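/- arXiv:0904.4004 — 3 statements merged into one kernel-verified Lean document; each statement's English description precedes it below -/
import Mathlib

section
/- Let K → P be an essentially smooth homomorphism of commutative noetherian rings of relative dimension d. Then there is an isomorphism of P-modules Ext^d_{Pᵉ}(P, Pᵉ) ≅ Hom_P(Ω^d_{P|K}, P), where Ω^d_{P|K} = ⋀^d_P Ω¹_{P|K}. In particular Ext^d_{Pᵉ}(P, Pᵉ) is an invertible P-module. -/
/-!
STATEMENT 5: For `K → P` essentially smooth of relative dimension `d`,
`Ext^d_{Pᵉ}(P, Pᵉ) ≅ Hom_P(Ω^d_{P|K}, P)` as `P`-modules, where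
`Ω^d_{P|K} = ⋀^d Ω¹_{P|K}`; in particular `Ext^d_{Pᵉ}(P, Pᵉ)` is an invertible
(i.e. finite projective of rank one) `P`-module.
-/

open CategoryTheory TensorProduct

def EssentiallySmooth (K P : Type) [CommRing K] [CommRing P] [Algebra K P] : Prop :=
  Algebra.EssFiniteType K P ∧ Module.Flat K P ∧ Algebra.FormallySmooth K P

def RelDim (K P : Type) [CommRing K] [CommRing P] [Algebra K P] (d : ℕ) : Prop :=
  Module.Finite P (Ω[P⁄K]) ∧ Module.Projective P (Ω[P⁄K]) ∧
    ∀ (p : Ideal P) (_ : p.IsPrime),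
      Module.rank (Localization.AtPrime p) (LocalizedModule p.primeCompl (Ω[P⁄K])) = d

section TwistedComplexes

theorem exists_seq_of_step {A : ℕ → Type*} (r : ∀ n, A n → A (n + 1) → Prop)
    {a : A 0} {b : A 1} (h0 : r 0 a b)
    (hs : ∀ n a b, r n a b → ∃ c, r (n + 1) b c) :
    ∃ s : ∀ n, A n, s 0 = a ∧ ∀ n, r n (s n) (s (n + 1)) := by
  choose next hnext using hs
  let T : ℕ → Type _ := fun n ↦ {p : A n × A (n + 1) // r n p.1 p.2}
  let t : ∀ n, T n := fun n ↦ Nat.rec (motive := T) ⟨(a, b), h0⟩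
    (fun n p ↦ ⟨(p.1.2, next n _ _ p.2), hnext n _ _ p.2⟩) n
  exact ⟨fun n ↦ (t n).1.1, rfl, fun n ↦ (t n).2⟩

variable {R : Type*} [CommRing R]

theorem Module.Projective.exists_comp_eq {X Y Z : Type*} [AddCommGroup X] [AddCommGroup Y]
    [AddCommGroup Z] [Module R X] [Module R Y] [Module R Z] [Module.Projective R X]
    (g : X →ₗ[R] Y) (h : Z →ₗ[R] Y) (hgh : ∀ x, ∃ z, h z = g x) :
    ∃ k : X →ₗ[R] Z, h ∘ₗ k = g := by
  obtain ⟨k, hk⟩ := Module.projective_lifting_property h.rangeRestrict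
    (g.codRestrict (LinearMap.range h) hgh) h.surjective_rangeRestrict
  refine ⟨k, LinearMap.ext fun x ↦ ?_⟩
  exact congrArg Subtype.val (LinearMap.congr_fun hk x)

variable {M N : Type*} [AddCommGroup M] [Module R M] [AddCommGroup N] [Module R N]
  {X Y : ℕ → Type*}
  [∀ n, AddCommGroup (X n)] [∀ n, Module R (X n)] [∀ n, AddCommGroup (Y n)] [∀ n, Module R (Y n)]

/-- The data of an augmented complex `⋯ → X 1 → X 0 → M`, the homology of which is killed
by `f`. -/
structure IsAcyclicUpTo (f : R) (d : ∀ n, X (n + 1) →ₗ[R] X n) (ε : X 0 →ₗ[R] M) : Prop where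
  surjective : Function.Surjective ε
  aug_d : ∀ x, ε (d 0 x) = 0
  d_d : ∀ n x, d n (d (n + 1) x) = 0
  exact_zero : ∀ x, ε x = 0 → ∃ y, d 0 y = f • x
  exact_succ : ∀ n x, d n x = 0 → ∃ y, d (n + 1) y = f • x

/-- The linear forms on `X n` with values in `N` that extend along the differential out of `X n`. -/
def coboundaries (N : Type*) [AddCommGroup N] [Module R N] (d : ∀ n, X (n + 1) →ₗ[R] X n) :
    ∀ n, Submodule R (X n →ₗ[R] N)
  | 0 => ⊥
  | n + 1 => LinearMap.range (LinearMap.lcomp R N (d n))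

variable {f g : R} {dX : ∀ n, X (n + 1) →ₗ[R] X n} {εX : X 0 →ₗ[R] M}
  {dY : ∀ n, Y (n + 1) →ₗ[R] Y n} {εY : Y 0 →ₗ[R] M}

theorem mem_coboundaries_succ {n : ℕ} {c : X (n + 1) →ₗ[R] N} :
    c ∈ coboundaries N dX (n + 1) ↔ ∃ b : X n →ₗ[R] N, b ∘ₗ dX n = c := Iff.rfl

theorem IsAcyclicUpTo.exists_twisted_lift [∀ n, Module.Projective R (X n)]
    (hX : IsAcyclicUpTo g dX εX) (hY : IsAcyclicUpTo f dY εY) :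
    ∃ β : ∀ n, X n →ₗ[R] Y n, εY ∘ₗ β 0 = εX ∧ ∀ n, dY n ∘ₗ β (n + 1) = f • (β n ∘ₗ dX n) := by
  obtain ⟨β₀, h₀⟩ := Module.Projective.exists_comp_eq εX εY fun x ↦ hY.surjective _
  obtain ⟨β₁, h₁⟩ := Module.Projective.exists_comp_eq (f • (β₀ ∘ₗ dX 0)) (dY 0) fun x ↦
    hY.exact_zero _ (by simpa [hX.aug_d] using LinearMap.congr_fun h₀ (dX 0 x))
  obtain ⟨β, rfl, hβ⟩ := exists_seq_of_step (A := fun n ↦ X n →ₗ[R] Y n)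
    (fun n a b ↦ dY n ∘ₗ b = f • (a ∘ₗ dX n)) h₁ fun n a b hab ↦
      Module.Projective.exists_comp_eq (f • (b ∘ₗ dX (n + 1))) (dY (n + 1)) fun x ↦
        hY.exact_succ _ _ (by simpa [hX.d_d] using LinearMap.congr_fun hab (dX (n + 1) x))
  exact ⟨β, h₀, hβ⟩

theorem IsAcyclicUpTo.exists_twisted_homotopy [∀ n, Module.Projective R (X n)] {f' : R}
    (hX : IsAcyclicUpTo f' dX εX) (hY : IsAcyclicUpTo f dY εY) (γ : ∀ n, X n →ₗ[R] Y n)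
    (h₀ : ∀ x, εY (γ 0 x) = 0) (hγ : ∀ n x, dY n (γ (n + 1) x) = g • γ n (dX n x)) :
    ∃ k : ∀ n, X n →ₗ[R] Y (n + 1), (∀ x, f • γ 0 x = dY 0 (k 0 x)) ∧
      ∀ n x, f ^ (n + 2) • γ (n + 1) x
        = dY (n + 1) (k (n + 1) x) + (f * g) • k n (dX n x) := by
  obtain ⟨k₀, hk₀⟩ := Module.Projective.exists_comp_eq (f • γ 0) (dY 0) fun x ↦
    hY.exact_zero _ (h₀ x)
  replace hk₀ : ∀ x, dY 0 (k₀ x) = f • γ 0 x := LinearMap.congr_fun hk₀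
  obtain ⟨k₁, hk₁⟩ := Module.Projective.exists_comp_eq
    (f • (f • γ 1 - g • (k₀ ∘ₗ dX 0))) (dY 1) fun x ↦
      hY.exact_succ _ _ (by simp [hγ, hk₀, smul_comm f g])
  replace hk₁ : ∀ x, dY 1 (k₁ x) = f • (f • γ 1 x - g • k₀ (dX 0 x)) := LinearMap.congr_fun hk₁
  obtain ⟨k, rfl, hk⟩ := exists_seq_of_step (A := fun n ↦ X n →ₗ[R] Y (n + 1))
    (fun n a b ↦ ∀ x, f ^ (n + 2) • γ (n + 1) x = dY (n + 1) (b x) + (f * g) • a (dX n x))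
    (a := k₀) (b := k₁) (fun x ↦ by rw [hk₁]; module) fun n a b hab ↦ by
      obtain ⟨c, hc⟩ := Module.Projective.exists_comp_eq
        (f • (f ^ (n + 2) • γ (n + 2) - g • (b ∘ₗ dX (n + 1)))) (dY (n + 2)) fun x ↦
          hY.exact_succ _ _ (by
            have := hab (dX (n + 1) x)
            simp only [hX.d_d, map_zero, smul_zero, add_zero] at this
            simp [hγ, ← this, smul_comm g])
      refine ⟨c, fun x ↦ ?_⟩
      have := LinearMap.congr_fun hc x
      simp only [LinearMap.comp_apply, LinearMap.smul_apply, LinearMap.sub_apply] at this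
      rw [this]
      module
  exact ⟨k, fun x ↦ (hk₀ x).symm, hk⟩

theorem IsAcyclicUpTo.comp_mem_coboundaries [∀ n, Module.Projective R (X n)]
    (hX : IsAcyclicUpTo f dX εX) (γ : ∀ n, X n →ₗ[R] X n)
    (h₀ : ∀ x, εX (γ 0 x) = 0) (hγ : ∀ n x, dX n (γ (n + 1) x) = g • γ n (dX n x))
    (n : ℕ) (c : X n →ₗ[R] N) (hc : c ∘ₗ dX n = 0) :
    f ^ (n + 1) • (c ∘ₗ γ n) ∈ coboundaries N dX n := by
  obtain ⟨k, hk₀, hk⟩ := hX.exists_twisted_homotopy hX γ h₀ hγ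
  replace hc : ∀ x, c (dX n x) = 0 := LinearMap.congr_fun hc
  cases n with
  | zero =>
    refine (Submodule.mem_bot R).mpr (LinearMap.ext fun x ↦ ?_)
    change f ^ 1 • c (γ 0 x) = 0
    rw [pow_one, ← map_smul, hk₀, hc]
  | succ n =>
    refine ⟨(f * g) • (c ∘ₗ k n), LinearMap.ext fun x ↦ ?_⟩
    change (f * g) • c (k n (dX n x)) = f ^ (n + 2) • c (γ (n + 1) x)
    rw [← map_smul c (f ^ (n + 2)), hk, map_add, hc, zero_add, map_smul]

theorem comp_mem_coboundaries_of_twisted (β : ∀ n, X n →ₗ[R] Y n)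
    (hβ : ∀ n, dY n ∘ₗ β (n + 1) = f • (β n ∘ₗ dX n)) (n : ℕ) {c : Y n →ₗ[R] N}
    (hc : c ∈ coboundaries N dY n) : c ∘ₗ β n ∈ coboundaries N dX n := by
  cases n with
  | zero => simp [(Submodule.mem_bot R).mp hc]
  | succ n =>
    obtain ⟨b, rfl⟩ := hc
    exact ⟨f • (b ∘ₗ β n), by ext x; simpa using congrArg b (LinearMap.congr_fun (hβ n) x).symm⟩

/-- If `X` is a projective resolution of `M = N/I` and `Y` is a complex of projectives resolving
`M` up to an element `f` acting as the identity on `M`, then the cohomology in degree `n` of the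
dual of `X` can be read off from `Y` as soon as `Y (n + 1) = 0`. -/
theorem IsAcyclicUpTo.exists_top_cohomology_map [∀ n, Module.Projective R (X n)]
    [∀ n, Module.Projective R (Y n)] (hX : IsAcyclicUpTo 1 dX εX) (hY : IsAcyclicUpTo f dY εY)
    (hf : ∀ m : M, f • m = m) (μ : N →ₗ[R] M) (hμ : Function.Surjective μ) (n : ℕ)
    [Subsingleton (Y (n + 1))]
    (hY₁ : ∀ c ∈ coboundaries N dY n, μ ∘ₗ c = 0)
    (hY₂ : ∀ c : Y n →ₗ[R] N, μ ∘ₗ c = 0 → f • c ∈ coboundaries N dY n) :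
    ∃ Φ : (X n →ₗ[R] N) →ₗ[R] (Y n →ₗ[R] M),
      (∀ c ∈ coboundaries N dX n, Φ c = 0) ∧
      (∀ c, c ∘ₗ dX n = 0 → Φ c = 0 → c ∈ coboundaries N dX n) ∧
      ∀ g, ∃ c, c ∘ₗ dX n = 0 ∧ Φ c = g := by
  have hf' : ∀ k : ℕ, ∀ m : M, f ^ k • m = m := fun k m ↦ by
    induction k with
    | zero => simp
    | succ k ih => rw [pow_succ, mul_smul, hf, ih]
  obtain ⟨α, hα₀, hα⟩ := hY.exists_twisted_lift hX
  obtain ⟨β, hβ₀, hβ⟩ := hX.exists_twisted_lift hY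
  have hα₀' : ∀ x, εX (α 0 x) = εY x := LinearMap.congr_fun hα₀
  have hβ₀' : ∀ x, εY (β 0 x) = εX x := LinearMap.congr_fun hβ₀
  have hα' : ∀ n x, dX n (α (n + 1) x) = α n (dY n x) := fun n x ↦ by
    simpa using LinearMap.congr_fun (hα n) x
  have hβ' : ∀ n x, dY n (β (n + 1) x) = f • β n (dX n x) := fun n ↦ LinearMap.congr_fun (hβ n)
  refine ⟨LinearMap.llcomp R (Y n) N M μ ∘ₗ LinearMap.lcomp R N (α n), fun c hc ↦
    hY₁ _ (comp_mem_coboundaries_of_twisted α hα n hc), fun c hc h ↦ ?_, fun g ↦ ?_⟩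
  · have key₁ : f • (c ∘ₗ α n ∘ₗ β n) ∈ coboundaries N dX n :=
      comp_mem_coboundaries_of_twisted β hβ n (hY₂ _ h)
    have key₂ := hX.comp_mem_coboundaries (g := f) (fun n ↦ α n ∘ₗ β n - f ^ n • LinearMap.id)
      (by simp [hα₀', hβ₀']) (by intro n x; simp [hα', hβ', smul_sub, pow_succ', mul_smul]) n c hc
    have key₃ := hX.comp_mem_coboundaries (g := 1) (fun n ↦ (1 - f) • LinearMap.id)
      (by simp [sub_smul, hf]) (by simp) n c hc
    have key₄ : f ^ (n + 1) • c ∈ coboundaries N dX n := by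
      convert sub_mem key₁ (Submodule.smul_mem _ f key₂) using 1
      ext x
      simp [smul_sub, pow_succ', mul_smul]
    have key₅ : ∀ k, f ^ k • c ∈ coboundaries N dX n → c ∈ coboundaries N dX n := fun k hk ↦ by
      induction k with
      | zero => simpa using hk
      | succ k ih =>
        refine ih ?_
        convert add_mem hk (Submodule.smul_mem _ (f ^ k) key₃) using 1
        ext x
        simp [sub_smul, smul_sub, pow_succ, mul_smul]
    exact key₅ _ key₄
  · obtain ⟨g', rfl⟩ := Module.projective_lifting_property μ g hμ
    refine ⟨f • (g' ∘ₗ β n), LinearMap.ext fun x ↦ ?_, LinearMap.ext fun x ↦ ?_⟩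
    · simp only [LinearMap.comp_apply, LinearMap.smul_apply, LinearMap.zero_apply]
      rw [← map_smul, ← hβ', Subsingleton.elim (β (n + 1) x) 0, map_zero, map_zero]
    · have key := hY₁ _ (hY.comp_mem_coboundaries (g := f)
        (fun n ↦ β n ∘ₗ α n - f ^ n • LinearMap.id) (by simp [hα₀', hβ₀'])
        (by intro n x; simp [hα', hβ', smul_sub, pow_succ', mul_smul]) n g'
        (LinearMap.ext fun x ↦ by rw [Subsingleton.elim x 0]; simp))
      have := LinearMap.congr_fun key x
      simp only [LinearMap.comp_apply, LinearMap.smul_apply, LinearMap.sub_apply, map_smul,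
        map_sub, hf', LinearMap.id_apply, LinearMap.zero_apply, sub_eq_zero] at this
      simp [hf, this]

end TwistedComplexes

section ExtCocycles

theorem CategoryTheory.ShortComplex.exists_ker_surjection {R : Type} [CommRing R]
    (S : ShortComplex (ModuleCat.{0} R)) :
    ∃ π : LinearMap.ker S.g.hom →ₗ[R] S.homology, Function.Surjective π ∧
      ∀ z, π z = 0 ↔ ∃ x, S.f.hom x = z := by
  let q : LinearMap.ker S.g.hom →ₗ[R] S.moduleCatLeftHomologyData.H :=
    (LinearMap.range S.moduleCatToCycles).mkQ
  let e : S.moduleCatLeftHomologyData.H ≃ₗ[R] S.homology :=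
    S.moduleCatHomologyIso.symm.toLinearEquiv
  refine ⟨e.toLinearMap ∘ₗ q, e.surjective.comp (Submodule.mkQ_surjective _), fun z ↦ ?_⟩
  rw [LinearMap.comp_apply, LinearEquiv.coe_coe, LinearEquiv.map_eq_zero_iff]
  refine (Submodule.Quotient.mk_eq_zero _).trans ?_
  exact ⟨fun ⟨x, hx⟩ ↦ ⟨x, congr_arg Subtype.val hx⟩, fun ⟨x, hx⟩ ↦ ⟨x, Subtype.ext hx⟩⟩

theorem CochainComplex.exists_cycles_surjection {R : Type} [CommRing R]
    (C : CochainComplex (ModuleCat.{0} R) ℕ) (n : ℕ) :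
    ∃ π : LinearMap.ker (C.d n (n + 1)).hom →ₗ[R] C.homology n, Function.Surjective π ∧
      ∀ z, π z = 0 ↔ ∃ x, (C.d ((ComplexShape.up ℕ).prev n) n).hom x = z := by
  have h := (C.sc n).exists_ker_surjection
  have e : (ComplexShape.up ℕ).next n = n + 1 := by simp
  change ∃ π : LinearMap.ker (C.d n ((ComplexShape.up ℕ).next n)).hom →ₗ[R] C.homology n,
    Function.Surjective π ∧
      ∀ z, π z = 0 ↔ ∃ x, (C.d ((ComplexShape.up ℕ).prev n) n).hom x = z.1 at h
  rw [e] at h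
  exact h

variable {R : Type} [CommRing R] {M N : Type} [AddCommGroup M] [AddCommGroup N]
  [Module R M] [Module R N]

/-- The terms of a projective resolution as modules. -/
abbrev CategoryTheory.ProjectiveResolution.obj
    (Q : ProjectiveResolution (ModuleCat.of R M)) (n : ℕ) : Type :=
  Q.complex.X n

/-- The differentials of a projective resolution as linear maps. -/
noncomputable def CategoryTheory.ProjectiveResolution.dHom
    (Q : ProjectiveResolution (ModuleCat.of R M)) (n : ℕ) :
    Q.obj (n + 1) →ₗ[R] Q.obj n :=
  (Q.complex.d (n + 1) n).hom

/-- The augmentation of a projective resolution as a linear map. -/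
noncomputable def CategoryTheory.ProjectiveResolution.augHom
    (Q : ProjectiveResolution (ModuleCat.of R M)) : Q.obj 0 →ₗ[R] M :=
  (Q.π.f 0).hom

theorem CategoryTheory.ProjectiveResolution.isAcyclicUpTo
    (Q : ProjectiveResolution (ModuleCat.of R M)) : IsAcyclicUpTo (X := Q.obj) 1 Q.dHom Q.augHom where
  surjective := (ModuleCat.epi_iff_surjective _).1 (inferInstanceAs (Epi (Q.π.f 0)))
  aug_d x := LinearMap.congr_fun (congr_arg ModuleCat.Hom.hom Q.complex_d_comp_π_f_zero) x
  d_d n x := LinearMap.congr_fun (congr_arg ModuleCat.Hom.hom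
    (Q.complex.d_comp_d (n + 2) (n + 1) n)) x
  exact_zero x hx := by
    obtain ⟨y, hy⟩ := (ShortComplex.moduleCat_exact_iff _).1 Q.exact₀ x hx
    exact ⟨y, hy.trans (one_smul R x).symm⟩
  exact_succ n x hx := by
    obtain ⟨y, hy⟩ := (ShortComplex.moduleCat_exact_iff _).1 (Q.exact_succ n) x hx
    exact ⟨y, hy.trans (one_smul R x).symm⟩

theorem CategoryTheory.ProjectiveResolution.exists_cocycles_surjection
    (Q : ProjectiveResolution (ModuleCat.of R M)) (n : ℕ) :
    ∃ π : LinearMap.ker (LinearMap.lcomp R N (Q.dHom n)) →ₗ[R]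
      (((Ext R (ModuleCat R) n).obj (Opposite.op (ModuleCat.of R M))).obj (ModuleCat.of R N)),
      Function.Surjective π ∧ ∀ z, π z = 0 ↔ z.1 ∈ coboundaries (X := Q.obj) N Q.dHom n := by
  obtain ⟨π, hπ, hπ'⟩ := (Q.complex.linearYonedaObj R (ModuleCat.of R N)).exists_cycles_surjection n
  let e (k : ℕ) : (Q.complex.X k ⟶ ModuleCat.of R N) ≃ₗ[R] (Q.obj k →ₗ[R] N) :=
    ModuleCat.homLinearEquiv
  let r : LinearMap.ker (LinearMap.lcomp R N (Q.dHom n)) →ₗ[R] LinearMap.ker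
      ((Q.complex.linearYonedaObj R (ModuleCat.of R N)).d n (n + 1)).hom :=
    LinearMap.codRestrict _ ((e n).symm.toLinearMap ∘ₗ Submodule.subtype _)
      fun z ↦ ModuleCat.hom_ext z.2
  refine ⟨(Q.isoExt n (ModuleCat.of R N)).symm.toLinearEquiv.toLinearMap ∘ₗ π ∘ₗ r,
    (Q.isoExt n (ModuleCat.of R N)).symm.toLinearEquiv.surjective.comp (hπ.comp fun z ↦ ?_),
    fun z ↦ ?_⟩
  · exact ⟨⟨e n z.1, congr_arg ModuleCat.Hom.hom z.2⟩, Subtype.ext ((e n).symm_apply_apply z.1)⟩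
  · rw [LinearMap.comp_apply, LinearEquiv.coe_coe, LinearEquiv.map_eq_zero_iff,
      LinearMap.comp_apply, hπ']
    cases n with
    | zero =>
      rw [HomologicalComplex.shape _ _ _ (by simp)]
      constructor
      · rintro ⟨x, hx⟩
        exact (congr_arg (e 0) hx).symm
      · intro hz
        exact ⟨0, ((e 0).symm.map_eq_zero_iff.2 hz).symm⟩
    | succ n =>
      rw [CochainComplex.prev_nat_succ, mem_coboundaries_succ]
      constructor
      · rintro ⟨x, hx⟩
        exact ⟨e n x, congr_arg (e (n + 1)) hx⟩
      · rintro ⟨b, hb⟩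
        exact ⟨(e n).symm b, congr_arg (e (n + 1)).symm hb⟩

theorem IsAcyclicUpTo.nonempty_ext_equiv {Y : ℕ → Type} [∀ n, AddCommGroup (Y n)]
    [∀ n, Module R (Y n)] [∀ n, Module.Projective R (Y n)] {f : R}
    {dY : ∀ n, Y (n + 1) →ₗ[R] Y n} {εY : Y 0 →ₗ[R] M} (hY : IsAcyclicUpTo f dY εY)
    (hf : ∀ m : M, f • m = m) (μ : N →ₗ[R] M) (hμ : Function.Surjective μ) (n : ℕ)
    [Subsingleton (Y (n + 1))]
    (hY₁ : ∀ c ∈ coboundaries N dY n, μ ∘ₗ c = 0)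
    (hY₂ : ∀ c : Y n →ₗ[R] N, μ ∘ₗ c = 0 → f • c ∈ coboundaries N dY n) :
    Nonempty ((((Ext R (ModuleCat R) n).obj (Opposite.op (ModuleCat.of R M))).obj
      (ModuleCat.of R N)) ≃ₗ[R] (Y n →ₗ[R] M)) := by
  let Q := ProjectiveResolution.of (ModuleCat.of R M)
  have : ∀ n, Module.Projective R (Q.obj n) := fun n ↦
    (IsProjective.iff_projective _).2 (Q.projective n)
  obtain ⟨Φ, h₁, h₂, h₃⟩ :=
    Q.isAcyclicUpTo.exists_top_cohomology_map hY hf μ hμ n hY₁ hY₂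
  obtain ⟨π, hπ, hπ'⟩ := Q.exists_cocycles_surjection (N := N) n
  let Ψ := Φ ∘ₗ (LinearMap.ker (LinearMap.lcomp R N (Q.dHom n))).subtype
  have hΨ : Function.Surjective Ψ := fun g ↦ by
    obtain ⟨c, hc, rfl⟩ := h₃ g
    exact ⟨⟨c, hc⟩, rfl⟩
  have hker : LinearMap.ker π = LinearMap.ker Ψ := by
    ext z
    rw [LinearMap.mem_ker, hπ', LinearMap.mem_ker]
    exact ⟨h₁ _, h₂ _ z.2⟩
  exact ⟨(π.quotKerEquivOfSurjective hπ).symm.trans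
    ((Submodule.quotEquivOfEq _ _ hker).trans (Ψ.quotKerEquivOfSurjective hΨ))⟩

end ExtCocycles

section Koszul

variable {R F G : Type*} [CommRing R] [AddCommGroup F] [Module R F] [AddCommGroup G] [Module R G]

namespace ExteriorAlgebra

/-- The Koszul differential on the exterior algebra: contraction with a linear form. -/
noncomputable def koszul (φ : F →ₗ[R] R) : ExteriorAlgebra R F →ₗ[R] ExteriorAlgebra R F :=
  CliffordAlgebra.contractLeft φ

theorem koszul_algebraMap (φ : F →ₗ[R] R) (r : R) : koszul φ (algebraMap R _ r) = 0 :=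
  CliffordAlgebra.contractLeft_algebraMap _ _ r

theorem koszul_one (φ : F →ₗ[R] R) : koszul φ 1 = 0 :=
  CliffordAlgebra.contractLeft_one _ _

theorem koszul_ι_mul (φ : F →ₗ[R] R) (v : F) (x : ExteriorAlgebra R F) :
    koszul φ (ι R v * x) = φ v • x - ι R v * koszul φ x :=
  CliffordAlgebra.contractLeft_ι_mul _ _ _

theorem koszul_koszul (φ : F →ₗ[R] R) (x : ExteriorAlgebra R F) : koszul φ (koszul φ x) = 0 :=
  CliffordAlgebra.contractLeft_contractLeft _ x

/-- Every element of the exterior algebra is a combination of products beginning with a vector. -/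
theorem induction_ι_mul {p : ExteriorAlgebra R F → Prop} (x : ExteriorAlgebra R F)
    (algebraMap : ∀ r, p (algebraMap R _ r)) (add : ∀ x y, p x → p y → p (x + y))
    (ι_mul : ∀ v x, p x → p (ι R v * x)) : p x :=
  CliffordAlgebra.left_induction _ algebraMap add (fun x v h ↦ ι_mul v x h) x

theorem koszul_map (g : F →ₗ[R] G) (φ : G →ₗ[R] R) (x : ExteriorAlgebra R F) :
    koszul φ (map g x) = map g (koszul (φ ∘ₗ g) x) := by
  induction x using induction_ι_mul with
  | algebraMap r => rw [AlgHom.commutes, koszul_algebraMap, koszul_algebraMap, map_zero]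
  | add x y hx hy => simp only [map_add, hx, hy]
  | ι_mul v x hx =>
    simp only [map_mul, map_apply_ι, koszul_ι_mul, hx, map_sub, map_smul, LinearMap.comp_apply]

theorem koszul_smul (φ : F →ₗ[R] R) (s : R) (x : ExteriorAlgebra R F) :
    koszul (s • φ) x = s • koszul φ x := by
  simp [koszul]

theorem koszul_mem_exteriorPower (φ : F →ₗ[R] R) {n : ℕ} {x : ExteriorAlgebra R F}
    (hx : x ∈ ⋀[R]^(n + 1) F) : koszul φ x ∈ ⋀[R]^n F := by
  induction n generalizing x with
  | zero =>
    rw [exteriorPower, zero_add, pow_one] at hx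
    obtain ⟨v, rfl⟩ := hx
    have := koszul_ι_mul φ v 1
    rw [mul_one, koszul_one, mul_zero, sub_zero] at this
    rw [this, exteriorPower, pow_zero]
    exact Submodule.smul_mem _ _ (Submodule.one_le.1 le_rfl)
  | succ n ih =>
    rw [exteriorPower, pow_succ'] at hx
    induction hx using Submodule.mul_induction_on' with
    | mem_mul_mem a ha b hb =>
      obtain ⟨v, rfl⟩ := ha
      rw [koszul_ι_mul]
      refine sub_mem (Submodule.smul_mem _ _ hb) ?_
      rw [exteriorPower, pow_succ']
      exact Submodule.mul_mem_mul ⟨v, rfl⟩ (ih hb)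
    | add a _ b _ ha hb => rw [map_add]; exact add_mem ha hb

theorem koszul_mem_smul (φ : F →ₗ[R] R) {I : Ideal R} (hI : ∀ v, φ v ∈ I) {n : ℕ}
    {x : ExteriorAlgebra R F} (hx : x ∈ ⋀[R]^(n + 1) F) : koszul φ x ∈ I • ⋀[R]^n F := by
  induction n generalizing x with
  | zero =>
    rw [exteriorPower, zero_add, pow_one] at hx
    obtain ⟨v, rfl⟩ := hx
    have := koszul_ι_mul φ v 1
    rw [mul_one, koszul_one, mul_zero, sub_zero] at this
    rw [this, exteriorPower, pow_zero]
    exact Submodule.smul_mem_smul (hI v) (Submodule.one_le.1 le_rfl)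
  | succ n ih =>
    rw [exteriorPower, pow_succ'] at hx
    induction hx using Submodule.mul_induction_on' with
    | mem_mul_mem a ha b hb =>
      obtain ⟨v, rfl⟩ := ha
      rw [koszul_ι_mul]
      refine sub_mem (Submodule.smul_mem_smul (hI v) hb) ?_
      refine Submodule.smul_induction_on (p := fun z ↦ ExteriorAlgebra.ι R v * z ∈ _) (ih hb)
        (fun r hr z hz ↦ ?_) fun y z hy hz ↦ ?_
      · rw [mul_smul_comm, exteriorPower, pow_succ']
        exact Submodule.smul_mem_smul hr (Submodule.mul_mem_mul ⟨v, rfl⟩ hz)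
      · rw [mul_add]
        exact add_mem hy hz
    | add a _ b _ ha hb => rw [map_add]; exact add_mem ha hb

end ExteriorAlgebra

/-- The differential of the Koszul complex of a linear form. -/
noncomputable def exteriorPower.koszul (φ : F →ₗ[R] R) (n : ℕ) : ⋀[R]^(n + 1) F →ₗ[R] ⋀[R]^n F :=
  (ExteriorAlgebra.koszul φ).restrict fun _ ↦ ExteriorAlgebra.koszul_mem_exteriorPower φ

theorem exteriorPower.coe_koszul (φ : F →ₗ[R] R) (n : ℕ) (x : ⋀[R]^(n + 1) F) :
    (exteriorPower.koszul φ n x : ExteriorAlgebra R F) = ExteriorAlgebra.koszul φ x := rfl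

theorem exteriorPower.comp_koszul_eq_zero {M : Type*} [AddCommGroup M] [Module R M]
    (φ : F →ₗ[R] R) (hφ : ∀ v, ∀ m : M, φ v • m = 0) {n : ℕ} (k : ⋀[R]^n F →ₗ[R] M) :
    k ∘ₗ exteriorPower.koszul φ n = 0 := by
  refine LinearMap.ext fun x ↦ ?_
  have key : ∀ y ∈ Module.annihilator R M • ⋀[R]^n F, ∀ h : y ∈ ⋀[R]^n F, k ⟨y, h⟩ = 0 := by
    intro y hy
    induction hy using Submodule.smul_induction_on' with
    | smul r hr z hz =>
      intro h
      exact (k.map_smul r ⟨z, hz⟩).trans (Module.mem_annihilator.1 hr _)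
    | add a ha b hb iha ihb =>
      intro h
      have := k.map_add ⟨a, Submodule.smul_le_right ha⟩ ⟨b, Submodule.smul_le_right hb⟩
      rw [iha, ihb, add_zero] at this
      exact this
  exact key _ (ExteriorAlgebra.koszul_mem_smul φ
    (fun v ↦ Module.mem_annihilator.2 (hφ v)) x.2) _

instance exteriorPower.projective [Module.Projective R F] (n : ℕ) :
    Module.Projective R (⋀[R]^n F) := by
  obtain ⟨s, hs⟩ := Module.projective_def'.1 (inferInstance : Module.Projective R F)
  refine Module.Projective.of_split (exteriorPower.map n s)
    (exteriorPower.map n (Finsupp.linearCombination R id)) ?_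
  rw [← exteriorPower.map_comp, hs, exteriorPower.map_id]

theorem exteriorPower.ι_mul_mem (v : F) {n : ℕ} {x : ExteriorAlgebra R F} (hx : x ∈ ⋀[R]^n F) :
    ExteriorAlgebra.ι R v * x ∈ ⋀[R]^(n + 1) F := by
  rw [ExteriorAlgebra.exteriorPower, pow_succ']
  exact Submodule.mul_mem_mul ⟨v, rfl⟩ hx

/-- Left multiplication by a vector, as a map between exterior powers. -/
noncomputable def exteriorPower.ιMul (v : F) (n : ℕ) : ⋀[R]^n F →ₗ[R] ⋀[R]^(n + 1) F :=
  (LinearMap.mulLeft R (ExteriorAlgebra.ι R v)).restrict fun _ ↦ exteriorPower.ι_mul_mem v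

theorem exteriorPower.ιMul_koszul (φ : F →ₗ[R] R) (n : ℕ) [Subsingleton (⋀[R]^(n + 2) F)] (v : F)
    (x : ⋀[R]^(n + 1) F) :
    exteriorPower.ιMul v n (exteriorPower.koszul φ n x) = φ v • x := by
  have h : exteriorPower.koszul φ (n + 1) (exteriorPower.ιMul v (n + 1) x) = 0 := by
    rw [Subsingleton.elim (exteriorPower.ιMul v (n + 1) x) 0, map_zero]
  have h' : ExteriorAlgebra.koszul φ (ExteriorAlgebra.ι R v * x) = 0 := congr_arg Subtype.val h
  rw [ExteriorAlgebra.koszul_ι_mul, sub_eq_zero] at h'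
  exact Subtype.ext h'.symm

theorem exteriorPower.comp_mem_coboundaries [Module.Finite R F] [Module.Projective R F]
    (φ : F →ₗ[R] R) (n : ℕ) [Subsingleton (⋀[R]^(n + 1) F)] (c : ⋀[R]^n F →ₗ[R] F) :
    φ ∘ₗ c ∈ coboundaries (X := fun n ↦ ⋀[R]^n F) R (exteriorPower.koszul φ) n := by
  cases n with
  | zero =>
    have : Subsingleton F := (exteriorPower.oneEquiv (R := R) (M := F)).symm.subsingleton
    rw [Subsingleton.elim c 0, LinearMap.comp_zero]
    exact zero_mem _
  | succ n =>
    obtain ⟨m, p, u, -, -, hu⟩ :=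
      Module.Finite.exists_comp_eq_id_of_projective R (⋀[R]^(n + 1) F)
    let e (i : Fin m) : Fin m → R := Pi.single i 1
    refine mem_coboundaries_succ.2 ⟨∑ i, LinearMap.proj i ∘ₗ u ∘ₗ
      exteriorPower.ιMul (c (p (e i))) n, LinearMap.ext fun x ↦ ?_⟩
    have hx : x = ∑ i, u x i • p (e i) := by
      conv_lhs => rw [← LinearMap.id_apply (R := R) x, ← hu, LinearMap.comp_apply,
        ← Finset.univ_sum_single (u x), map_sum]
      refine Finset.sum_congr rfl fun i _ ↦ ?_
      rw [← map_smul]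
      simp [e, ← Pi.single_smul]
    conv_rhs => rw [hx]
    simp [exteriorPower.ιMul_koszul, mul_comm]

theorem exteriorPower.smul_mem_coboundaries [Module.Finite R F] [Module.Projective R F]
    (φ : F →ₗ[R] R) {M : Type*} [AddCommGroup M] [Module R M] (μ : R →ₗ[R] M) {f : R}
    (hf : ∀ r, μ r = 0 → f * r ∈ LinearMap.range φ) (n : ℕ) [Subsingleton (⋀[R]^(n + 1) F)]
    (c : ⋀[R]^n F →ₗ[R] R) (hc : μ ∘ₗ c = 0) :
    f • c ∈ coboundaries (X := fun n ↦ ⋀[R]^n F) R (exteriorPower.koszul φ) n := by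
  obtain ⟨k, hk⟩ := Module.Projective.exists_comp_eq (f • c) φ
    fun x ↦ hf _ (LinearMap.congr_fun hc x)
  rw [← hk]
  exact exteriorPower.comp_mem_coboundaries φ n k

end Koszul

section KoszulAcyclic

variable {R F G : Type*} [CommRing R] [AddCommGroup F] [Module R F] [AddCommGroup G] [Module R G]

namespace ExteriorAlgebra

theorem algebraMapInv_koszul_mem (φ : F →ₗ[R] R) (x : ExteriorAlgebra R F) :
    algebraMapInv (koszul φ x) ∈ LinearMap.range φ := by
  induction x using induction_ι_mul with
  | algebraMap r => rw [koszul_algebraMap, map_zero]; exact zero_mem _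
  | add x y hx hy => rw [map_add, map_add]; exact add_mem hx hy
  | ι_mul v x hx =>
    have h : algebraMapInv (ι R v) = 0 := by simp [algebraMapInv]
    rw [koszul_ι_mul, map_sub, map_mul, h, zero_mul, sub_zero, map_smul, smul_eq_mul, mul_comm,
      ← smul_eq_mul, ← map_smul]
    exact ⟨_, rfl⟩

theorem koszul_ι (φ : F →ₗ[R] R) (v : F) : koszul φ (ι R v) = algebraMap R _ (φ v) := by
  have := koszul_ι_mul φ v 1
  rwa [mul_one, koszul_one, mul_zero, sub_zero, ← Algebra.algebraMap_eq_smul_one] at this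

/-- Up to elements of `S`, the only homology of the Koszul complex of `φ` is in degree zero. -/
def IsKoszulAcyclic (S : Submonoid R) (φ : F →ₗ[R] R) : Prop :=
  ∀ y, koszul φ y = 0 → ∃ t ∈ S, ∃ z r, t • y = koszul φ z + algebraMap R _ r

theorem exists_map_add_ι_mul_map {i : F →ₗ[R] G} {p : G →ₗ[R] F} {v : G} {ξ : G →ₗ[R] R}
    (h : ∀ m, i (p m) + ξ m • v = m) (y : ExteriorAlgebra R G) :
    ∃ a b, y = map i a + ι R v * map i b := by
  induction y using induction_ι_mul with
  | algebraMap r => exact ⟨algebraMap R _ r, 0, by simp⟩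
  | add x y hx hy =>
    obtain ⟨a, b, rfl⟩ := hx
    obtain ⟨c, d, rfl⟩ := hy
    exact ⟨a + c, b + d, by simp only [map_add, mul_add]; abel⟩
  | ι_mul m y hy =>
    obtain ⟨a, b, rfl⟩ := hy
    refine ⟨ι R (p m) * a, ξ m • a - ι R (p m) * b, ?_⟩
    have h₁ : ι R m = ι R (i (p m)) + ξ m • ι R v := by rw [← map_smul, ← map_add, h]
    have h₂ : ι R (i (p m)) * ι R v = - (ι R v * ι R (i (p m))) :=
      eq_neg_of_add_eq_zero_left (ι_add_mul_swap _ _)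
    have h₃ : ι R v * ι R v = 0 := ι_sq_zero _
    simp only [h₁, map_mul, map_sub, map_smul, map_apply_ι, add_mul, mul_add, mul_sub,
      smul_mul_assoc, mul_smul_comm, ← mul_assoc, h₂, h₃]
    simp only [neg_mul, zero_mul, smul_zero, add_zero]
    abel

theorem eq_zero_of_map_add_ι_mul_map {i : F →ₗ[R] G} {p : G →ₗ[R] F} {v : G} {ξ : G →ₗ[R] R}
    (hpi : p ∘ₗ i = LinearMap.id) (hpv : p v = 0) (hξi : ξ ∘ₗ i = 0) (hξv : ξ v = 1)
    {a b : ExteriorAlgebra R F} (h : map i a + ι R v * map i b = 0) : a = 0 ∧ b = 0 := by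
  have hp : ∀ x, map p (map i x) = x := fun x ↦ by
    rw [← AlgHom.comp_apply, map_comp_map, hpi, map_id, AlgHom.id_apply]
  have hξ : ∀ x, koszul ξ (map i x) = 0 := fun x ↦ by
    rw [koszul_map, hξi, ← zero_smul R (0 : F →ₗ[R] R), koszul_smul, zero_smul, map_zero]
  constructor
  · have := congr_arg (map p) h
    simpa [hp, hpv] using this
  · have h₁ := congr_arg (koszul ξ) h
    rw [map_add, hξ, koszul_ι_mul, hξ, hξv, mul_zero, sub_zero, one_smul, zero_add, map_zero] at h₁
    rw [← hp b, h₁, map_zero]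

theorem IsKoszulAcyclic.of_split {S : Submonoid R} {φ : G →ₗ[R] R}
    {i : F →ₗ[R] G} {p : G →ₗ[R] F} {v : G} {ξ : G →ₗ[R] R}
    (hpi : p ∘ₗ i = LinearMap.id) (hpv : p v = 0) (hξi : ξ ∘ₗ i = 0) (hξv : ξ v = 1)
    (h : ∀ m, i (p m) + ξ m • v = m) (ih : IsKoszulAcyclic S (φ ∘ₗ i))
    (hS : ∀ r, φ v * r ∈ LinearMap.range (φ ∘ₗ i) →
      ∃ t ∈ S, t * r ∈ LinearMap.range (φ ∘ₗ i)) : IsKoszulAcyclic S φ := by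
  intro y hy
  obtain ⟨a, b, rfl⟩ := exists_map_add_ι_mul_map h y
  have hy' : map i (koszul (φ ∘ₗ i) a + φ v • b) + ι R v * map i (- koszul (φ ∘ₗ i) b) = 0 := by
    rw [← hy, map_add (koszul φ), koszul_ι_mul, koszul_map, koszul_map]
    simp only [map_add, map_neg, map_smul, mul_neg]
    abel
  obtain ⟨ha, hb⟩ := eq_zero_of_map_add_ι_mul_map hpi hpv hξi hξv hy'
  obtain ⟨t₁, ht₁, c, r, hc⟩ := ih b (neg_eq_zero.1 hb)
  have hr : φ v * r ∈ LinearMap.range (φ ∘ₗ i) := by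
    have : algebraMap R _ (φ v * r) = koszul (φ ∘ₗ i) (- (t₁ • a + φ v • c)) := by
      have h₁ : algebraMap R (ExteriorAlgebra R F) r = t₁ • b - koszul (φ ∘ₗ i) c := by
        rw [hc]; abel
      rw [Algebra.algebraMap_eq_smul_one, mul_smul, ← Algebra.algebraMap_eq_smul_one, h₁,
        map_neg, map_add, map_smul, map_smul, eq_neg_of_add_eq_zero_left ha, smul_sub, smul_neg,
        smul_comm t₁]
      abel
    have h₂ := algebraMapInv_koszul_mem (φ ∘ₗ i) (- (t₁ • a + φ v • c))
    rwa [← this, algebraMap_leftInverse] at h₂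
  obtain ⟨t₂, ht₂, m, hm⟩ := hS r hr
  obtain ⟨c', hc'⟩ : ∃ c', (t₂ * t₁) • b = koszul (φ ∘ₗ i) c' := by
    refine ⟨t₂ • c + ι R m, ?_⟩
    rw [mul_smul, hc, map_add, koszul_ι, hm, map_smul, smul_add, map_mul, Algebra.smul_def t₂
      (algebraMap _ _ r)]
  obtain ⟨t₃, ht₃, e, s, he⟩ := ih ((t₂ * t₁) • a + φ v • c') (by
    rw [map_add, map_smul, map_smul, ← hc', eq_neg_of_add_eq_zero_left ha, smul_neg, smul_comm]
    abel)
  refine ⟨t₃ * (t₂ * t₁), mul_mem ht₃ (mul_mem ht₂ ht₁), map i e - ι R v * map i (t₃ • c'), s, ?_⟩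
  have he' : t₃ • (t₂ * t₁) • a = koszul (φ ∘ₗ i) e + algebraMap R _ s - t₃ • φ v • c' := by
    rw [← he]; simp only [smul_add]; abel
  rw [mul_smul, smul_add, smul_add, ← map_smul, ← map_smul, he', ← mul_smul_comm, ← mul_smul_comm,
    ← map_smul, ← map_smul, hc', map_sub (koszul φ), koszul_ι_mul, koszul_map, koszul_map]
  simp only [map_add, map_sub, map_smul, AlgHom.commutes, smul_comm t₃]
  abel

end ExteriorAlgebra

end KoszulAcyclic

section KoszulRegular

open ExteriorAlgebra

variable {R F G : Type*} [CommRing R] [AddCommGroup F] [Module R F] [AddCommGroup G] [Module R G]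

theorem ExteriorAlgebra.isKoszulAcyclic_of_regular {S : Submonoid R} {k : ℕ} (x : Fin k → R)
    (hx : ∀ j r, x j * r ∈ Ideal.span (x '' Set.Iio j) →
      ∃ t ∈ S, t * r ∈ Ideal.span (x '' Set.Iio j)) :
    IsKoszulAcyclic S (Fintype.linearCombination R x) := by
  induction k with
  | zero =>
    intro y hy
    clear hy
    refine ⟨1, S.one_mem, 0, ?_⟩
    induction y using induction_ι_mul with
    | algebraMap r => exact ⟨r, by simp⟩
    | add a b ha hb =>
      obtain ⟨r, hr⟩ := ha
      obtain ⟨s, hs⟩ := hb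
      exact ⟨r + s, by rw [smul_add, hr, hs]; simp⟩
    | ι_mul v a _ => exact ⟨0, by rw [Subsingleton.elim v 0, map_zero]; simp⟩
  | succ k ih =>
    let i : (Fin k → R) →ₗ[R] (Fin (k + 1) → R) :=
      LinearMap.pi (Fin.lastCases 0 fun j ↦ LinearMap.proj j)
    have hi : ∀ m j, i m (Fin.castSucc j) = m j := fun m j ↦ by simp [i]
    have hi' : ∀ m, i m (Fin.last k) = 0 := fun m ↦ by simp [i]
    have hφ : Fintype.linearCombination R x ∘ₗ i =
        Fintype.linearCombination R (fun j : Fin k ↦ x j.castSucc) := by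
      refine LinearMap.ext fun m ↦ ?_
      simp [Fintype.linearCombination_apply, Fin.sum_univ_castSucc, hi, hi']
    have hIio : ∀ j : Fin k, x '' Set.Iio j.castSucc =
        (fun j : Fin k ↦ x j.castSucc) '' Set.Iio j := fun j ↦ by
      rw [← Set.image_image x Fin.castSucc, Fin.image_castSucc_Iio]
    have hlast : LinearMap.range (Fintype.linearCombination R (fun j : Fin k ↦ x j.castSucc)) =
        Ideal.span (x '' Set.Iio (Fin.last k)) := by
      have : Set.Iio (Fin.last k) = Set.range Fin.castSucc := by
        rw [Fin.range_castSucc]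
        exact Set.ext fun j ↦ Fin.lt_def
      rw [Fintype.range_linearCombination, Ideal.span, this, ← Set.range_comp]
      rfl
    refine IsKoszulAcyclic.of_split (i := i) (p := LinearMap.funLeft R R Fin.castSucc)
      (v := Pi.single (Fin.last k) 1) (ξ := LinearMap.proj (Fin.last k)) ?_ ?_ ?_ ?_ ?_ ?_ ?_
    · refine LinearMap.ext fun m ↦ funext fun j ↦ ?_
      simp [LinearMap.funLeft_apply, hi]
    · refine funext fun j ↦ ?_
      simp [LinearMap.funLeft_apply, (Fin.castSucc_lt_last j).ne]
    · refine LinearMap.ext fun m ↦ ?_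
      simp [hi']
    · simp
    · refine fun m ↦ funext fun j ↦ ?_
      induction j using Fin.lastCases with
      | last => simp [hi']
      | cast j => simp [hi, LinearMap.funLeft_apply, (Fin.castSucc_lt_last j).ne]
    · rw [hφ]
      exact ih _ fun j r ↦ by simpa only [hIio] using hx j.castSucc r
    · rw [hφ, hlast]
      simpa [Fintype.linearCombination_apply_single] using hx (Fin.last k)

theorem ExteriorAlgebra.koszul_proj (φ : F →ₗ[R] R) (n : ℕ) (z : ExteriorAlgebra R F) :
    GradedAlgebra.proj (fun n : ℕ ↦ ⋀[R]^n F) n (koszul φ z) =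
      koszul φ (GradedAlgebra.proj (fun n : ℕ ↦ ⋀[R]^n F) (n + 1) z) := by
  induction z using DirectSum.Decomposition.inductionOn (fun n : ℕ ↦ ⋀[R]^n F) with
  | zero => simp
  | add a b ha hb => simp only [map_add, ha, hb]
  | homogeneous a =>
    rename_i m
    rw [GradedAlgebra.proj_apply, GradedAlgebra.proj_apply]
    cases m with
    | zero =>
      obtain ⟨a, ha⟩ := a
      rw [DirectSum.decompose_of_mem_ne (fun n : ℕ ↦ ⋀[R]^n F) ha (Nat.succ_ne_zero n).symm, map_zero]
      rw [exteriorPower, pow_zero] at ha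
      obtain ⟨r, rfl⟩ := Submodule.mem_one.1 ha
      simp [koszul_algebraMap]
    | succ m =>
      rcases eq_or_ne m n with rfl | h
      · rw [DirectSum.decompose_of_mem_same (fun n : ℕ ↦ ⋀[R]^n F) a.2,
          DirectSum.decompose_of_mem_same (fun n : ℕ ↦ ⋀[R]^n F) (koszul_mem_exteriorPower φ a.2)]
      · rw [DirectSum.decompose_of_mem_ne (fun n : ℕ ↦ ⋀[R]^n F) a.2 (by omega : m + 1 ≠ n + 1), map_zero,
          DirectSum.decompose_of_mem_ne (fun n : ℕ ↦ ⋀[R]^n F) (koszul_mem_exteriorPower φ a.2) h]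

theorem ExteriorAlgebra.map_eq_pow_smul {g : F →ₗ[R] F} {s : R} (hg : g = s • LinearMap.id) {n : ℕ}
    {y : ExteriorAlgebra R F} (hy : y ∈ ⋀[R]^n F) : map g y = s ^ n • y := by
  induction n generalizing y with
  | zero =>
    rw [exteriorPower, pow_zero] at hy
    obtain ⟨r, rfl⟩ := Submodule.mem_one.1 hy
    simp
  | succ n ih =>
    rw [exteriorPower, pow_succ'] at hy
    induction hy using Submodule.mul_induction_on' with
    | mem_mul_mem a ha b hb =>
      obtain ⟨v, rfl⟩ := ha
      rw [map_mul, map_apply_ι, ih hb, hg, LinearMap.smul_apply, map_smul, smul_mul_smul_comm,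
        pow_succ']
      rfl
    | add a _ b _ ha hb => rw [map_add, ha, hb, smul_add]

theorem ExteriorAlgebra.IsKoszulAcyclic.exists_of_mem {S : Submonoid R} {φ : F →ₗ[R] R}
    (h : IsKoszulAcyclic S φ) {G : Type*} [AddCommGroup G] [Module R G] {w : F →ₗ[R] G}
    {u : G →ₗ[R] F} {s : R} (hs : s ∈ S) (hwu : w ∘ₗ u = s • LinearMap.id) {ψ : G →ₗ[R] R}
    (hφ : φ = ψ ∘ₗ w) (n : ℕ) (y : ⋀[R]^(n + 1) G) (hy : exteriorPower.koszul ψ n y = 0) :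
    ∃ t ∈ S, ∃ z, exteriorPower.koszul ψ (n + 1) z = t • y := by
  have hu : koszul φ (map u y.1) = 0 := by
    have hψ : ψ ∘ₗ w ∘ₗ u = s • ψ := by rw [hwu]; ext; simp
    rw [hφ, koszul_map, LinearMap.comp_assoc, hψ, koszul_smul, ← exteriorPower.coe_koszul, hy]
    simp
  obtain ⟨t, ht, z, r, hz⟩ := h _ hu
  have h₁ : (t * s ^ (n + 1)) • y.1 = koszul ψ (map w z) + algebraMap R _ r := by
    rw [mul_smul, ← map_eq_pow_smul hwu y.2, ← map_comp_map, AlgHom.comp_apply, ← map_smul, hz, map_add,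
      AlgHom.commutes, koszul_map, hφ]
  refine ⟨t * s ^ (n + 1), mul_mem ht (pow_mem hs _),
    ⟨GradedAlgebra.proj (fun n : ℕ ↦ ⋀[R]^n G) (n + 2) (map w z), SetLike.coe_mem _⟩, Subtype.ext ?_⟩
  rw [exteriorPower.coe_koszul, ← koszul_proj]
  have h₂ := congr_arg (GradedAlgebra.proj (fun n : ℕ ↦ ⋀[R]^n G) (n + 1)) h₁
  have h₃ : algebraMap R (ExteriorAlgebra R G) r ∈ ⋀[R]^0 G := by
    rw [exteriorPower, pow_zero]
    exact Submodule.algebraMap_mem r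
  rw [map_smul, map_add, GradedAlgebra.proj_apply _ _ y.1, DirectSum.decompose_of_mem_same (fun n : ℕ ↦ ⋀[R]^n G) y.2,
    GradedAlgebra.proj_apply _ _ (algebraMap R _ r),
    DirectSum.decompose_of_mem_ne (fun n : ℕ ↦ ⋀[R]^n G) h₃ (Nat.succ_ne_zero n).symm, add_zero] at h₂
  exact h₂.symm

end KoszulRegular

section KoszulGlobal

variable {R F M : Type*} [CommRing R] [AddCommGroup F] [Module R F] [AddCommGroup M] [Module R M]

theorem Submodule.FG.exists_smul_mem {N N' : Submodule R M} (hN : N.FG) (S : Submonoid R)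
    (h : ∀ y ∈ N, ∃ t ∈ S, t • y ∈ N') : ∃ t ∈ S, ∀ y ∈ N, t • y ∈ N' := by
  classical
  obtain ⟨s, rfl⟩ := hN
  choose! t ht ht' using fun y (hy : y ∈ s) ↦ h y (Submodule.subset_span hy)
  refine ⟨∏ y ∈ s, t y, prod_mem ht, fun y hy ↦ ?_⟩
  induction hy using Submodule.span_induction with
  | mem y hy =>
    rw [← Finset.prod_erase_mul _ _ hy, mul_smul]
    exact Submodule.smul_mem _ _ (ht' y hy)
  | zero => rw [smul_zero]; exact zero_mem _
  | add a b _ _ ha hb => rw [smul_add]; exact add_mem ha hb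
  | smul r a _ ha => rw [smul_comm]; exact Submodule.smul_mem _ _ ha

theorem Submodule.FG.exists_smul_mem_of_isMaximal {N N' : Submodule R M} (hN : N.FG) (I : Ideal R)
    (h : ∀ q : Ideal R, q.IsMaximal → I ≤ q → ∀ y ∈ N, ∃ t ∉ q, t • y ∈ N') :
    ∃ t, 1 - t ∈ I ∧ ∀ y ∈ N, t • y ∈ N' := by
  let T : Ideal R :=
    { carrier := {t | ∀ y ∈ N, t • y ∈ N'}
      add_mem' := fun ha hb y hy ↦ by rw [add_smul]; exact add_mem (ha y hy) (hb y hy)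
      zero_mem' := fun y _ ↦ by rw [zero_smul]; exact zero_mem _
      smul_mem' := fun r a ha y hy ↦ by
        rw [smul_eq_mul, mul_smul]; exact Submodule.smul_mem _ _ (ha y hy) }
  have hT : T ⊔ I = ⊤ := by
    by_contra hne
    obtain ⟨q, hq, hle⟩ := Ideal.exists_le_maximal _ hne
    obtain ⟨t, htq, ht⟩ := hN.exists_smul_mem q.primeCompl (h q hq (le_sup_right.trans hle))
    exact htq (hle (Ideal.mem_sup_left ht))
  obtain ⟨t, ht, i, hi, hti⟩ := Submodule.mem_sup.1 ((Ideal.eq_top_iff_one _).1 hT)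
  exact ⟨t, by rwa [← hti, add_sub_cancel_left], ht⟩

theorem exteriorPower.zeroEquiv_koszul (φ : F →ₗ[R] R) (v : F) :
    exteriorPower.zeroEquiv (R := R) (M := F)
      (exteriorPower.koszul φ 0 (exteriorPower.ιMulti R 1 fun _ ↦ v)) = φ v := by
  have : exteriorPower.koszul φ 0 (exteriorPower.ιMulti R 1 fun _ ↦ v) =
      φ v • exteriorPower.ιMulti R 0 fun _ ↦ 0 := by
    refine Subtype.ext ?_
    rw [exteriorPower.coe_koszul]
    simp [ExteriorAlgebra.ιMulti_apply, ExteriorAlgebra.koszul_ι, Algebra.algebraMap_eq_smul_one]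
  rw [this, map_smul, exteriorPower.zeroEquiv_ιMulti, smul_eq_mul, mul_one]

/-- The augmentation of the Koszul complex. -/
noncomputable def exteriorPower.koszulAug (μ : R →ₗ[R] M) : ⋀[R]^0 F →ₗ[R] M :=
  μ ∘ₗ (exteriorPower.zeroEquiv (R := R) (M := F)).toLinearMap

theorem exteriorPower.exists_isAcyclicUpTo_koszul [IsNoetherianRing R] [Module.Finite R F]
    (φ : F →ₗ[R] R) (μ : R →ₗ[R] M) (hμ : Function.Surjective μ) (hφ : ∀ v, μ (φ v) = 0) {d : ℕ}
    (hd : ∀ n, d < n → Subsingleton (⋀[R]^n F))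
    (hloc : ∀ q : Ideal R, q.IsMaximal → LinearMap.ker μ ≤ q → ∀ n, ∀ y : ⋀[R]^(n + 1) F,
      exteriorPower.koszul φ n y = 0 → ∃ t ∉ q, ∃ z, exteriorPower.koszul φ (n + 1) z = t • y)
    {f₀ : R} (hf₀ : μ (1 - f₀) = 0) (hf₀' : ∀ r, μ r = 0 → f₀ * r ∈ LinearMap.range φ) :
    ∃ f, μ (1 - f) = 0 ∧ (∀ r, μ r = 0 → f * r ∈ LinearMap.range φ) ∧
      IsAcyclicUpTo (X := fun n ↦ ⋀[R]^n F) f (exteriorPower.koszul φ)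
        (exteriorPower.koszulAug μ) := by
  have key : ∀ n, ∃ f, 1 - f ∈ LinearMap.ker μ ∧ ∀ y ∈ LinearMap.ker (exteriorPower.koszul φ n),
      f • y ∈ LinearMap.range (exteriorPower.koszul φ (n + 1)) := fun n ↦
    (IsNoetherian.noetherian _).exists_smul_mem_of_isMaximal _ fun q hq hle y hy ↦ by
      obtain ⟨t, ht, z, hz⟩ := hloc q hq hle n y hy
      exact ⟨t, ht, z, hz⟩
  choose f hf hf' using key
  have hprod : 1 - f₀ * ∏ n ∈ Finset.range d, f n ∈ LinearMap.ker μ := by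
    have h₁ : 1 - ∏ n ∈ Finset.range d, f n ∈ LinearMap.ker μ := by
      refine Finset.prod_induction _ (fun a ↦ 1 - a ∈ LinearMap.ker μ) (fun a b ha hb ↦ ?_) (by simp)
        fun n _ ↦ hf n
      rw [show 1 - a * b = (1 - a) + a • (1 - b) by rw [smul_eq_mul]; ring]
      exact add_mem ha (Submodule.smul_mem _ _ hb)
    rw [show ∀ b, 1 - f₀ * b = (1 - f₀) + f₀ • (1 - b) by intro b; rw [smul_eq_mul]; ring]
    exact add_mem hf₀ (Submodule.smul_mem _ _ h₁)
  have hrange : ∀ r, μ r = 0 → (f₀ * ∏ n ∈ Finset.range d, f n) * r ∈ LinearMap.range φ := by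
    intro r hr
    rw [mul_comm f₀, mul_assoc, ← smul_eq_mul]
    exact Submodule.smul_mem _ _ (hf₀' r hr)
  refine ⟨f₀ * ∏ n ∈ Finset.range d, f n, hprod, hrange, ?_⟩
  constructor
  · exact hμ.comp (exteriorPower.zeroEquiv (R := R) (M := F)).surjective
  · intro x
    refine LinearMap.congr_fun (exteriorPower.comp_koszul_eq_zero (M := M) φ (fun v m ↦ ?_)
      (exteriorPower.koszulAug μ)) x
    obtain ⟨r, rfl⟩ := hμ m
    rw [← map_smul, smul_eq_mul, mul_comm, ← smul_eq_mul, map_smul, hφ, smul_zero]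
  · intro n x
    exact Subtype.ext (ExteriorAlgebra.koszul_koszul φ x.1)
  · intro x hx
    obtain ⟨v, hv⟩ := hrange _ hx
    refine ⟨exteriorPower.ιMulti R 1 fun _ ↦ v,
      (exteriorPower.zeroEquiv (R := R) (M := F)).injective ?_⟩
    rw [exteriorPower.zeroEquiv_koszul, hv, map_smul]
    rfl
  · intro n x hx
    by_cases hn : n < d
    · obtain ⟨z, hz⟩ := hf' n x hx
      refine ⟨(f₀ * ∏ m ∈ (Finset.range d).erase n, f m) • z, ?_⟩
      rw [map_smul, hz, ← mul_smul, mul_assoc, Finset.prod_erase_mul _ _ (Finset.mem_range.2 hn)]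
    · have := hd (n + 1) (by omega)
      exact ⟨0, Subsingleton.elim _ _⟩

end KoszulGlobal

section LocallyFree

variable {R M N : Type*} [CommRing R] [AddCommGroup M] [Module R M] [AddCommGroup N] [Module R N]

theorem exteriorPower.map_smul_id (s : R) (n : ℕ) :
    exteriorPower.map n (s • LinearMap.id (R := R) (M := M)) = s ^ n • LinearMap.id := by
  refine exteriorPower.linearMap_ext (AlternatingMap.ext fun v ↦ ?_)
  simpa using (exteriorPower.ιMulti R n).toMultilinearMap.map_smul_univ (fun _ ↦ s) v

theorem LinearMap.baseChange_smul_id (B : Type*) [CommRing B] [Algebra R B] (s : R) :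
    (s • LinearMap.id (R := R) (M := M)).baseChange B = algebraMap R B s • LinearMap.id := by
  ext; simp [TensorProduct.smul_tmul']

theorem IsLocalization.bijective_smul {S : Submonoid R} (A : Type*) [CommRing A] [Algebra R A]
    [IsLocalization S A] [Module A M] [IsScalarTower R A M] {s : R} (hs : s ∈ S) :
    Function.Bijective (fun x : M ↦ s • x) := by
  obtain ⟨v, hv⟩ := IsLocalization.map_units A (⟨s, hs⟩ : S)
  convert! MulAction.bijective v using 2 with x
  rw [Units.smul_def, hv, algebraMap_smul]

/-- `M` and `N` are isomorphic up to a scalar in `S`. -/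
def NearlyEquiv (S : Submonoid R) (M N : Type*) [AddCommGroup M] [Module R M] [AddCommGroup N]
    [Module R N] : Prop :=
  ∃ s ∈ S, ∃ (w : N →ₗ[R] M) (u : M →ₗ[R] N), w ∘ₗ u = s • LinearMap.id ∧ u ∘ₗ w = s • LinearMap.id

namespace NearlyEquiv

variable {S : Submonoid R}

theorem of_linearEquiv_left {M' : Type*} [AddCommGroup M'] [Module R M'] (e : M' ≃ₗ[R] M)
    (h : NearlyEquiv S M N) : NearlyEquiv S M' N := by
  obtain ⟨s, hs, w, u, hwu, huw⟩ := h
  refine ⟨s, hs, e.symm.toLinearMap ∘ₗ w, u ∘ₗ e.toLinearMap, LinearMap.ext fun x ↦ ?_,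
    LinearMap.ext fun x ↦ ?_⟩
  · simpa using congr_arg e.symm (LinearMap.congr_fun hwu (e x))
  · simpa using LinearMap.congr_fun huw x

theorem of_linearEquiv_right {N' : Type*} [AddCommGroup N'] [Module R N'] (e : N ≃ₗ[R] N')
    (h : NearlyEquiv S M N) : NearlyEquiv S M N' := by
  obtain ⟨s, hs, w, u, hwu, huw⟩ := h
  refine ⟨s, hs, w ∘ₗ e.symm.toLinearMap, e.toLinearMap ∘ₗ u, LinearMap.ext fun x ↦ ?_,
    LinearMap.ext fun x ↦ ?_⟩
  · simpa using LinearMap.congr_fun hwu x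
  · simpa using congr_arg e (LinearMap.congr_fun huw (e.symm x))

theorem exteriorPower (h : NearlyEquiv S M N) (n : ℕ) : NearlyEquiv S (⋀[R]^n M) (⋀[R]^n N) := by
  obtain ⟨s, hs, w, u, hwu, huw⟩ := h
  refine ⟨s ^ n, pow_mem hs n, exteriorPower.map n w, exteriorPower.map n u, ?_, ?_⟩
  · rw [← exteriorPower.map_comp, hwu, exteriorPower.map_smul_id]
  · rw [← exteriorPower.map_comp, huw, exteriorPower.map_smul_id]

theorem dual (h : NearlyEquiv S M N) : NearlyEquiv S (M →ₗ[R] R) (N →ₗ[R] R) := by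
  obtain ⟨s, hs, w, u, hwu, huw⟩ := h
  refine ⟨s, hs, LinearMap.lcomp R R u, LinearMap.lcomp R R w, LinearMap.ext fun x ↦ ?_,
    LinearMap.ext fun x ↦ ?_⟩
  · refine LinearMap.ext fun y ↦ ?_
    simpa using congr_arg x (LinearMap.congr_fun hwu y)
  · refine LinearMap.ext fun y ↦ ?_
    simpa using congr_arg x (LinearMap.congr_fun huw y)

theorem baseChange {B : Type*} [CommRing B] [Algebra R B] {T : Submonoid B}
    (hST : S ≤ T.comap (algebraMap R B)) (h : NearlyEquiv S M N) :
    NearlyEquiv T (B ⊗[R] M) (B ⊗[R] N) := by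
  obtain ⟨s, hs, w, u, hwu, huw⟩ := h
  refine ⟨algebraMap R B s, hST hs, w.baseChange B, u.baseChange B, ?_, ?_⟩
  · rw [← LinearMap.baseChange_comp, hwu, LinearMap.baseChange_smul_id]
  · rw [← LinearMap.baseChange_comp, huw, LinearMap.baseChange_smul_id]

theorem nonempty_linearEquiv {A M' N' : Type*} [CommRing A] [Algebra R A] [IsLocalization S A]
    [AddCommGroup M'] [Module R M'] [Module A M'] [IsScalarTower R A M']
    [AddCommGroup N'] [Module R N'] [Module A N'] [IsScalarTower R A N']
    (f : M →ₗ[R] M') (g : N →ₗ[R] N') [IsLocalizedModule S f] [IsLocalizedModule S g]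
    (h : NearlyEquiv S M N) : Nonempty (M' ≃ₗ[A] N') := by
  obtain ⟨s, hs, w, u, hwu, huw⟩ := h
  have h₁ : IsLocalizedModule.map S g f w ∘ₗ IsLocalizedModule.map S f g u = s • LinearMap.id := by
    rw [← IsLocalizedModule.map_comp', hwu, map_smul, IsLocalizedModule.map_id]
  have h₂ : IsLocalizedModule.map S f g u ∘ₗ IsLocalizedModule.map S g f w = s • LinearMap.id := by
    rw [← IsLocalizedModule.map_comp', huw, map_smul, IsLocalizedModule.map_id]
  refine ⟨LinearEquiv.ofBijective (IsLocalizedModule.mapExtendScalars S f g A u) ⟨?_, ?_⟩⟩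
  · intro x y hxy
    apply (IsLocalization.bijective_smul A hs).1
    have := congr_arg (IsLocalizedModule.map S g f w) hxy
    exact (LinearMap.congr_fun h₁ x).symm.trans (this.trans (LinearMap.congr_fun h₁ y))
  · intro y
    obtain ⟨x, rfl⟩ := (IsLocalization.bijective_smul A hs).2 y
    exact ⟨_, LinearMap.congr_fun h₂ x⟩

theorem of_linearEquiv {M' N' : Type*} [Module.FinitePresentation R M]
    [Module.FinitePresentation R N] [AddCommGroup M'] [Module R M'] [AddCommGroup N'] [Module R N']
    (f : M →ₗ[R] M') (g : N →ₗ[R] N') [IsLocalizedModule S f] [IsLocalizedModule S g]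
    (e : M' ≃ₗ[R] N') : NearlyEquiv S M N := by
  obtain ⟨u, s, hu⟩ := Module.FinitePresentation.exists_lift_of_isLocalizedModule S g
    (e.toLinearMap ∘ₗ f)
  obtain ⟨w, t, hw⟩ := Module.FinitePresentation.exists_lift_of_isLocalizedModule S f
    (e.symm.toLinearMap ∘ₗ g)
  have hu' (x : M) : g (u x) = (s : R) • e (f x) := LinearMap.congr_fun hu x
  have hw' (x : N) : f (w x) = (t : R) • e.symm (g x) := LinearMap.congr_fun hw x
  obtain ⟨a, ha⟩ := Module.Finite.exists_smul_of_comp_eq_of_isLocalizedModule S f (w ∘ₗ u)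
    ((s * t : R) • LinearMap.id) (LinearMap.ext fun x ↦ by
      simp [hw', hu', mul_smul, smul_comm (s : R) (t : R)])
  obtain ⟨b, hb⟩ := Module.Finite.exists_smul_of_comp_eq_of_isLocalizedModule S g (u ∘ₗ w)
    ((s * t : R) • LinearMap.id) (LinearMap.ext fun x ↦ by
      simp [hw', hu', mul_smul])
  have ha' (x : M) : (a : R) • w (u x) = (a : R) • (s * t : R) • x := LinearMap.congr_fun ha x
  have hb' (x : N) : (b : R) • u (w x) = (b : R) • (s * t : R) • x := LinearMap.congr_fun hb x
  refine ⟨a * b * (s * t), mul_mem (mul_mem a.2 b.2) (mul_mem s.2 t.2), w, (a * b : R) • u,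
    LinearMap.ext fun x ↦ ?_, LinearMap.ext fun x ↦ ?_⟩
  · simp only [LinearMap.comp_apply, LinearMap.smul_apply, map_smul, LinearMap.id_apply]
    rw [mul_comm (a : R) b, mul_smul, ha', smul_smul, smul_smul]
  · simp only [LinearMap.comp_apply, LinearMap.smul_apply, LinearMap.id_apply]
    rw [mul_smul, hb', smul_smul, smul_smul]

end NearlyEquiv

/-- `M` is free of rank `d` in a weak sense at every prime. -/
def IsLocallyFreeOfRank (R M : Type*) [CommRing R] [AddCommGroup M] [Module R M] (d : ℕ) : Prop :=
  ∀ q : Ideal R, ∀ _ : q.IsPrime, NearlyEquiv q.primeCompl M (Fin d → R)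

namespace IsLocallyFreeOfRank

variable {d : ℕ}

theorem of_linearEquiv (e : M ≃ₗ[R] N) (h : IsLocallyFreeOfRank R N d) :
    IsLocallyFreeOfRank R M d :=
  fun q hq ↦ (h q hq).of_linearEquiv_left e

theorem of_rank [Module.Finite R M] [Module.Projective R M]
    (h : ∀ (p : Ideal R) (_ : p.IsPrime),
      Module.rank (Localization.AtPrime p) (LocalizedModule p.primeCompl M) = d) :
    IsLocallyFreeOfRank R M d := by
  intro q hq
  have := Module.finitePresentation_of_projective R M
  have : Module.Free (Localization.AtPrime q) (LocalizedModule q.primeCompl M) :=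
    Module.free_of_flat_of_isLocalRing
  let b := Module.finBasisOfFinrankEq (Localization.AtPrime q) (LocalizedModule q.primeCompl M)
    (Module.finrank_eq_of_rank_eq (h q hq))
  refine NearlyEquiv.of_linearEquiv (LocalizedModule.mkLinearMap q.primeCompl M)
    (LinearMap.pi fun i : Fin d ↦ Algebra.linearMap R (Localization.AtPrime q) ∘ₗ LinearMap.proj i)
    (b.equivFun.restrictScalars R)

theorem baseChange (h : IsLocallyFreeOfRank R M d) (B : Type*) [CommRing B] [Algebra R B] :
    IsLocallyFreeOfRank B (B ⊗[R] M) d := by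
  intro q hq
  refine ((h (q.comap (algebraMap R B)) inferInstance).baseChange
    (T := q.primeCompl) fun x hx ↦ hx).of_linearEquiv_right ?_
  exact TensorProduct.piScalarRight R B B (Fin d)

theorem rank_eq (h : IsLocallyFreeOfRank R M d) (p : Ideal R) (hp : p.IsPrime) :
    Module.rank (Localization.AtPrime p) (LocalizedModule p.primeCompl M) = d := by
  obtain ⟨e⟩ := (h p hp).nonempty_linearEquiv (A := Localization.AtPrime p)
    (LocalizedModule.mkLinearMap p.primeCompl M)
    (LinearMap.pi fun i : Fin d ↦ Algebra.linearMap R (Localization.AtPrime p) ∘ₗ LinearMap.proj i)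
  exact Cardinal.lift_injective (e.lift_rank_eq.trans (by simp))

theorem of_nearlyEquiv [Nontrivial R]
    (h : ∀ q : Ideal R, ∀ _ : q.IsPrime, NearlyEquiv q.primeCompl M N) [Module.Free R N]
    [Module.Finite R N] (hN : Module.finrank R N = d) : IsLocallyFreeOfRank R M d :=
  fun q hq ↦ (h q hq).of_linearEquiv_right (Module.finBasisOfFinrankEq R N hN).equivFun

theorem dual_exteriorPower (h : IsLocallyFreeOfRank R M d) :
    IsLocallyFreeOfRank R ((⋀[R]^d M) →ₗ[R] R) 1 := by
  rcases subsingleton_or_nontrivial R with hR | hR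
  · exact fun q hq ↦ absurd (Subsingleton.elim _ _) hq.ne_top
  refine of_nearlyEquiv (fun q hq ↦ ((h q hq).exteriorPower d).dual) ?_
  rw [Module.finrank_linearMap_self, exteriorPower.finrank_eq]
  simp

theorem subsingleton_exteriorPower (h : IsLocallyFreeOfRank R M d) {n : ℕ} (hn : d < n) :
    Subsingleton (⋀[R]^n M) := by
  rcases subsingleton_or_nontrivial R with hR | hR
  · exact Module.subsingleton R _
  have : Subsingleton (⋀[R]^n (Fin d → R)) := by
    rw [← Module.finrank_eq_zero_iff_of_free (R := R), exteriorPower.finrank_eq]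
    simpa using Nat.choose_eq_zero_of_lt hn
  refine subsingleton_of_forall_eq 0 fun y ↦ ?_
  by_contra hy
  obtain ⟨q, hq, hyq⟩ := Ideal.exists_le_maximal (Ideal.torsionOf R _ y)
    (by rwa [ne_eq, Ideal.torsionOf_eq_top_iff])
  obtain ⟨s, hs, w, u, hwu, -⟩ := (h q hq.isPrime).exteriorPower n
  refine hs (hyq ?_)
  rw [Ideal.mem_torsionOf_iff]
  refine (LinearMap.congr_fun hwu y).symm.trans ?_
  rw [LinearMap.comp_apply, Subsingleton.elim (u y) 0, map_zero]

end IsLocallyFreeOfRank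

end LocallyFree

section Smooth

open MvPolynomial

theorem Algebra.FormallySmooth.flat_of_essFiniteType (A B : Type*) [CommRing A] [CommRing B]
    [Algebra A B] [IsNoetherianRing A] [Algebra.EssFiniteType A B] [Algebra.FormallySmooth A B] :
    Module.Flat A B := by
  obtain ⟨σ, hσ⟩ := (Algebra.essFiniteType_iff A B).1 ‹_›
  let g : MvPolynomial σ A →ₐ[A] B := aeval Subtype.val
  let M : Submonoid (MvPolynomial σ A) := (IsUnit.submonoid B).comap g
  let f : Localization M →ₐ[A] B := IsLocalization.liftAlgHom (M := M) (f := g) fun y ↦ y.2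
  have hf (p : MvPolynomial σ A) : f (algebraMap _ _ p) = g p := IsLocalization.lift_eq _ _
  have : Module.Flat (MvPolynomial σ A) (Localization M) := IsLocalization.flat _ M
  have : Module.Flat A (Localization M) := .trans A (MvPolynomial σ A) _
  refine Algebra.FormallySmooth.flat_of_algHom_of_isNoetherianRing f fun s ↦ ?_
  obtain ⟨t, ht, hu, hst⟩ := hσ s
  rw [Algebra.adjoin_eq_range] at ht hst
  obtain ⟨t, rfl⟩ : ∃ t', g t' = t := ht
  obtain ⟨p, hp⟩ : ∃ p, g p = s * g t := hst
  let t' : M := ⟨t, hu⟩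
  refine ⟨IsLocalization.mk' _ p t', hu.mul_left_injective ?_⟩
  change f _ * g t' = s * g t
  rw [← hp, ← hf p, ← hf t', ← map_mul, IsLocalization.mk'_spec]

theorem Algebra.FormallySmooth.flat_aeval {P B : Type*} [CommRing P] [CommRing B] [Algebra P B]
    [IsNoetherianRing P] [Algebra.EssFiniteType P B] [Algebra.FormallySmooth P B] {k : ℕ}
    (v : Fin k → B)
    (hv : Function.Bijective (Fintype.linearCombination B fun i ↦ KaehlerDifferential.D P B (v i))) :
    (aeval (R := P) v).toRingHom.Flat := by
  let : Algebra (MvPolynomial (Fin k) P) B := (aeval (R := P) v).toRingHom.toAlgebra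
  have : IsScalarTower P (MvPolynomial (Fin k) P) B := .of_algebraMap_eq' (aeval (R := P) v).comp_algebraMap.symm
  have hbij : Function.Bijective (KaehlerDifferential.mapBaseChange P (MvPolynomial (Fin k) P) B) := by
    let b := (KaehlerDifferential.mvPolynomialBasis P (Fin k)).baseChange B
    have hb (i) : b i = 1 ⊗ₜ KaehlerDifferential.D P (MvPolynomial (Fin k) P) (X i) := by
      rw [Module.Basis.baseChange_apply]
      congr 1
      exact (KaehlerDifferential.mvPolynomialBasis P (Fin k)).repr.injective (by simp)
    have h : KaehlerDifferential.mapBaseChange P (MvPolynomial (Fin k) P) B ∘ₗ b.equivFun.symm.toLinearMap =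
        Fintype.linearCombination B fun i ↦ KaehlerDifferential.D P B (v i) := by
      refine LinearMap.pi_ext' fun i ↦ LinearMap.ext_ring ?_
      have : algebraMap (MvPolynomial (Fin k) P) B (X i) = v i := aeval_X _ _
      simp [hb, this, Fintype.linearCombination_apply]
    refine (Function.Bijective.of_comp_iff _ b.equivFun.symm.bijective).1 ?_
    rw [← h] at hv
    exact hv
  have : Algebra.EssFiniteType (MvPolynomial (Fin k) P) B := .of_comp P (MvPolynomial (Fin k) P) B
  have h₁ : Subsingleton Ω[B⁄MvPolynomial (Fin k) P] := by
    refine subsingleton_of_forall_eq 0 fun x ↦ ?_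
    obtain ⟨y, rfl⟩ := KaehlerDifferential.map_surjective P (MvPolynomial (Fin k) P) B x
    exact (KaehlerDifferential.exact_mapBaseChange_map P (MvPolynomial (Fin k) P) B y).2 (hbij.2 y)
  have h₂ : Subsingleton (Algebra.H1Cotangent (MvPolynomial (Fin k) P) B) := by
    refine subsingleton_of_forall_eq 0 fun x ↦ ?_
    have hx : Algebra.H1Cotangent.δ P (MvPolynomial (Fin k) P) B x = 0 := by
      apply hbij.1
      rw [map_zero]
      exact (Algebra.H1Cotangent.exact_δ_mapBaseChange P (MvPolynomial (Fin k) P) B _).2 ⟨x, rfl⟩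
    obtain ⟨y, rfl⟩ := (Algebra.H1Cotangent.exact_map_δ P (MvPolynomial (Fin k) P) B x).1 hx
    rw [Subsingleton.elim y 0, map_zero]
  have : Algebra.FormallySmooth (MvPolynomial (Fin k) P) B := ⟨inferInstance, h₂⟩
  exact Algebra.FormallySmooth.flat_of_essFiniteType (MvPolynomial (Fin k) P) B

end Smooth

section Regular

open MvPolynomial

theorem Ideal.mem_map_of_mul_mem_of_flat {A B : Type*} [CommRing A] [CommRing B] [Algebra A B]
    [Module.Flat A B] {J : Ideal A} {a : A} (h : ∀ r, a * r ∈ J → r ∈ J) {b : B}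
    (hb : algebraMap A B a * b ∈ J.map (algebraMap A B)) : b ∈ J.map (algebraMap A B) := by
  have h₁ : IsSMulRegular (A ⧸ J) a := (isSMulRegular_quotient_iff_mem_of_smul_mem J a).2 h
  have h₂ := (TensorProduct.tensorQuotEquivQuotSMul B J).isSMulRegular_congr a |>.1
    (h₁.lTensor B)
  have h₃ := mem_of_isSMulRegular_quotient_of_smul_mem h₂ (x := b)
  rw [Ideal.smul_top_eq_map] at h₃
  exact h₃ (by rwa [Submodule.restrictScalars_mem, Algebra.smul_def])

theorem MvPolynomial.mem_span_X_of_mul_mem {P σ : Type*} [CommRing P] {s : Set σ} {j : σ}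
    (hj : j ∉ s) {r : MvPolynomial σ P}
    (hr : X j * r ∈ Ideal.span (X '' s : Set (MvPolynomial σ P))) :
    r ∈ Ideal.span (X '' s : Set (MvPolynomial σ P)) := by
  classical
  rw [mem_ideal_span_X_image] at hr ⊢
  intro m hm
  obtain ⟨i, hi, hmi⟩ := hr (Finsupp.single j 1 + m) (by
    rw [mem_support_iff, coeff_X_mul]
    exact mem_support_iff.1 hm)
  have hij : j ≠ i := fun h ↦ hj (h ▸ hi)
  exact ⟨i, hi, by simpa [Finsupp.single_apply, hij] using hmi⟩

theorem RingHom.Flat.mem_span_of_mul_mem {P B : Type*} [CommRing P] [CommRing B] [Algebra P B]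
    {σ : Type*} {v : σ → B} (hv : (aeval (R := P) v).toRingHom.Flat) {s : Set σ} {j : σ}
    (hj : j ∉ s) {b : B} (hb : v j * b ∈ Ideal.span (v '' s)) : b ∈ Ideal.span (v '' s) := by
  let : Algebra (MvPolynomial σ P) B := (aeval (R := P) v).toRingHom.toAlgebra
  have : Module.Flat (MvPolynomial σ P) B := hv
  have hX (i) : algebraMap (MvPolynomial σ P) B (X i) = v i := aeval_X _ _
  have hs : Ideal.map (algebraMap (MvPolynomial σ P) B) (Ideal.span (X '' s)) =
      Ideal.span (v '' s) := by
    rw [Ideal.map_span, Set.image_image]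
    simp_rw [hX]
  rw [← hs] at hb ⊢
  refine Ideal.mem_map_of_mul_mem_of_flat (a := X j) (fun r ↦ mem_span_X_of_mul_mem hj) ?_
  rwa [hX]

end Regular

section Diagonal

variable {P R : Type*} [CommRing P] [CommRing R] [Algebra P R]

open KaehlerDifferential in
theorem KaehlerDifferential.span_range_D_eq_top_of_retraction [Algebra.EssFiniteType P R]
    (μ : R →ₐ[P] P) (q : Ideal R) [q.IsPrime] (hq : RingHom.ker μ ≤ q) {ι : Type*} (x : ι → R)
    (hx : ∀ i, μ (x i) = 0) {g : R} (hg : g ∉ q)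
    (hgx : ∀ r, μ r = 0 → g * r ∈ Ideal.span (Set.range x)) :
    Submodule.span (Localization.AtPrime q)
      (Set.range fun i ↦ D P (Localization.AtPrime q) (algebraMap R _ (x i))) = ⊤ := by
  set B := Localization.AtPrime q
  set N := Submodule.span B (Set.range fun i ↦ D P B (algebraMap R _ (x i)))
  have : Algebra.EssFiniteType R B := .of_isLocalization B q.primeCompl
  have : Algebra.EssFiniteType P B := .comp P R B
  set m := IsLocalRing.maximalIdeal B
  have hm {r : R} (hr : r ∈ q) : algebraMap R B r ∈ m :=
    (IsLocalization.AtPrime.to_map_mem_maximal_iff B q r).2 hr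
  have hu {r : R} (hr : r ∉ q) : IsUnit (algebraMap R B r) :=
    IsLocalization.map_units B (⟨r, hr⟩ : q.primeCompl)
  have hunit {b : B} (hb : IsUnit b) {T : Submodule B Ω[B⁄P]} {y} (hy : b • y ∈ T) : y ∈ T := by
    obtain ⟨b, rfl⟩ := hb
    exact (Submodule.smul_mem_iff_of_isUnit _ b.isUnit).1 hy
  have hspan (r : R) (hr : r ∈ Ideal.span (Set.range x)) :
      D P B (algebraMap R B r) ∈ N ⊔ m • (⊤ : Submodule B Ω[B⁄P]) := by
    induction hr using Submodule.span_induction with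
    | mem r hr =>
      obtain ⟨i, rfl⟩ := hr
      exact Submodule.mem_sup_left (Submodule.subset_span ⟨i, rfl⟩)
    | zero => simp
    | add r s _ _ hr hs => simpa using add_mem hr hs
    | smul a r hr h =>
      have hr' : r ∈ q := by
        refine hq (Ideal.span_le.2 ?_ hr)
        rintro _ ⟨i, rfl⟩
        exact hx i
      rw [smul_eq_mul, map_mul, Derivation.leibniz]
      exact add_mem (Submodule.smul_mem _ _ h)
        (Submodule.mem_sup_right (Submodule.smul_mem_smul (hm hr') trivial))
  have hD (r : R) : D P B (algebraMap R B r) ∈ N ⊔ m • (⊤ : Submodule B Ω[B⁄P]) := by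
    set r' := r - algebraMap P R (μ r) with hr'
    have hr'μ : μ r' = 0 := by simp [hr']
    have h₁ : D P B (algebraMap R B r') = D P B (algebraMap R B r) := by
      rw [hr', map_sub, ← IsScalarTower.algebraMap_apply, map_sub, Derivation.map_algebraMap,
        sub_zero]
    rw [← h₁]
    have h₂ := hspan _ (hgx r' hr'μ)
    rw [map_mul, Derivation.leibniz] at h₂
    refine hunit (hu hg) ((Submodule.add_mem_iff_left _ ?_).1 h₂)
    exact Submodule.mem_sup_right (Submodule.smul_mem_smul (hm (hq hr'μ)) trivial)
  have htop : (⊤ : Submodule B Ω[B⁄P]) ≤ N ⊔ m • (⊤ : Submodule B Ω[B⁄P]) := by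
    refine (span_range_map_derivation_of_isLocalization P R B q.primeCompl).symm.le.trans
      (Submodule.span_le.2 ?_)
    rintro _ ⟨r, rfl⟩
    simpa using hD r
  refine top_le_iff.1 (Submodule.le_of_le_smul_of_le_jacobson_bot Module.Finite.fg_top ?_ htop)
  exact IsLocalRing.maximalIdeal_le_jacobson _

theorem exists_mul_mem_span_of_retraction [IsNoetherianRing P] [Algebra.EssFiniteType P R]
    [Algebra.FormallySmooth P R] (μ : R →ₐ[P] P) (q : Ideal R) [q.IsPrime] (hq : RingHom.ker μ ≤ q)
    {d : ℕ} (hΩ : NearlyEquiv q.primeCompl Ω[R⁄P] (Fin d → R)) (x : Fin d → R)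
    (hx : ∀ i, μ (x i) = 0) {g : R} (hg : g ∉ q)
    (hgx : ∀ r, μ r = 0 → g * r ∈ Ideal.span (Set.range x)) (j : Fin d) (r : R)
    (hr : x j * r ∈ Ideal.span (x '' Set.Iio j)) :
    ∃ t ∈ q.primeCompl, t * r ∈ Ideal.span (x '' Set.Iio j) := by
  set B := Localization.AtPrime q
  have : Algebra.EssFiniteType R B := .of_isLocalization B q.primeCompl
  have : Algebra.EssFiniteType P B := .comp P R B
  have : Algebra.FormallySmooth R B := .of_isLocalization q.primeCompl
  have : Algebra.FormallySmooth P B := .comp P R B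
  obtain ⟨e⟩ := hΩ.nonempty_linearEquiv (A := B) (KaehlerDifferential.map P P R B)
    (LinearMap.pi fun i : Fin d ↦ Algebra.linearMap R B ∘ₗ LinearMap.proj i)
  let l := Fintype.linearCombination B fun i ↦ KaehlerDifferential.D P B (algebraMap R B (x i))
  have hl : Function.Surjective l := by
    rw [← LinearMap.range_eq_top, Fintype.range_linearCombination]
    exact KaehlerDifferential.span_range_D_eq_top_of_retraction μ q hq x hx hg hgx
  have hl' : Function.Injective l := by
    have := OrzechProperty.injective_of_surjective_endomorphism (e.toLinearMap ∘ₗ l)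
      (e.surjective.comp hl)
    exact Function.Injective.of_comp this
  have hflat := Algebra.FormallySmooth.flat_aeval (P := P) (fun i ↦ algebraMap R B (x i)) ⟨hl', hl⟩
  have hs : Ideal.map (algebraMap R B) (Ideal.span (x '' Set.Iio j)) =
      Ideal.span ((fun i ↦ algebraMap R B (x i)) '' Set.Iio j) := by
    rw [Ideal.map_span, Set.image_image]
  have h := hflat.mem_span_of_mul_mem (s := Set.Iio j) (j := j) (lt_irrefl j)
    (b := algebraMap R B r) (by
      rw [← hs, ← map_mul]
      exact Ideal.mem_map_of_mem _ hr)
  rw [← hs] at h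
  exact (IsLocalization.algebraMap_mem_map_algebraMap_iff q.primeCompl B _ _).1 h

end Diagonal

section Diagonal

variable {P R : Type*} [CommRing P] [CommRing R] [Algebra P R]

theorem exteriorPower.exists_koszul_eq_smul_of_retraction [IsNoetherianRing P]
    [Algebra.EssFiniteType P R] [Algebra.FormallySmooth P R] (μ : R →ₐ[P] P) (q : Ideal R)
    [q.IsPrime] (hq : RingHom.ker μ ≤ q) {d : ℕ}
    (hΩ : NearlyEquiv q.primeCompl Ω[R⁄P] (Fin d → R))
    {F : Type*} [AddCommGroup F] [Module R F] (hF : NearlyEquiv q.primeCompl F (Fin d → R))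
    (φ : F →ₗ[R] R) (hφ : ∀ v, μ (φ v) = 0) {f : R} (hf : μ (1 - f) = 0)
    (hf' : ∀ r, μ r = 0 → f * r ∈ LinearMap.range φ) (n : ℕ) (y : ⋀[R]^(n + 1) F)
    (hy : exteriorPower.koszul φ n y = 0) :
    ∃ t ∉ q, ∃ z, exteriorPower.koszul φ (n + 1) z = t • y := by
  obtain ⟨s, hs, w, u, hwu, -⟩ := hF
  let x : Fin d → R := fun j ↦ φ (w (Pi.single j 1))
  have hx : Fintype.linearCombination R x = φ ∘ₗ w := by
    refine LinearMap.pi_ext' fun j ↦ LinearMap.ext_ring ?_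
    simp [x]
  have hfq : f ∉ q := fun h ↦ Ideal.IsPrime.ne_top' ((Ideal.eq_top_iff_one q).2 <| by
    simpa using q.add_mem (hq hf) h)
  have hg : s * f ∉ q := fun h ↦ (Ideal.IsPrime.mem_or_mem ‹_› h).elim hs hfq
  have hgx : ∀ r, μ r = 0 → s * f * r ∈ Ideal.span (Set.range x) := by
    intro r hr
    obtain ⟨v, hv⟩ := hf' r hr
    have h : s * f * r = Fintype.linearCombination R x (u v) := by
      rw [hx, LinearMap.comp_apply, ← LinearMap.comp_apply w, hwu]
      simp [hv, mul_assoc]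
    rw [h, Ideal.span, ← Fintype.range_linearCombination]
    exact LinearMap.mem_range_self _ _
  have hreg := ExteriorAlgebra.isKoszulAcyclic_of_regular (S := q.primeCompl) x fun j r hr ↦
    exists_mul_mem_span_of_retraction μ q hq hΩ x (fun i ↦ hφ _) hg hgx j r hr
  exact hreg.exists_of_mem hs hwu hx n y hy

end Diagonal

section Diagonal

variable (K P : Type*) [CommRing K] [CommRing P] [Algebra K P]

theorem KaehlerDifferential.exists_baseChange_toIdeal [IsNoetherianRing (P ⊗[K] P)]
    [Module.Projective P Ω[P⁄K]] :
    ∃ φ : (P ⊗[K] P) ⊗[P] Ω[P⁄K] →ₗ[P ⊗[K] P] P ⊗[K] P,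
      (∀ v, Algebra.TensorProduct.lmul' (S := P) K (φ v) = 0) ∧
      ∃ f, Algebra.TensorProduct.lmul' (S := P) K (1 - f) = 0 ∧
        ∀ r, Algebra.TensorProduct.lmul' (S := P) K r = 0 → f * r ∈ LinearMap.range φ := by
  obtain ⟨σ, hσ⟩ := Module.projective_lifting_property
    ((KaehlerDifferential.fromIdeal K P).restrictScalars P) (LinearMap.id (R := P) (M := Ω[P⁄K]))
    (KaehlerDifferential.fromIdeal_surjective K P)
  let I := KaehlerDifferential.ideal K P
  let ι : I →ₗ[P] P ⊗[K] P := (Submodule.subtype I).restrictScalars P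
  let φ : (P ⊗[K] P) ⊗[P] Ω[P⁄K] →ₗ[P ⊗[K] P] P ⊗[K] P :=
    TensorProduct.AlgebraTensorModule.lift
      ((LinearMap.toSpanSingleton (P ⊗[K] P) _ (ι ∘ₗ σ)))
  have hφ (r m) : φ (r ⊗ₜ m) = r * σ m := by simp [φ, ι]
  have hle : LinearMap.range φ ≤ I := by
    rintro _ ⟨v, rfl⟩
    induction v with
    | zero => simp
    | add v w hv hw => rw [map_add]; exact add_mem hv hw
    | tmul r m => rw [hφ]; exact I.mul_mem_left _ (σ m).2
  have hsup : I ≤ LinearMap.range φ ⊔ I • I := by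
    intro r hr
    have hmem : r - σ (KaehlerDifferential.fromIdeal K P ⟨r, hr⟩) ∈ I • I := by
      have h0 : KaehlerDifferential.fromIdeal K P
          (⟨r, hr⟩ - σ (KaehlerDifferential.fromIdeal K P ⟨r, hr⟩)) = 0 := by
        rw [map_sub, sub_eq_zero]
        exact (LinearMap.congr_fun hσ _).symm
      have := (Ideal.toCotangent_eq_zero I _).1 h0
      rw [smul_eq_mul, ← sq]
      exact this
    rw [← add_sub_cancel (σ (KaehlerDifferential.fromIdeal K P ⟨r, hr⟩) : P ⊗[K] P) r]
    refine Submodule.add_mem_sup ⟨1 ⊗ₜ KaehlerDifferential.fromIdeal K P ⟨r, hr⟩, ?_⟩ hmem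
    rw [hφ, one_mul]
  obtain ⟨f, hf, hfI⟩ := Submodule.exists_sub_one_mem_and_smul_le_of_fg_of_le_sup
    (IsNoetherian.noetherian I) le_rfl hsup
  refine ⟨φ, fun v ↦ hle (LinearMap.mem_range_self φ v), f, ?_, fun r hr ↦ hfI ?_⟩
  · rw [← neg_sub, map_neg, neg_eq_zero]
    exact hf
  · exact Submodule.smul_mem_pointwise_smul r f I hr

end Diagonal

theorem IsLocallyFreeOfRank.kaehlerDifferential_tensorProduct {K S A : Type*} [CommRing K]
    [CommRing S] [CommRing A] [Algebra K S] [Algebra K A] {d : ℕ}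
    (h : IsLocallyFreeOfRank A Ω[A⁄K] d) :
    IsLocallyFreeOfRank (S ⊗[K] A) Ω[S ⊗[K] A⁄S] d := by
  algebraize [(Algebra.TensorProduct.includeRight (R := K) (A := S) (B := A)).toRingHom]
  exact (h.baseChange (S ⊗[K] A)).of_linearEquiv
    (KaehlerDifferential.tensorKaehlerEquiv K S A (S ⊗[K] A)).symm

/-- An alternating map, regarded as alternating over a smaller ring of scalars. -/
def AlternatingMap.restrictScalarsOfTower (P : Type*) {R M N ι : Type*} [CommRing P] [CommRing R]
    [AddCommGroup M] [AddCommGroup N] [Module R M] [Module R N] [Module P M] [Module P N]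
    [SMul P R] [IsScalarTower P R M] [IsScalarTower P R N] (f : M [⋀^ι]→ₗ[R] N) :
    M [⋀^ι]→ₗ[P] N where
  __ := f.toMultilinearMap.restrictScalars P
  map_eq_zero_of_eq' := f.map_eq_zero_of_eq'

@[simp]
theorem AlternatingMap.restrictScalarsOfTower_apply (P : Type*) {R M N ι : Type*} [CommRing P]
    [CommRing R] [AddCommGroup M] [AddCommGroup N] [Module R M] [Module R N] [Module P M]
    [Module P N] [SMul P R] [IsScalarTower P R M] [IsScalarTower P R N] (f : M [⋀^ι]→ₗ[R] N)
    (v : ι → M) : f.restrictScalarsOfTower P v = f v :=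
  rfl

theorem exteriorPower.ιMulti_one_tmul_ext {P R M N : Type*} [CommRing P] [CommRing R]
    [Algebra P R] [AddCommGroup M] [Module P M] [AddCommGroup N] [Module R N] {n : ℕ}
    {b b' : ⋀[R]^n (R ⊗[P] M) →ₗ[R] N}
    (h : ∀ m : Fin n → M, b (exteriorPower.ιMulti R n fun i ↦ 1 ⊗ₜ m i) =
      b' (exteriorPower.ιMulti R n fun i ↦ 1 ⊗ₜ m i)) : b = b' := by
  have hs : Submodule.span R (Set.range (TensorProduct.mk P R M 1)) = ⊤ := by
    refine Submodule.eq_top_iff'.2 fun v ↦ ?_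
    induction v with
    | zero => exact zero_mem _
    | add v w hv hw => exact add_mem hv hw
    | tmul r m =>
      rw [← mul_one r, ← smul_eq_mul, ← TensorProduct.smul_tmul']
      exact Submodule.smul_mem _ r (Submodule.subset_span ⟨m, rfl⟩)
  refine LinearMap.ext_on (exteriorPower.ιMulti_span_of_span R n (R ⊗[P] M) hs) ?_
  rintro _ ⟨v, hv, rfl⟩
  choose m hm using fun i ↦ hv ⟨i, rfl⟩
  obtain rfl := funext hm
  exact h m

section BaseChange

variable {P R M : Type*} [CommRing P] [CommRing R] [Algebra P R] [Algebra R P]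
  [IsScalarTower P R P] [AddCommGroup M] [Module P M]

theorem algebraMap_smul_of_retraction (p x : P) : algebraMap P R p • x = p • x := by
  rw [Algebra.algebraMap_eq_smul_one, smul_assoc, one_smul]

theorem algebraMap_algebraMap_of_retraction (p : P) : algebraMap R P (algebraMap P R p) = p := by
  rw [Algebra.algebraMap_eq_smul_one, algebraMap_smul_of_retraction, smul_eq_mul, mul_one]

/-- Along a retraction `R → P` of `P → R`, the `P`-valued `R`-linear forms on the exterior powers
of `R ⊗ M` are those on the exterior powers of `M`. -/
theorem exteriorPower.exists_linearEquiv_dual_baseChange (n : ℕ) :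
    ∃ e : (⋀[R]^n (R ⊗[P] M) →ₗ[R] P) ≃+ (⋀[P]^n M →ₗ[P] P),
      ∀ (p : P) b, e (algebraMap P R p • b) = p • e b := by
  let f : (⋀[R]^n (R ⊗[P] M) →ₗ[R] P) →+ (⋀[P]^n M →ₗ[P] P) :=
    { toFun b := exteriorPower.alternatingMapLinearEquiv
        (((exteriorPower.alternatingMapLinearEquiv.symm b).restrictScalarsOfTower P).compLinearMap
          (TensorProduct.mk P R M 1))
      map_zero' := by ext; simp
      map_add' _ _ := by ext; simp }
  have hf (b) (m : Fin n → M) : f b (exteriorPower.ιMulti P n m) =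
      b (exteriorPower.ιMulti R n fun i ↦ 1 ⊗ₜ m i) := by
    simp [f]
  refine ⟨AddEquiv.ofBijective f ⟨fun b b' h ↦ ?_, fun a ↦ ?_⟩, fun p b ↦ ?_⟩
  · refine exteriorPower.ιMulti_one_tmul_ext fun m ↦ ?_
    rw [← hf, ← hf, h]
  · let : Module R M := Module.compHom M (algebraMap R P)
    have : IsScalarTower R P M := ⟨fun r p m ↦ by
      rw [Algebra.smul_def, mul_smul]; rfl⟩
    have : IsScalarTower P R M := ⟨fun p r m ↦ by
      rw [Algebra.smul_def, mul_smul]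
      change algebraMap R P (algebraMap P R p) • (r • m) = p • r • m
      rw [algebraMap_algebraMap_of_retraction]⟩
    let π : R ⊗[P] M →ₗ[R] M :=
      TensorProduct.AlgebraTensorModule.lift (LinearMap.toSpanSingleton R _ LinearMap.id)
    refine ⟨exteriorPower.alternatingMapLinearEquiv
      (((exteriorPower.alternatingMapLinearEquiv.symm a).restrictScalarsOfTower R).compLinearMap π), ?_⟩
    refine exteriorPower.linearMap_ext (AlternatingMap.ext fun m ↦ ?_)
    simp only [LinearMap.compAlternatingMap_apply]
    rw [hf]
    simp [π]
  · refine exteriorPower.linearMap_ext (AlternatingMap.ext fun m ↦ ?_)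
    simp only [LinearMap.compAlternatingMap_apply, LinearMap.smul_apply]
    change f (algebraMap P R p • b) _ = p • f b _
    rw [hf, hf, LinearMap.smul_apply, algebraMap_smul_of_retraction]

end BaseChange

section Diagonal

theorem exteriorPower.comp_eq_zero_of_mem_coboundaries {R F M : Type*} [CommRing R]
    [AddCommGroup F] [Module R F] [AddCommGroup M] [Module R M] (φ : F →ₗ[R] R)
    (hφ : ∀ v, ∀ m : M, φ v • m = 0) (μ : R →ₗ[R] M) {n : ℕ} {c : ⋀[R]^n F →ₗ[R] R}
    (hc : c ∈ coboundaries (X := fun n ↦ ⋀[R]^n F) R (exteriorPower.koszul φ) n) :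
    μ ∘ₗ c = 0 := by
  cases n with
  | zero => rw [(Submodule.mem_bot R).1 hc, LinearMap.comp_zero]
  | succ n =>
    obtain ⟨b, rfl⟩ := mem_coboundaries_succ.1 hc
    rw [← LinearMap.comp_assoc]
    exact exteriorPower.comp_koszul_eq_zero φ hφ (μ ∘ₗ b)

variable {P R M : Type} [CommRing P] [CommRing R] [Algebra P R] [Algebra R P]
  [IsScalarTower P R P] [AddCommGroup M] [Module P M]

theorem exists_ext_addEquiv_of_retraction [IsNoetherianRing P] [Algebra.EssFiniteType P R]
    [Algebra.FormallySmooth P R] [Module.Finite P M] [Module.Projective P M] {d : ℕ}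
    (hM : IsLocallyFreeOfRank P M d) (hΩ : IsLocallyFreeOfRank R Ω[R⁄P] d)
    (φ : R ⊗[P] M →ₗ[R] R) (hφ : ∀ v, algebraMap R P (φ v) = 0) {f : R}
    (hf : algebraMap R P (1 - f) = 0)
    (hf' : ∀ r, algebraMap R P r = 0 → f * r ∈ LinearMap.range φ) :
    ∃ e : (((Ext R (ModuleCat R) d).obj (Opposite.op (ModuleCat.of R P))).obj
        (ModuleCat.of R R)) ≃+ (⋀[P]^d M →ₗ[P] P),
      ∀ (p : P) x, e (algebraMap P R p • x) = p • e x := by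
  have : IsNoetherianRing R := Algebra.EssFiniteType.isNoetherianRing P R
  have hF := hM.baseChange R
  have hsub (n : ℕ) (hn : d < n) : Subsingleton (⋀[R]^n (R ⊗[P] M)) :=
    hF.subsingleton_exteriorPower hn
  have := hsub (d + 1) d.lt_succ_self
  let μ : R →ₗ[R] P := Algebra.linearMap R P
  let ρ : R →ₐ[P] P :=
    { algebraMap R P with commutes' := algebraMap_algebraMap_of_retraction }
  have hμ : Function.Surjective μ := fun p ↦
    ⟨algebraMap P R p, algebraMap_algebraMap_of_retraction p⟩
  obtain ⟨g, hg, hg', hac⟩ := exteriorPower.exists_isAcyclicUpTo_koszul φ μ hμ hφ hsub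
    (fun q hq hle ↦ have := hq.isPrime
      exteriorPower.exists_koszul_eq_smul_of_retraction ρ q hle (hΩ q this) (hF q this) φ hφ hf hf')
    hf hf'
  have hgP (p : P) : g • p = p := by
    have : algebraMap R P g = 1 := by
      rw [eq_comm, ← sub_eq_zero, ← map_one (algebraMap R P), ← map_sub]
      exact hg
    rw [Algebra.smul_def, this, one_mul]
  have hsmul (v) (p : P) : φ v • p = 0 := by
    rw [Algebra.smul_def, hφ, zero_mul]
  obtain ⟨e₁⟩ := hac.nonempty_ext_equiv hgP μ hμ d
    (fun c hc ↦ exteriorPower.comp_eq_zero_of_mem_coboundaries φ hsmul μ hc)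
    (fun c hc ↦ exteriorPower.smul_mem_coboundaries φ μ hg' d c hc)
  obtain ⟨e₂, he₂⟩ := exteriorPower.exists_linearEquiv_dual_baseChange (P := P) (R := R) (M := M) d
  refine ⟨e₁.toAddEquiv.trans e₂, fun p x ↦ ?_⟩
  rw [AddEquiv.trans_apply, AddEquiv.trans_apply, ← he₂]
  exact congrArg e₂ (e₁.map_smul _ _)

end Diagonal

theorem stmt5 (K P : Type) [CommRing K] [CommRing P] [IsNoetherianRing K]
    [IsNoetherianRing P] [Algebra K P] (d : ℕ)
    (hsm : EssentiallySmooth K P) (hd : RelDim K P d) :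
    letI : Algebra (P ⊗[K] P) P :=
      (Algebra.TensorProduct.lmul' (S := P) K).toRingHom.toAlgebra
    letI E := (((Ext (P ⊗[K] P) (ModuleCat (P ⊗[K] P)) d).obj
        (Opposite.op (ModuleCat.of (P ⊗[K] P) P))).obj
          (ModuleCat.of (P ⊗[K] P) (P ⊗[K] P)))
    letI : Module P E := Module.compHom E
      (Algebra.TensorProduct.includeLeftRingHom : P →+* P ⊗[K] P)
    Nonempty (E ≃ₗ[P] ((⋀[P]^d (Ω[P⁄K])) →ₗ[P] P)) ∧
      (Module.Finite P E ∧ Module.Projective P E ∧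
        ∀ (p : Ideal P) (_ : p.IsPrime),
          Module.rank (Localization.AtPrime p) (LocalizedModule p.primeCompl E) = 1) := by
  obtain ⟨_, _, _⟩ := hsm
  obtain ⟨_, _, hrank⟩ := hd
  have hM := IsLocallyFreeOfRank.of_rank hrank
  have : IsNoetherianRing (P ⊗[K] P) := Algebra.EssFiniteType.isNoetherianRing P (P ⊗[K] P)
  obtain ⟨φ, hφ, f, hf, hf'⟩ := KaehlerDifferential.exists_baseChange_toIdeal K P
  let : Algebra (P ⊗[K] P) P := (Algebra.TensorProduct.lmul' (S := P) K).toRingHom.toAlgebra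
  let E := ((Ext (P ⊗[K] P) (ModuleCat (P ⊗[K] P)) d).obj
    (Opposite.op (ModuleCat.of (P ⊗[K] P) P))).obj (ModuleCat.of (P ⊗[K] P) (P ⊗[K] P))
  let : Module P E := Module.compHom E
    (Algebra.TensorProduct.includeLeftRingHom : P →+* P ⊗[K] P)
  have : IsScalarTower P (P ⊗[K] P) P := .of_algebraMap_eq fun p ↦ by
    change p = Algebra.TensorProduct.lmul' (S := P) K (p ⊗ₜ 1)
    simp
  obtain ⟨e₀, he₀⟩ := exists_ext_addEquiv_of_retraction hM
    (IsLocallyFreeOfRank.kaehlerDifferential_tensorProduct hM) φ hφ hf hf'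
  let e : E ≃ₗ[P] (⋀[P]^d Ω[P⁄K]) →ₗ[P] P := { e₀ with map_smul' := he₀ }
  refine ⟨⟨e⟩, .equiv e.symm, .of_equiv e.symm, fun p hp ↦ ?_⟩
  have h := (hM.dual_exteriorPower.of_linearEquiv e).rank_eq p hp
  rwa [Nat.cast_one] at h
end

section
/- Let K → P be an essentially smooth homomorphism of commutative noetherian rings of relative dimension d. Then there is an isomorphism of P-modules Ω^d_{P|K} ≅ Hom_P(Ext^d_{Pᵉ}(P, Pᵉ), P). -/
/-!
STATEMENT 6: For `K → P` essentially smooth of relative dimension `d`,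
`Ω^d_{P|K} ≅ Hom_P(Ext^d_{Pᵉ}(P, Pᵉ), P)` as `P`-modules.
-/

open CategoryTheory TensorProduct

section

open Polynomial

theorem exists_ringHom_truncated_polynomial {A S T B : Type*} [CommRing A] [CommRing S]
    [CommRing T] [CommRing B] [Algebra A S] [Algebra.FormallySmooth A S] (D : Derivation A S S)
    (p : S →+* T) (π : T[X] →+* B) (hπ : Function.Surjective π) {n : ℕ} (hX : π (X ^ n) = 0) :
    ∃ ψ : S →+* B, ∀ r, ∃ q : T[X], ψ r = π (C (p r) + C (p (D r)) * X + X ^ 2 * q) := by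
  let : Algebra A B := (π.comp (C.comp (p.comp (algebraMap A S)))).toAlgebra
  let I : Ideal B := Ideal.span {π (X ^ 2)}
  have hI : IsNilpotent I := by
    refine ⟨n, ?_⟩
    rw [Ideal.span_singleton_pow, ← map_pow, Ideal.zero_eq_bot, Ideal.span_singleton_eq_bot,
      ← pow_mul, mul_comm, pow_mul, map_pow, hX, zero_pow two_ne_zero]
  let g : S →ₐ[A] B ⧸ I :=
    { toFun := fun r => Ideal.Quotient.mk I (π (C (p r) + C (p (D r)) * X))
      map_one' := by simp
      map_mul' := fun a b => by
        rw [← map_mul, ← map_mul, Ideal.Quotient.mk_eq_mk_iff_sub_mem, ← map_sub,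
          Ideal.mem_span_singleton]
        refine ⟨π (- C (p (D a)) * C (p (D b))), ?_⟩
        rw [← map_mul]
        congr 1
        simp only [Derivation.leibniz, smul_eq_mul, map_mul, map_add]
        ring
      map_zero' := by simp
      map_add' := fun a b => by
        simp only [map_add, add_mul]
        ring
      commutes' := fun a => by
        simp only [Derivation.map_algebraMap, map_zero, zero_mul, add_zero]
        rfl }
  obtain ⟨f, hf⟩ := Algebra.FormallySmooth.exists_lift I hI g
  refine ⟨f.toRingHom, fun r => ?_⟩
  have h : Ideal.Quotient.mk I (f r) = Ideal.Quotient.mk I (π (C (p r) + C (p (D r)) * X)) :=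
    DFunLike.congr_fun hf r
  rw [Ideal.Quotient.mk_eq_mk_iff_sub_mem, Ideal.mem_span_singleton] at h
  obtain ⟨q, hq⟩ := h
  obtain ⟨q, rfl⟩ := hπ q
  refine ⟨q, ?_⟩
  rw [sub_eq_iff_eq_add, ← map_mul] at hq
  rw [map_add _ _ (X ^ 2 * q), add_comm]
  exact hq

theorem mem_span_of_pow_mul_eq_zero {A S : Type*} [CommRing A] [CommRing S] [Algebra A S]
    [Algebra.FormallySmooth A S] (D : Derivation A S S) {x : S} (hx : D x = 1) {r : S} {n : ℕ}
    (h : x ^ n * r = 0) : r ∈ Ideal.span {x} := by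
  have hX : Ideal.Quotient.mk (Ideal.span {(X : (S ⧸ Ideal.span {x})[X]) ^ (n + 1)})
      (X ^ (n + 1)) = 0 :=
    Ideal.Quotient.eq_zero_iff_mem.mpr (Ideal.mem_span_singleton_self _)
  obtain ⟨ψ, hψ⟩ := exists_ringHom_truncated_polynomial D
    (Ideal.Quotient.mk (Ideal.span {x})) _ Ideal.Quotient.mk_surjective hX
  obtain ⟨a, ha⟩ := hψ x
  obtain ⟨b, hb⟩ := hψ r
  have hx0 : Ideal.Quotient.mk (Ideal.span {x}) x = 0 :=
    Ideal.Quotient.eq_zero_iff_mem.mpr (Ideal.mem_span_singleton_self x)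
  have h0 := congrArg ψ h
  rw [map_mul, map_pow, ha, hb, map_zero, ← map_pow, ← map_mul, Ideal.Quotient.eq_zero_iff_mem,
    Ideal.mem_span_singleton, hx, hx0, map_zero, map_one, map_one, zero_add, one_mul] at h0
  rw [X_pow_dvd_iff] at h0
  have h1 := h0 n (Nat.lt_succ_self n)
  have h2 : (X + X ^ 2 * a) ^ n * (C (Ideal.Quotient.mk (Ideal.span {x}) r) +
      C (Ideal.Quotient.mk (Ideal.span {x}) (D r)) * X + X ^ 2 * b) =
      ((1 + X * a) ^ n * (C (Ideal.Quotient.mk (Ideal.span {x}) r) +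
      C (Ideal.Quotient.mk (Ideal.span {x}) (D r)) * X + X ^ 2 * b)) * X ^ n := by
    rw [show X + X ^ 2 * a = X * (1 + X * a) by ring, mul_pow]; ring
  rw [h2, coeff_mul_X_pow', if_pos le_rfl, Nat.sub_self, coeff_zero_eq_eval_zero] at h1
  simpa [Ideal.Quotient.eq_zero_iff_mem] using h1

theorem eq_zero_of_mul_eq_zero_of_derivation {A S : Type*} [CommRing A] [CommRing S] [Algebra A S]
    [Algebra.FormallySmooth A S] [IsNoetherianRing S] [IsLocalRing S] (D : Derivation A S S)
    {x : S} (hm : x ∈ IsLocalRing.maximalIdeal S) (hx : D x = 1) {r : S} (h : x * r = 0) :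
    r = 0 := by
  have key : ∀ n : ℕ, ∃ t, r = x ^ n * t := by
    intro n
    induction n with
    | zero => exact ⟨r, by simp⟩
    | succ n ih =>
      obtain ⟨t, rfl⟩ := ih
      obtain ⟨t', rfl⟩ := Ideal.mem_span_singleton.mp
        (mem_span_of_pow_mul_eq_zero D hx (n := n + 1) (r := t) (by rw [← h]; ring))
      exact ⟨t', by ring⟩
  have hbot := Ideal.iInf_pow_eq_bot_of_isLocalRing (Ideal.span {x})
    (by
      intro hT
      exact (IsLocalRing.maximalIdeal.isMaximal S).ne_top
        (top_le_iff.mp (hT ▸ (Ideal.span_singleton_le_iff_mem _).mpr hm)))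
  rw [← Ideal.mem_bot, ← hbot, Ideal.mem_iInf]
  intro n
  obtain ⟨t, ht⟩ := key n
  rw [Ideal.span_singleton_pow, Ideal.mem_span_singleton]
  exact ⟨t, ht⟩

end

theorem exists_derivation_quotient {A S : Type*} [CommRing A] [CommRing S] [Algebra A S]
    (D : Derivation A S S) (I : Ideal S) (h : ∀ x ∈ I, D x ∈ I) :
    ∃ D' : Derivation A (S ⧸ I) (S ⧸ I),
      ∀ s, D' (Ideal.Quotient.mk I s) = Ideal.Quotient.mk I (D s) := by
  let f : S ⧸ I →+ S ⧸ I := QuotientAddGroup.map I.toAddSubgroup I.toAddSubgroup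
    (D : S →ₗ[A] S).toAddMonoidHom h
  have hf : ∀ s, f (Ideal.Quotient.mk I s) = Ideal.Quotient.mk I (D s) := fun s => rfl
  let g : S ⧸ I →ₗ[A] S ⧸ I :=
    { f with
      map_smul' := fun a x => by
        obtain ⟨x, rfl⟩ := Ideal.Quotient.mk_surjective x
        change f (Ideal.Quotient.mk I (a • x)) = a • f (Ideal.Quotient.mk I x)
        rw [hf, hf, D.map_smul]
        rfl }
  refine ⟨Derivation.mk' g fun a b => ?_, hf⟩
  obtain ⟨a, rfl⟩ := Ideal.Quotient.mk_surjective a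
  obtain ⟨b, rfl⟩ := Ideal.Quotient.mk_surjective b
  have hg : ∀ s, g (Ideal.Quotient.mk I s) = Ideal.Quotient.mk I (D s) := hf
  rw [← map_mul, hg, hg, hg, D.leibniz]
  simp

theorem formallySmooth_quotient_span {A S ι : Type*} [CommRing A] [CommRing S] [Algebra A S]
    [Algebra.FormallySmooth A S] [Fintype ι] [DecidableEq ι] (x : ι → S)
    (D : ι → Derivation A S S) (hD : ∀ i j, D i (x j) = if i = j then 1 else 0) :
    Algebra.FormallySmooth A (S ⧸ Ideal.span (Set.range x)) := by
  set I := Ideal.span (Set.range x) with hI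
  have hs : Function.Surjective (algebraMap S (S ⧸ I)) := Ideal.Quotient.mk_surjective
  rw [Algebra.FormallySmooth.iff_split_injection hs]
  have hker : RingHom.ker (algebraMap S (S ⧸ I)) = I := Ideal.mk_ker
  let y : ι → RingHom.ker (algebraMap S (S ⧸ I)) := fun i =>
    ⟨x i, hker.symm ▸ Ideal.subset_span ⟨i, rfl⟩⟩
  let t : ι → (S ⧸ I →ₗ[S] (RingHom.ker (algebraMap S (S ⧸ I))).Cotangent) := fun i =>
    Submodule.liftQ I (LinearMap.toSpanSingleton S _ (Ideal.toCotangent _ (y i))) fun r hr => by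
      rw [LinearMap.mem_ker, LinearMap.toSpanSingleton_apply]
      exact Ideal.Cotangent.smul_eq_zero_of_mem (hker.symm ▸ hr) _
  let l : (S ⧸ I) ⊗[S] Ω[S⁄A] →ₗ[S] (RingHom.ker (algebraMap S (S ⧸ I))).Cotangent :=
    ∑ i, t i ∘ₗ (TensorProduct.rid S (S ⧸ I)).toLinearMap ∘ₗ
      (D i).liftKaehlerDifferential.lTensor (S ⧸ I)
  have hl : ∀ z, l (KaehlerDifferential.kerCotangentToTensor A S (S ⧸ I)
      (Ideal.toCotangent _ z)) = ∑ i, D i z • Ideal.toCotangent _ (y i) := by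
    intro z
    rw [KaehlerDifferential.kerCotangentToTensor_toCotangent]
    simp only [l, LinearMap.sum_apply, LinearMap.comp_apply, LinearMap.lTensor_tmul,
      Derivation.liftKaehlerDifferential_comp_D, LinearEquiv.coe_coe, TensorProduct.rid_tmul]
    refine Finset.sum_congr rfl fun i _ => ?_
    rw [map_smul]
    congr 1
    exact one_smul S (Ideal.toCotangent _ (y i))
  refine ⟨l, LinearMap.ext fun c => ?_⟩
  obtain ⟨z, rfl⟩ := Ideal.toCotangent_surjective _ c
  rw [LinearMap.comp_apply, hl, LinearMap.id_apply]
  have hz : (z : S) ∈ I := hker.le z.2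
  obtain ⟨c, hc⟩ := (Submodule.mem_span_range_iff_exists_fun S).mp hz
  have hz' : z = ∑ j, c j • y j := Subtype.ext (by simpa [y] using hc.symm)
  rw [hz', map_sum]
  refine Finset.sum_congr rfl fun i _ => ?_
  rw [map_smul, ← sub_eq_zero, ← sub_smul]
  apply Ideal.Cotangent.smul_eq_zero_of_mem
  refine hker.ge ?_
  have : D i (∑ j, c j • y j : RingHom.ker (algebraMap S (S ⧸ I))) =
      c i + ∑ j, x j * D i (c j) := by
    simp [y, hD, Finset.sum_add_distrib]
  rw [this, add_sub_cancel_left]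
  exact Ideal.sum_mem _ fun j _ => Ideal.mul_mem_right _ _ (Ideal.subset_span ⟨j, rfl⟩)

theorem mem_span_of_mul_mem_span_of_derivation {A S ι : Type*} [CommRing A] [CommRing S]
    [Algebra A S] [Algebra.FormallySmooth A S] [IsNoetherianRing S] [IsLocalRing S]
    [Fintype ι] [DecidableEq ι] {x : ι → S} (hx : ∀ i, x i ∈ IsLocalRing.maximalIdeal S)
    {D : ι → Derivation A S S} (hD : ∀ i j, D i (x j) = if i = j then 1 else 0)
    (s : Set ι) {i : ι} (hi : i ∉ s) {r : S} (h : x i * r ∈ Ideal.span (x '' s)) :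
    r ∈ Ideal.span (x '' s) := by
  classical
  set I := Ideal.span (x '' s) with hI
  have hr : x '' s = Set.range (fun j : s => x j) := by
    rw [Set.image_eq_range]
  have : Algebra.FormallySmooth A (S ⧸ I) := by
    rw [hI, hr]
    exact formallySmooth_quotient_span (fun j : s => x j) (fun j => D j) fun i j => by
      simp [hD, Subtype.ext_iff]
  have hIm : I ≤ IsLocalRing.maximalIdeal S := by
    rw [hI, Ideal.span_le]
    rintro _ ⟨j, _, rfl⟩
    exact hx j
  have hIt : I ≠ ⊤ := fun e : I = ⊤ =>
    (IsLocalRing.maximalIdeal.isMaximal S).ne_top (top_le_iff.mp (e.ge.trans hIm))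
  have : Nontrivial (S ⧸ I) := Ideal.Quotient.nontrivial_iff.mpr hIt
  have : IsLocalRing (S ⧸ I) :=
    IsLocalRing.of_surjective' (Ideal.Quotient.mk I) Ideal.Quotient.mk_surjective
  obtain ⟨D', hD'⟩ := exists_derivation_quotient (D i) I (fun z hz => by
    refine Submodule.span_induction (p := fun z _ => D i z ∈ I) ?_ (by simp) ?_ ?_ hz
    · rintro _ ⟨j, hj, rfl⟩
      rw [hD, if_neg (by rintro rfl; exact hi hj)]
      exact I.zero_mem
    · intro a b _ _ ha hb
      rw [map_add]
      exact I.add_mem ha hb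
    · intro a b hb hb'
      rw [smul_eq_mul, Derivation.leibniz]
      exact I.add_mem (I.mul_mem_left _ hb') (I.mul_mem_right _ hb))
  rw [← Ideal.Quotient.eq_zero_iff_mem] at h ⊢
  rw [map_mul] at h
  refine eq_zero_of_mul_eq_zero_of_derivation D' ?_ ?_ h
  · rw [IsLocalRing.mem_maximalIdeal, mem_nonunits_iff]
    intro hu
    obtain ⟨v, hv⟩ := hu.exists_right_inv
    obtain ⟨v, rfl⟩ := Ideal.Quotient.mk_surjective v
    rw [← map_mul, ← map_one (Ideal.Quotient.mk I), Ideal.Quotient.mk_eq_mk_iff_sub_mem] at hv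
    refine (IsLocalRing.maximalIdeal.isMaximal S).ne_top ((Ideal.eq_top_iff_one _).mpr ?_)
    rw [← sub_sub_cancel (x i * v) 1]
    exact Ideal.sub_mem _ (Ideal.mul_mem_right _ _ (hx i)) (hIm hv)
  · rw [hD', hD, if_pos rfl, map_one]

theorem exists_derivation_of_formallyEtale {A R S : Type*} [CommRing A] [CommRing R] [CommRing S]
    [Algebra A R] [Algebra A S] [Algebra R S] [IsScalarTower A R S] [Algebra.FormallyEtale R S]
    (D : Derivation A R R) :
    ∃ D' : Derivation A S S, ∀ r, D' (algebraMap R S r) = algebraMap R S (D r) := by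
  let l : S ⊗[R] Ω[R⁄A] →ₗ[S] S :=
    LinearMap.liftBaseChange S (Algebra.linearMap R S ∘ₗ D.liftKaehlerDifferential)
  refine ⟨(l ∘ₗ (KaehlerDifferential.tensorKaehlerEquivOfFormallyEtale A R S).symm.toLinearMap).compDer
    (KaehlerDifferential.D A S), fun r => ?_⟩
  change l ((KaehlerDifferential.tensorKaehlerEquivOfFormallyEtale A R S).symm
    (KaehlerDifferential.D A S (algebraMap R S r))) = _
  rw [KaehlerDifferential.tensorKaehlerEquivOfFormallyEtale_symm_D_algebraMap]
  simp [l]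

theorem exists_mul_mem_span_of_derivation {A R ι : Type*} [CommRing A] [CommRing R]
    [Algebra A R] [Algebra.FormallySmooth A R] [IsNoetherianRing R]
    [Fintype ι] [DecidableEq ι] (p : Ideal R) [p.IsPrime] {x : ι → R} (hx : ∀ i, x i ∈ p)
    {D : ι → Derivation A R R} {u : R} (hu : u ∉ p)
    (hD : ∀ i j, D i (x j) - (if i = j then u else 0) ∈ p)
    (s : Set ι) {i : ι} (hi : i ∉ s) {r : R} (h : x i * r ∈ Ideal.span (x '' s)) :
    ∃ w ∉ p, w * r ∈ Ideal.span (x '' s) := by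
  classical
  let S := Localization.AtPrime p
  have : Algebra.FormallyEtale R S := .of_isLocalization p.primeCompl
  have : Algebra.FormallySmooth A S := .comp A R S
  have : IsNoetherianRing S := IsLocalization.isNoetherianRing p.primeCompl S inferInstance
  choose D' hD' using fun i => exists_derivation_of_formallyEtale (S := S) (D i)
  let N : Matrix ι ι S := .of fun i j => D' i (algebraMap R S (x j))
  have hN : IsUnit N.det := by
    rw [← IsLocalRing.residue_ne_zero_iff_isUnit, RingHom.map_det]
    have : (IsLocalRing.residue S).mapMatrix N =
        Matrix.scalar ι (IsLocalRing.residue S (algebraMap R S u)) := by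
      ext i j
      rw [RingHom.mapMatrix_apply, Matrix.map_apply, Matrix.scalar_apply, Matrix.diagonal_apply]
      change IsLocalRing.residue S (D' i (algebraMap R S (x j))) = _
      rw [hD']
      have h1 : IsLocalRing.residue S
          (algebraMap R S (D i (x j) - (if i = j then u else 0))) = 0 := by
        rw [IsLocalRing.residue_eq_zero_iff, IsLocalization.AtPrime.to_map_mem_maximal_iff S p]
        exact hD i j
      rw [map_sub, map_sub, sub_eq_zero] at h1
      rw [h1]
      split_ifs <;> simp
    rw [this, Matrix.scalar_apply, Matrix.det_diagonal]
    refine Finset.prod_ne_zero_iff.mpr fun _ _ => ?_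
    rw [Ne, IsLocalRing.residue_eq_zero_iff, IsLocalization.AtPrime.to_map_mem_maximal_iff S p]
    exact hu
  let E : ι → Derivation A S S := fun i => ∑ k, N⁻¹ i k • D' k
  have hE : ∀ i j, E i (algebraMap R S (x j)) = if i = j then 1 else 0 := by
    intro i j
    have := congrFun (congrFun (Matrix.nonsing_inv_mul N hN) i) j
    rw [Matrix.mul_apply, Matrix.one_apply] at this
    rw [← this]
    change Derivation.coeFnAddMonoidHom (∑ k, N⁻¹ i k • D' k) _ = _
    rw [map_sum, Finset.sum_apply]
    rfl
  have h' : algebraMap R S (x i) * algebraMap R S r ∈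
      Ideal.span ((fun j => algebraMap R S (x j)) '' s) := by
    have := Ideal.mem_map_of_mem (algebraMap R S) h
    rwa [Ideal.map_span, Set.image_image, map_mul] at this
  have hr := mem_span_of_mul_mem_span_of_derivation
    (fun i => (IsLocalization.AtPrime.to_map_mem_maximal_iff S p _).mpr (hx i)) hE s hi h'
  rw [← Set.image_image (algebraMap R S) x, ← Ideal.map_span,
    IsLocalization.algebraMap_mem_map_algebraMap_iff p.primeCompl] at hr
  exact hr

namespace ExteriorAlgebra
variable {R M : Type*} [CommRing R] [AddCommGroup M] [Module R M]

/-- Interior multiplication by a linear form. -/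
noncomputable def contract (f : Module.Dual R M) : ExteriorAlgebra R M →ₗ[R] ExteriorAlgebra R M :=
  CliffordAlgebra.contractLeft f

@[simp]
theorem contract_algebraMap (f : Module.Dual R M) (r : R) :
    contract f (algebraMap R (ExteriorAlgebra R M) r) = 0 :=
  CliffordAlgebra.contractLeft_algebraMap _ _ _

@[simp]
theorem contract_ι (f : Module.Dual R M) (m : M) :
    contract f (ι R m) = algebraMap R (ExteriorAlgebra R M) (f m) :=
  CliffordAlgebra.contractLeft_ι _ _ _

theorem contract_ι_mul (f : Module.Dual R M) (m : M) (x : ExteriorAlgebra R M) :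
    contract f (ι R m * x) = f m • x - ι R m * contract f x :=
  CliffordAlgebra.contractLeft_ι_mul _ _ _

theorem contract_contract_self (f : Module.Dual R M) (x : ExteriorAlgebra R M) :
    contract f (contract f x) = 0 := CliffordAlgebra.contractLeft_contractLeft _ _

theorem contract_swap (f g : Module.Dual R M) (x : ExteriorAlgebra R M) :
    contract f (contract g x) = -contract g (contract f x) :=
  CliffordAlgebra.contractLeft_comm _ _ _

theorem ι_mul_mem {n : ℕ} {x : ExteriorAlgebra R M} (hx : x ∈ ⋀[R]^n M) (m : M) :
    ι R m * x ∈ ⋀[R]^(n + 1) M := by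
  rw [exteriorPower, pow_succ']
  exact Submodule.mul_mem_mul ⟨m, rfl⟩ hx

theorem mem_exteriorPower_zero {x : ExteriorAlgebra R M} :
    x ∈ ⋀[R]^0 M ↔ ∃ r, algebraMap R _ r = x := by
  rw [exteriorPower, pow_zero, Submodule.mem_one]

theorem mem_exteriorPower_one {x : ExteriorAlgebra R M} :
    x ∈ ⋀[R]^1 M ↔ ∃ m, ι R m = x := by
  rw [exteriorPower, pow_one]
  rfl

theorem contract_mem (f : Module.Dual R M) {n : ℕ} {x : ExteriorAlgebra R M}
    (hx : x ∈ ⋀[R]^(n + 1) M) : contract f x ∈ ⋀[R]^n M := by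
  induction n generalizing x with
  | zero =>
    rw [exteriorPower, zero_add, pow_one] at hx
    obtain ⟨m, rfl⟩ := hx
    rw [mem_exteriorPower_zero]
    exact ⟨f m, (contract_ι f m).symm⟩
  | succ n ih =>
    rw [exteriorPower, pow_succ'] at hx
    refine Submodule.mul_induction_on hx ?_ fun a b ha hb => by
      rw [map_add]; exact add_mem ha hb
    rintro _ ⟨m, rfl⟩ y hy
    rw [contract_ι_mul]
    exact sub_mem (Submodule.smul_mem _ _ hy) (ι_mul_mem (ih hy) m)

variable {ι' : Type*} [DecidableEq ι'] {m : ι' → M} {l : ι' → Module.Dual R M} {u : R}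

theorem exists_killing_endomorphism (hlm : ∀ i j, l i (m j) = if i = j then u else 0)
    (s : Finset ι') : ∃ P : ExteriorAlgebra R M →ₗ[R] ExteriorAlgebra R M,
      (∀ z, (∀ k, contract (l k) z = 0) → P z = u ^ s.card • z) ∧
      (∀ k ∈ s, ∀ y, P (ι R (m k) * y) = 0) ∧
      ∀ k ∉ s, ∀ y, P (ι R (m k) * y) = ι R (m k) * P y := by
  induction s using Finset.induction_on with
  | empty => exact ⟨LinearMap.id, by simp, by simp, by simp⟩
  | insert i s hi ih =>
    obtain ⟨P, h1, h2, h3⟩ := ih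
    have hT : ∀ k, k ≠ i → ∀ y, contract (l i) (ι R (m i) * (ι R (m k) * y)) =
        ι R (m k) * contract (l i) (ι R (m i) * y) := by
      intro k hk y
      have : ι R (m i) * ι R (m k) = - (ι R (m k) * ι R (m i)) :=
        eq_neg_of_add_eq_zero_left (ι_add_mul_swap _ _)
      rw [← mul_assoc, this, neg_mul, map_neg, mul_assoc, contract_ι_mul _ (m k), hlm,
        if_neg hk.symm, zero_smul, zero_sub, neg_neg]
    refine ⟨P ∘ₗ contract (l i) ∘ₗ LinearMap.mulLeft R (ι R (m i)), ?_, ?_, ?_⟩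
    · intro z hz
      change P (contract (l i) (ι R (m i) * z)) = _
      rw [contract_ι_mul, hz, mul_zero, sub_zero, hlm, if_pos rfl, map_smul, h1 z hz,
        Finset.card_insert_of_notMem hi, pow_succ', mul_smul]
    · intro k hk y
      change P (contract (l i) (ι R (m i) * (ι R (m k) * y))) = _
      rcases eq_or_ne k i with rfl | hki
      · rw [← mul_assoc, ι_sq_zero, zero_mul, map_zero, map_zero]
      · rw [hT k hki, h2 k (Finset.mem_of_mem_insert_of_ne hk hki)]
    · intro k hk y
      change P (contract (l i) (ι R (m i) * (ι R (m k) * y))) = _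
      rw [Finset.mem_insert, not_or] at hk
      rw [hT k hk.1, h3 k hk.2]
      rfl

theorem exists_smul_eq_zero_of_contract [Fintype ι'] (hlm : ∀ i j, l i (m j) = if i = j then u else 0)
    (hm : ∀ v, u • v = ∑ i, l i v • m i) {n : ℕ} {z : ExteriorAlgebra R M}
    (hz : z ∈ ⋀[R]^(n + 1) M) (h : ∀ k, contract (l k) z = 0) :
    u ^ (Fintype.card ι' + 1) • z = 0 := by
  obtain ⟨P, h1, h2, -⟩ := exists_killing_endomorphism hlm Finset.univ
  have h0 : P (u • z) = 0 := by
    rw [exteriorPower, pow_succ'] at hz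
    refine Submodule.mul_induction_on hz ?_ fun a b ha hb => by
      rw [smul_add, map_add, ha, hb, add_zero]
    rintro _ ⟨v, rfl⟩ y -
    have : u • ((ι R v : ExteriorAlgebra R M) * y) = ∑ i, l i v • (ι R (m i) * y) := by
      rw [← smul_mul_assoc, ← map_smul, hm, map_sum, Finset.sum_mul]
      exact Finset.sum_congr rfl fun i _ => by rw [map_smul, smul_mul_assoc]
    rw [this]
    rw [map_sum]
    exact Finset.sum_eq_zero fun i hi => by rw [map_smul, h2 i hi, smul_zero]
  rw [map_smul, h1 z h, Finset.card_univ] at h0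
  rw [pow_succ', mul_smul, h0]

theorem _root_.Submodule.exists_sum_of_mem_span_image_finset {N : Type*} [AddCommGroup N]
    [Module R N] {v : ι' → N} {s : Finset ι'} {x : N} (hx : x ∈ Submodule.span R (v '' s)) :
    ∃ c : ι' → R, ∑ k ∈ s, c k • v k = x := by
  obtain ⟨c, hc⟩ := (Submodule.mem_span_image_finset_iff_exists_fun R).mp hx
  refine ⟨fun k => if h : k ∈ s then c ⟨k, h⟩ else 0, ?_⟩
  rw [← hc, ← Finset.sum_coe_sort s]
  exact Finset.sum_congr rfl fun k _ => by simp

theorem exists_contract_eq_smul [Fintype ι'] (W : Submonoid R) (hu : u ∈ W) (f : Module.Dual R M)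
    (hlm : ∀ i j, l i (m j) = if i = j then u else 0) (hm : ∀ v, u • v = ∑ i, l i v • m i)
    (hreg : ∀ (s : Finset ι') (i : ι') (r : R), i ∉ s →
      f (m i) * r ∈ Ideal.span ((fun k => f (m k)) '' (s : Set ι')) →
      ∃ w ∈ W, w * r ∈ Ideal.span ((fun k => f (m k)) '' (s : Set ι'))) (s : Finset ι') :
    ∀ (n : ℕ) (z : ExteriorAlgebra R M), z ∈ ⋀[R]^(n + 1) M →
      (∀ k ∉ s, contract (l k) z = 0) → contract f z = 0 →
      ∃ w ∈ W, ∃ y ∈ ⋀[R]^(n + 2) M, (∀ k ∉ s, contract (l k) y = 0) ∧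
        contract f y = w • z := by
  induction s using Finset.induction_on with
  | empty =>
    intro n z hz hk _
    refine ⟨_, pow_mem hu (Fintype.card ι' + 1), 0, zero_mem _, by simp, ?_⟩
    rw [map_zero, exists_smul_eq_zero_of_contract hlm hm hz fun k => hk k (by simp)]
  | insert i s hi ih =>
    intro n z hz hk hf
    set b := contract (l i) z with hb
    set a := contract (l i) (ι R (m i) * z) with ha
    have hab : u • z = a + ι R (m i) * b := by
      rw [ha, contract_ι_mul, hlm, if_pos rfl, sub_add_cancel]
    have hbn : b ∈ ⋀[R]^n M := contract_mem _ hz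
    have han : a ∈ ⋀[R]^(n + 1) M := contract_mem _ (ι_mul_mem hz _)
    have hbk : ∀ k ∉ s, contract (l k) b = 0 := by
      intro k hks
      rcases eq_or_ne k i with rfl | hki
      · exact contract_contract_self _ _
      · rw [hb, contract_swap, hk k (by simp [hks, hki]), map_zero, neg_zero]
    have hak : ∀ k ∉ s, contract (l k) a = 0 := by
      intro k hks
      rcases eq_or_ne k i with rfl | hki
      · exact contract_contract_self _ _
      · rw [ha, contract_swap, contract_ι_mul, hk k (by simp [hks, hki]), hlm,
          if_neg hki, zero_smul, mul_zero, sub_zero, map_zero, neg_zero]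
    have hbf : contract f b = 0 := by
      rw [hb, contract_swap, hf, map_zero, neg_zero]
    have haf : contract f a = -(f (m i) • b) := by
      have := congrArg (contract f) hab
      rw [map_smul, hf, smul_zero, map_add, contract_ι_mul, hbf, mul_zero, sub_zero] at this
      exact eq_neg_of_add_eq_zero_left this.symm
    obtain ⟨w, hw, c, hcn, hck, hcf⟩ : ∃ w ∈ W, ∃ c ∈ ⋀[R]^(n + 1) M,
        (∀ k ∉ s, contract (l k) c = 0) ∧ contract f c = w • b := by
      cases n with
      | succ n => exact ih n b hbn hbk hbf
      | zero =>
        obtain ⟨r, hr⟩ := mem_exteriorPower_zero.mp hbn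
        obtain ⟨v, hv⟩ := mem_exteriorPower_one.mp han
        have hlv : ∀ k ∉ s, l k v = 0 := by
          intro k hks
          have := hak k hks
          rw [← hv] at this
          rw [contract_ι] at this
          exact (algebraMap_inj M _ _).mp (this.trans (map_zero _).symm)
        have hfv : f v = -(f (m i) * r) := by
          rw [← hv, ← hr] at haf
          rw [contract_ι] at haf
          rw [← algebraMap_inj M, map_neg, map_mul, ← Algebra.smul_def]
          exact haf
        obtain ⟨w, hw, hwr⟩ := hreg s i (u * r) hi (by
          have : f (m i) * (u * r) = - ∑ k, l k v * f (m k) := by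
            rw [mul_left_comm, ← neg_eq_iff_eq_neg, ← mul_neg, ← hfv, ← smul_eq_mul,
              ← map_smul, hm, map_sum]
            simp
          rw [this]
          refine neg_mem (Ideal.sum_mem _ fun k _ => ?_)
          by_cases hks : k ∈ s
          · exact Ideal.mul_mem_left _ _ (Ideal.subset_span ⟨k, hks, rfl⟩)
          · rw [hlv k hks, zero_mul]; exact zero_mem _)
        obtain ⟨c, hc⟩ := Submodule.exists_sum_of_mem_span_image_finset hwr
        refine ⟨w * u, mul_mem hw hu, ι R (∑ k ∈ s, c k • m k), ?_, ?_, ?_⟩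
        · exact mem_exteriorPower_one.mpr ⟨_, rfl⟩
        · intro k hks
          rw [contract_ι, map_sum, Finset.sum_eq_zero, map_zero]
          intro j hj
          rw [map_smul, hlm, if_neg (by rintro rfl; exact hks hj), smul_zero]
        · rw [contract_ι, ← hr, Algebra.smul_def, ← map_mul, mul_assoc, ← hc, map_sum]
          simp
    obtain ⟨w', hw', g, hgn, hgk, hgf⟩ := ih n (w • a + f (m i) • c)
      (add_mem (Submodule.smul_mem _ _ han) (Submodule.smul_mem _ _ hcn))
      (fun k hks => by rw [map_add, map_smul, map_smul, hak k hks, hck k hks]; simp)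
      (by rw [map_add, map_smul, map_smul, haf, hcf, smul_neg, smul_comm, neg_add_cancel])
    refine ⟨w' * w * u, mul_mem (mul_mem hw' hw) hu, g - w' • (ι R (m i) * c),
      sub_mem hgn (Submodule.smul_mem _ _ (ι_mul_mem hcn _)), ?_, ?_⟩
    · intro k hks
      rw [Finset.mem_insert, not_or] at hks
      rw [map_sub, map_smul, contract_ι_mul, hgk k hks.2, hck k hks.2, hlm, if_neg hks.1]
      simp
    · rw [map_sub, map_smul, contract_ι_mul, hgf, hcf, mul_smul, hab, mul_smul, mul_smul_comm]
      simp only [smul_sub, smul_add]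
      abel

end ExteriorAlgebra

section

universe u

/-- A nonnegative chain complex of `R`-modules augmented to `Q`. -/
structure AugmentedComplex (R Q : Type u) [CommRing R] [AddCommGroup Q] [Module R Q] where
  /-- the terms -/
  obj : ℕ → Type u
  [addCommGroup : ∀ n, AddCommGroup (obj n)]
  [module : ∀ n, Module R (obj n)]
  /-- the differentials -/
  d : ∀ n, obj (n + 1) →ₗ[R] obj n
  /-- the augmentation -/
  ε : obj 0 →ₗ[R] Q
  d_d : ∀ n x, d n (d (n + 1) x) = 0
  ε_d : ∀ x, ε (d 0 x) = 0

namespace AugmentedComplex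

attribute [instance] addCommGroup module

variable {R Q : Type u} [CommRing R] [AddCommGroup Q] [Module R Q] (X Y : AugmentedComplex R Q)

/-- Exactness up to multiplication by `f`. -/
structure ExactUpTo (f : R) : Prop where
  ε_surj : ∀ q, ∃ y, Y.ε y = f • q
  ε_exact : ∀ y, Y.ε y = 0 → ∃ z, Y.d 0 z = f • y
  d_exact : ∀ n y, Y.d n y = 0 → ∃ z, Y.d (n + 1) z = f • y

/-- The `n`-cocycles with values in `R`. -/
def cocycles (n : ℕ) : Submodule R (X.obj n →ₗ[R] R) := LinearMap.ker (LinearMap.lcomp R R (X.d n))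

/-- The `n`-coboundaries with values in `R`. -/
def coboundaries : ∀ n : ℕ, Submodule R (X.obj n →ₗ[R] R)
  | 0 => ⊥
  | n + 1 => LinearMap.range (LinearMap.lcomp R R (X.d n))

variable {X Y}

theorem mem_cocycles {n : ℕ} {φ : X.obj n →ₗ[R] R} :
    φ ∈ X.cocycles n ↔ ∀ x, φ (X.d n x) = 0 :=
  LinearMap.ext_iff

theorem mem_coboundaries_zero {φ : X.obj 0 →ₗ[R] R} : φ ∈ X.coboundaries 0 ↔ φ = 0 :=
  Submodule.mem_bot R

theorem mem_coboundaries_succ {n : ℕ} {φ : X.obj (n + 1) →ₗ[R] R} :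
    φ ∈ X.coboundaries (n + 1) ↔ ∃ ψ : X.obj n →ₗ[R] R, φ = ψ ∘ₗ X.d n :=
  ⟨fun ⟨ψ, h⟩ => ⟨ψ, h.symm⟩, fun ⟨ψ, h⟩ => ⟨ψ, h.symm⟩⟩

theorem exists_lift_smul {P M N : Type*} [AddCommGroup P] [Module R P] [Module.Projective R P]
    [AddCommGroup M] [Module R M] [AddCommGroup N] [Module R N] (d : M →ₗ[R] N) (φ : P →ₗ[R] N)
    {f : R} (h : ∀ x, ∃ y, d y = f • φ x) : ∃ ψ : P →ₗ[R] M, ∀ x, d (ψ x) = f • φ x := by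
  obtain ⟨ψ, hψ⟩ := Module.projective_lifting_property d.rangeRestrict
    ((f • φ).codRestrict d.range h) d.surjective_rangeRestrict
  exact ⟨ψ, fun x => congrArg Subtype.val (LinearMap.congr_fun hψ x)⟩

theorem exists_seq {A : ℕ → Type*} {p : ∀ n, A n → Prop} {q : ∀ n, A n → A (n + 1) → Prop}
    {a₀ : A 0} (h₀ : p 0 a₀) (h : ∀ n a, p n a → ∃ b, q n a b ∧ p (n + 1) b) :
    ∃ a : ∀ n, A n, a 0 = a₀ ∧ ∀ n, q n (a n) (a (n + 1)) := by
  choose s hs using h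
  let t : ∀ n, {a : A n // p n a} := fun n =>
    Nat.rec ⟨a₀, h₀⟩ (fun n a => ⟨s n a.1 a.2, (hs n a.1 a.2).2⟩) n
  exact ⟨fun n => (t n).1, rfl, fun n => (hs n (t n).1 (t n).2).1⟩

/-- The kernel of the augmentation in degree `0`, the cycles in positive degree. -/
def cycles (Y : AugmentedComplex R Q) : ∀ n, Submodule R (Y.obj n)
  | 0 => LinearMap.ker Y.ε
  | n + 1 => LinearMap.ker (Y.d n)

theorem ExactUpTo.exists_d_eq {f : R} (hY : Y.ExactUpTo f) {n : ℕ} {y : Y.obj n}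
    (hy : y ∈ Y.cycles n) : ∃ z, Y.d n z = f • y := by
  cases n with
  | zero => exact hY.ε_exact _ hy
  | succ n => exact hY.d_exact _ _ hy

theorem exists_lift [∀ n, Module.Projective R (X.obj n)] {f : R} (hY : Y.ExactUpTo f) :
    ∃ a : ∀ n, X.obj n →ₗ[R] Y.obj n, (∀ x, Y.ε (a 0 x) = f • X.ε x) ∧
      ∀ n x, Y.d n (a (n + 1) x) = f • a n (X.d n x) := by
  obtain ⟨a0, ha0⟩ := exists_lift_smul Y.ε X.ε fun x => hY.ε_surj _
  obtain ⟨a, rfl, ha⟩ := exists_seq (A := fun n => X.obj n →ₗ[R] Y.obj n)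
    (p := fun n a => ∀ x, a (X.d n x) ∈ Y.cycles n)
    (q := fun n a b => ∀ x, Y.d n (b x) = f • a (X.d n x)) (a₀ := a0)
    (fun x => by
      change Y.ε _ = 0
      rw [ha0, X.ε_d, smul_zero])
    (fun n a ha => by
      obtain ⟨b, hb⟩ := exists_lift_smul (Y.d n) (a ∘ₗ X.d n) fun x => hY.exists_d_eq (ha x)
      refine ⟨b, hb, fun x => ?_⟩
      change Y.d n _ = 0
      rw [hb, LinearMap.comp_apply, X.d_d, map_zero, smul_zero])
  exact ⟨a, ha0, ha⟩

theorem exists_homotopy [∀ n, Module.Projective R (X.obj n)] {f u : R} (hY : Y.ExactUpTo f)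
    (g : ∀ n, X.obj n →ₗ[R] Y.obj n) (hg0 : ∀ x, Y.ε (g 0 x) = 0)
    (hg : ∀ n x, Y.d n (g (n + 1) x) = u • g n (X.d n x)) :
    ∃ h : ∀ n, X.obj n →ₗ[R] Y.obj (n + 1), (∀ x, f • g 0 x = Y.d 0 (h 0 x)) ∧
      ∀ n x, f ^ (n + 2) • g (n + 1) x = Y.d (n + 1) (h (n + 1) x) + (f * u) • h n (X.d n x) := by
  obtain ⟨h0, hh0⟩ := exists_lift_smul (Y.d 0) (g 0) fun x => hY.ε_exact _ (hg0 x)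
  obtain ⟨h, rfl, hh⟩ := exists_seq (A := fun n => X.obj n →ₗ[R] Y.obj (n + 1))
    (p := fun n h => ∀ x, Y.d n (f ^ (n + 1) • g (n + 1) x - u • h (X.d n x)) = 0)
    (q := fun n h k => ∀ x, Y.d (n + 1) (k x) = f • (f ^ (n + 1) • g (n + 1) x - u • h (X.d n x)))
    (a₀ := h0)
    (fun x => by
      rw [map_sub, map_smul, map_smul, hg, hh0, smul_comm u f]
      simp)
    (fun n h hn => by
      obtain ⟨k, hk⟩ := exists_lift_smul (Y.d (n + 1))
        (f ^ (n + 1) • g (n + 1) - u • h ∘ₗ X.d n) fun x => hY.d_exact _ _ (hn x)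
      have hk' : ∀ x, Y.d (n + 1) (k x) = f • (f ^ (n + 1) • g (n + 1) x - u • h (X.d n x)) := hk
      refine ⟨k, hk', fun x => ?_⟩
      rw [map_sub, map_smul, map_smul, hg, hk', X.d_d, map_zero, smul_zero, sub_zero]
      simp only [smul_smul]
      rw [sub_eq_zero]
      congr 1
      ring)
  refine ⟨h, fun x => (hh0 x).symm, fun n x => ?_⟩
  rw [hh]
  simp only [smul_sub, smul_smul, ← pow_succ']
  rw [sub_add_cancel]

end AugmentedComplex

end

section

universe u
namespace AugmentedComplex

variable {R Q : Type u} [CommRing R] [AddCommGroup Q] [Module R Q] {X Y : AugmentedComplex R Q}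

theorem comp_mem_coboundaries_of_cocycle [∀ n, Module.Projective R (X.obj n)] {u : R}
    (hY : Y.ExactUpTo 1) (g : ∀ n, X.obj n →ₗ[R] Y.obj n) (hg0 : ∀ x, Y.ε (g 0 x) = 0)
    (hg : ∀ n x, Y.d n (g (n + 1) x) = u • g n (X.d n x)) {n : ℕ} {φ : Y.obj n →ₗ[R] R}
    (hφ : φ ∈ Y.cocycles n) : φ ∘ₗ g n ∈ X.coboundaries n := by
  obtain ⟨h, h0, hh⟩ := exists_homotopy hY g hg0 hg
  simp only [one_pow, one_smul, one_mul] at h0 hh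
  rw [mem_cocycles] at hφ
  cases n with
  | zero =>
    refine mem_coboundaries_zero.mpr (LinearMap.ext fun x => ?_)
    rw [LinearMap.comp_apply, h0, hφ, LinearMap.zero_apply]
  | succ n =>
    refine mem_coboundaries_succ.mpr ⟨u • φ ∘ₗ h n, LinearMap.ext fun x => ?_⟩
    rw [LinearMap.comp_apply, hh, map_add, hφ, zero_add, map_smul]
    rfl

theorem comp_mem_coboundaries {u : R} (g : ∀ n, X.obj n →ₗ[R] Y.obj n)
    (hg : ∀ n x, Y.d n (g (n + 1) x) = u • g n (X.d n x)) {n : ℕ} {φ : Y.obj n →ₗ[R] R}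
    (hφ : φ ∈ Y.coboundaries n) : φ ∘ₗ g n ∈ X.coboundaries n := by
  cases n with
  | zero =>
    rw [mem_coboundaries_zero] at hφ ⊢
    rw [hφ, LinearMap.zero_comp]
  | succ n =>
    obtain ⟨ψ, rfl⟩ := mem_coboundaries_succ.mp hφ
    refine mem_coboundaries_succ.mpr ⟨u • ψ ∘ₗ g n, LinearMap.ext fun x => ?_⟩
    rw [LinearMap.comp_apply, LinearMap.comp_apply, hg, map_smul]
    rfl

theorem mem_of_smul_mem {V : Type*} [AddCommGroup V] [Module R V] {N : Submodule R V} {I : Ideal R}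
    {v : V} (hv : ∀ x ∈ I, x • v ∈ N) {c : R} (hc : c - 1 ∈ I) (h : c • v ∈ N) : v ∈ N := by
  have := N.sub_mem h (hv _ hc)
  rwa [sub_smul, one_smul, sub_sub_cancel] at this

theorem map_mem_of_mem_smul_top {V : Type*} [AddCommGroup V] [Module R V] {I : Ideal R}
    (g : V →ₗ[R] R) {v : V} (hv : v ∈ I • (⊤ : Submodule R V)) : g v ∈ I := by
  simpa using Submodule.smul_top_le_comap_smul_top I g hv

theorem exists_comparison {K F : AugmentedComplex R Q} [∀ n, Module.Projective R (K.obj n)]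
    [∀ n, Module.Projective R (F.obj n)] {π : R →ₗ[R] Q} (hπ : Function.Surjective π)
    {I : Ideal R} (hI : LinearMap.ker π = I) {f : R} (hf : f - 1 ∈ I)
    (hF : F.ExactUpTo 1) (hK : K.ExactUpTo f)
    (hKd : ∀ n x, K.d n x ∈ I • (⊤ : Submodule R (K.obj n))) {n : ℕ} [Module.Finite R (K.obj n)]
    (hKn : ∀ y : K.obj (n + 1), f • y = 0)
    (hcob : ∀ x ∈ I, ∀ g : K.obj n →ₗ[R] R, (f ^ 2 * x) • g ∈ K.coboundaries n) :
    ∃ θ : (F.obj n →ₗ[R] R) →ₗ[R] (K.obj n →ₗ[R] Q),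
      (∀ t, ∃ φ ∈ F.cocycles n, θ φ = t) ∧
      ∀ φ ∈ F.cocycles n, θ φ = 0 ↔ φ ∈ F.coboundaries n := by
  obtain ⟨a, ha0, ha⟩ := exists_lift (X := K) hF
  obtain ⟨b, hb0, hb⟩ := exists_lift (X := F) hK
  simp only [one_smul] at ha0 ha
  have hfpow : ∀ k, f ^ k - 1 ∈ I := fun k => by
    obtain ⟨c, hc⟩ := sub_dvd_pow_sub_pow f 1 k
    rw [one_pow] at hc
    exact hc ▸ I.mul_mem_right _ hf
  have hmem : ∀ r, π r = 0 ↔ r ∈ I := fun r => by rw [← hI, LinearMap.mem_ker]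
  have hπf : ∀ k r, π (f ^ k * r) = π r := fun k r => by
    rw [← sub_eq_zero, ← map_sub, hmem, ← sub_one_mul]
    exact I.mul_mem_right _ (hfpow k)
  have hIφ : ∀ φ ∈ F.cocycles n, ∀ x ∈ I, x • φ ∈ F.coboundaries n := by
    intro φ hφ x hx
    have := comp_mem_coboundaries_of_cocycle (X := F) (u := 1) hF (fun k => x • LinearMap.id)
      (fun y => by
        obtain ⟨r, hr⟩ := hπ (F.ε y)
        rw [LinearMap.smul_apply, map_smul, LinearMap.id_apply, ← hr, ← map_smul, hmem, smul_eq_mul]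
        exact I.mul_mem_right _ hx)
      (fun k y => by simp) hφ
    rwa [LinearMap.comp_smul, LinearMap.comp_id] at this
  have hba : ∀ (g : K.obj n →ₗ[R] R) y, π (g (b n (a n y))) = π (g y) := by
    obtain ⟨h, h0, hh⟩ := exists_homotopy (X := K) (u := f) hK
      (fun k => b k ∘ₗ a k - f ^ (k + 1) • LinearMap.id)
      (fun x => by simp [hb0, ha0])
      (fun k x => by
        simp only [LinearMap.sub_apply, LinearMap.comp_apply, LinearMap.smul_apply,
          LinearMap.id_apply, map_sub, map_smul, hb, ha, smul_sub, smul_smul, ← pow_succ'])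
    have key : ∃ k : ℕ, ∀ y,
        f ^ k • (b n (a n y) - f ^ (n + 1) • y) ∈ I • (⊤ : Submodule R (K.obj n)) := by
      cases n with
      | zero => exact ⟨1, fun y => by simpa only [pow_one] using (h0 y).symm ▸ hKd _ _⟩
      | succ k =>
        exact ⟨k + 2, fun y => (hh k y).symm ▸ add_mem (hKd _ _)
          (Submodule.smul_mem _ _ (Submodule.smul_top_le_comap_smul_top I (h k) (hKd k y)))⟩
    obtain ⟨k, hk⟩ := key
    intro g y
    have := map_mem_of_mem_smul_top g (hk y)
    rw [map_smul, map_sub, map_smul, ← hmem, smul_eq_mul, hπf, map_sub, smul_eq_mul, hπf] at this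
    exact sub_eq_zero.mp this
  have hab : ∀ φ ∈ F.cocycles n, φ ∘ₗ a n ∘ₗ b n - f ^ (n + 1) • φ ∈ F.coboundaries n := by
    intro φ hφ
    have := comp_mem_coboundaries_of_cocycle (X := F) (u := f) hF
      (fun k => a k ∘ₗ b k - f ^ (k + 1) • LinearMap.id)
      (fun x => by simp [hb0, ha0])
      (fun k x => by
        simp only [LinearMap.sub_apply, LinearMap.comp_apply, LinearMap.smul_apply,
          LinearMap.id_apply, map_sub, map_smul, hb, ha, smul_sub, smul_smul, ← pow_succ']) hφ
    rwa [LinearMap.comp_sub, LinearMap.comp_smul, LinearMap.comp_id] at this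
  refine ⟨LinearMap.compRight R π ∘ₗ LinearMap.lcomp R R (a n), fun t => ?_, fun φ hφ => ?_⟩
  · obtain ⟨g, hg⟩ := Module.projective_lifting_property π t hπ
    refine ⟨f ^ 2 • g ∘ₗ b n, mem_cocycles.mpr fun x => ?_, LinearMap.ext fun y => ?_⟩
    · rw [LinearMap.smul_apply, LinearMap.comp_apply, ← map_smul, pow_two, mul_smul, ← hb,
        ← map_smul, hKn, map_zero, map_zero]
    · exact (hπf 2 _).trans ((hba g y).trans (LinearMap.congr_fun hg y))
  · have hθ : (LinearMap.compRight R π ∘ₗ LinearMap.lcomp R R (a n)) φ = 0 ↔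
        ∀ y, φ (a n y) ∈ I := by
      rw [LinearMap.ext_iff]
      exact forall_congr' fun y => hmem _
    rw [hθ]
    constructor
    · intro h
      obtain ⟨k, p, q, -, -, hpq⟩ := Module.Finite.exists_comp_eq_id_of_projective R (K.obj n)
      have hsum : φ ∘ₗ a n = ∑ i, φ (a n (p (Pi.single i 1))) • LinearMap.proj i ∘ₗ q := by
        ext y
        conv_lhs => rw [← LinearMap.id_apply (R := R) y, ← hpq, LinearMap.comp_apply,
          LinearMap.comp_apply, pi_eq_sum_univ' (q y)]
        simp [mul_comm]
      have h1 : f ^ 2 • φ ∘ₗ a n ∈ K.coboundaries n := by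
        rw [hsum, Finset.smul_sum]
        refine Submodule.sum_mem _ fun i _ => ?_
        rw [smul_smul]
        exact hcob _ (h _) _
      have h2 := comp_mem_coboundaries b hb h1
      rw [LinearMap.smul_comp, LinearMap.comp_assoc] at h2
      have h3 := Submodule.sub_mem _ h2 (Submodule.smul_mem _ (f ^ 2) (hab φ hφ))
      rw [smul_sub, sub_sub_cancel, smul_smul, ← pow_add] at h3
      exact mem_of_smul_mem (hIφ φ hφ) (hfpow _) h3
    · intro h y
      have h1 := comp_mem_coboundaries (u := 1) a (by simpa using ha) h
      cases n with
      | zero =>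
        rw [mem_coboundaries_zero] at h1
        rw [← LinearMap.comp_apply, h1]
        exact I.zero_mem
      | succ n =>
        obtain ⟨ψ, hψ⟩ := mem_coboundaries_succ.mp h1
        rw [← LinearMap.comp_apply, hψ]
        exact map_mem_of_mem_smul_top ψ (hKd _ _)

end AugmentedComplex

end

namespace AugmentedComplex
universe u
variable {R Q : Type u} [CommRing R] [AddCommGroup Q] [Module R Q]

noncomputable def ofProjectiveResolution (P : ProjectiveResolution (ModuleCat.of R Q)) :
    AugmentedComplex R Q where
  obj n := P.complex.X n
  d n := (P.complex.d (n + 1) n).hom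
  ε := (P.π.f 0).hom
  d_d n x := by
    rw [← LinearMap.comp_apply, ← ModuleCat.hom_comp, P.complex.d_comp_d]
    rfl
  ε_d x := by
    have := congrArg ModuleCat.Hom.hom P.complex_d_comp_π_f_zero
    exact LinearMap.congr_fun this x

variable (P : ProjectiveResolution (ModuleCat.of R Q))

theorem projective_ofProjectiveResolution (n : ℕ) :
    Module.Projective R ((ofProjectiveResolution P).obj n) :=
  (IsProjective.iff_projective (P.complex.X n)).mpr (P.projective n)

theorem exactUpTo_ofProjectiveResolution : (ofProjectiveResolution P).ExactUpTo 1 where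
  ε_surj q := by
    have : Epi (P.π.f 0) := inferInstance
    rw [one_smul]
    exact (ModuleCat.epi_iff_surjective _).mp this q
  ε_exact y hy := by
    rw [one_smul]
    have := ShortComplex.exact_of_g_is_cokernel
      (ShortComplex.mk _ _ P.complex_d_comp_π_f_zero) P.isColimitCokernelCofork
    exact (ShortComplex.moduleCat_exact_iff _).mp this y hy
  d_exact n y hy := by
    rw [one_smul]
    exact (ShortComplex.moduleCat_exact_iff _).mp (P.exact_succ n) y hy

end AugmentedComplex

namespace CochainComplex
universe u
variable {R : Type u} [CommRing R]

theorem _root_.CategoryTheory.ShortComplex.exists_ker_to_homology (S : ShortComplex (ModuleCat.{u} R)) :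
    ∃ ξ : LinearMap.ker S.g.hom →ₗ[R] S.homology, Function.Surjective ξ ∧
      ∀ z, ξ z = 0 ↔ ∃ y, S.f y = z.1 := by
  let e := S.moduleCatHomologyIso.toLinearEquiv
  let q : LinearMap.ker S.g.hom →ₗ[R] S.moduleCatLeftHomologyData.H :=
    Submodule.mkQ (LinearMap.range S.moduleCatToCycles)
  have hq : Function.Surjective q := Submodule.mkQ_surjective _
  refine ⟨e.symm.toLinearMap ∘ₗ q, e.symm.surjective.comp hq, fun z => ?_⟩
  rw [LinearMap.comp_apply, LinearEquiv.coe_coe, LinearEquiv.map_eq_zero_iff]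
  refine (Submodule.Quotient.mk_eq_zero _).trans (exists_congr fun y => ?_)
  rw [Subtype.ext_iff]
  rfl

theorem exists_cycles_to_homology (C : CochainComplex (ModuleCat.{u} R) ℕ) (n : ℕ) :
    ∃ ξ : LinearMap.ker (C.d n (n + 1)).hom →ₗ[R] C.homology n, Function.Surjective ξ ∧
      ∀ z, ξ z = 0 ↔ ∃ y, C.d ((ComplexShape.up ℕ).prev n) n y = z.1 := by
  have : ∀ k, (ComplexShape.up ℕ).next n = k →
      ∃ ξ : LinearMap.ker (C.d n k).hom →ₗ[R] C.homology n, Function.Surjective ξ ∧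
      ∀ z, ξ z = 0 ↔ ∃ y, C.d ((ComplexShape.up ℕ).prev n) n y = z.1 := by
    rintro _ rfl
    exact (C.sc n).exists_ker_to_homology
  exact this _ (CochainComplex.next ℕ n)

end CochainComplex

namespace AugmentedComplex
universe u
variable {R Q : Type u} [CommRing R] [AddCommGroup Q] [Module R Q]
variable (P : ProjectiveResolution (ModuleCat.of R Q))

theorem exists_cocycles_to_ext (n : ℕ) :
    ∃ ξ : (ofProjectiveResolution P).cocycles n →ₗ[R]
        ((Ext R (ModuleCat R) n).obj (Opposite.op (ModuleCat.of R Q))).obj (ModuleCat.of R R),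
      Function.Surjective ξ ∧
      ∀ z, ξ z = 0 ↔ (z : _ →ₗ[R] R) ∈ (ofProjectiveResolution P).coboundaries n := by
  obtain ⟨ξ, hξ, hξ'⟩ := CochainComplex.exists_cycles_to_homology
    (P.complex.linearYonedaObj R (ModuleCat.of R R)) n
  let e := (P.isoExt (R := R) n (ModuleCat.of R R)).toLinearEquiv
  let t : (ofProjectiveResolution P).cocycles n →ₗ[R]
      LinearMap.ker ((P.complex.linearYonedaObj R (ModuleCat.of R R)).d n (n + 1)).hom :=
    { toFun := fun φ => ⟨(ModuleCat.ofHom φ.1 : P.complex.X n ⟶ ModuleCat.of R R), by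
        have := mem_cocycles.mp φ.2
        refine ModuleCat.hom_ext (LinearMap.ext this)⟩
      map_add' := fun _ _ => rfl
      map_smul' := fun _ _ => rfl }
  have ht : Function.Surjective t := by
    rintro ⟨φ, hφ⟩
    refine ⟨⟨ModuleCat.Hom.hom (φ : P.complex.X n ⟶ ModuleCat.of R R), mem_cocycles.mpr fun x => ?_⟩,
      rfl⟩
    exact LinearMap.congr_fun (congrArg ModuleCat.Hom.hom (show P.complex.d (n + 1) n ≫ φ = 0 from hφ)) x
  refine ⟨e.symm.toLinearMap ∘ₗ ξ ∘ₗ t, e.symm.surjective.comp (hξ.comp ht), fun z => ?_⟩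
  rw [LinearMap.comp_apply, LinearEquiv.coe_coe, LinearEquiv.map_eq_zero_iff, LinearMap.comp_apply,
    hξ']
  cases n with
  | zero =>
    rw [mem_coboundaries_zero, (P.complex.linearYonedaObj R (ModuleCat.of R R)).shape _ _ (by simp)]
    constructor
    · rintro ⟨_, h⟩
      exact congrArg ModuleCat.Hom.hom
        (show (0 : P.complex.X 0 ⟶ ModuleCat.of R R) = ModuleCat.ofHom z.1 from h) |>.symm
    · intro h
      refine ⟨0, ?_⟩
      change (0 : P.complex.X 0 ⟶ ModuleCat.of R R) = ModuleCat.ofHom z.1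
      rw [h]
      rfl
  | succ n =>
    rw [mem_coboundaries_succ, CochainComplex.prev_nat_succ]
    constructor
    · rintro ⟨y, h⟩
      exact ⟨ModuleCat.Hom.hom (y : P.complex.X n ⟶ ModuleCat.of R R), congrArg ModuleCat.Hom.hom
        (show P.complex.d (n + 1) n ≫ (y : P.complex.X n ⟶ ModuleCat.of R R) = ModuleCat.ofHom z.1
          from h) |>.symm⟩
    · rintro ⟨ψ, h⟩
      refine ⟨(ModuleCat.ofHom ψ : P.complex.X n ⟶ ModuleCat.of R R), ?_⟩
      exact ModuleCat.hom_ext h.symm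

end AugmentedComplex

namespace AugmentedComplex
universe u
variable {R Q : Type u} [CommRing R] [AddCommGroup Q] [Module R Q]

theorem _root_.LinearMap.nonempty_equiv_of_ker_eq_ker {V A B : Type*} [AddCommGroup V] [Module R V]
    [AddCommGroup A] [Module R A] [AddCommGroup B] [Module R B] (ξ : V →ₗ[R] A) (θ : V →ₗ[R] B)
    (hξ : Function.Surjective ξ) (hθ : Function.Surjective θ)
    (h : LinearMap.ker ξ = LinearMap.ker θ) : Nonempty (A ≃ₗ[R] B) :=
  ⟨(ξ.quotKerEquivOfSurjective hξ).symm ≪≫ₗ Submodule.quotEquivOfEq _ _ h ≪≫ₗ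
    θ.quotKerEquivOfSurjective hθ⟩

theorem nonempty_ext_equiv {K : AugmentedComplex R Q} [∀ n, Module.Projective R (K.obj n)]
    {π : R →ₗ[R] Q} (hπ : Function.Surjective π) {I : Ideal R}
    (hI : LinearMap.ker π = I) {f : R} (hf : f - 1 ∈ I) (hK : K.ExactUpTo f)
    (hKd : ∀ n x, K.d n x ∈ (I • ⊤ : Submodule R (K.obj n))) {n : ℕ} [Module.Finite R (K.obj n)]
    (hKn : ∀ y : K.obj (n + 1), f • y = 0)
    (hcob : ∀ x ∈ I, ∀ g : K.obj n →ₗ[R] R, (f ^ 2 * x) • g ∈ K.coboundaries n) :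
    Nonempty ((((Ext R (ModuleCat R) n).obj (Opposite.op (ModuleCat.of R Q))).obj
      (ModuleCat.of R R)) ≃ₗ[R] (K.obj n →ₗ[R] Q)) := by
  let P : ProjectiveResolution (ModuleCat.of R Q) := Classical.choice HasProjectiveResolution.out
  have := projective_ofProjectiveResolution P
  obtain ⟨θ, hθ, hθ'⟩ := exists_comparison hπ hI hf (exactUpTo_ofProjectiveResolution P) hK hKd hKn
    hcob
  obtain ⟨ξ, hξ, hξ'⟩ := exists_cocycles_to_ext P n
  let θ' := θ ∘ₗ ((ofProjectiveResolution P).cocycles n).subtype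
  have hs : Function.Surjective θ' := fun t =>
    let ⟨φ, h, h'⟩ := hθ t
    ⟨⟨φ, h⟩, h'⟩
  have hker : LinearMap.ker ξ = LinearMap.ker θ' := by
    ext z
    rw [LinearMap.mem_ker, LinearMap.mem_ker, hξ']
    exact (hθ' _ z.2).symm
  exact LinearMap.nonempty_equiv_of_ker_eq_ker
    (V := (ofProjectiveResolution P).cocycles n) (B := K.obj n →ₗ[R] Q) (A := (((Ext R (ModuleCat R) n).obj (Opposite.op (ModuleCat.of R Q))).obj
      (ModuleCat.of R R))) ξ θ' hξ hs hker
end AugmentedComplex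

theorem Submodule.exists_sub_one_mem_and_smul_mem_of_prime {R V : Type*} [CommRing R]
    [AddCommGroup V] [Module R V] {N B : Submodule R V} (hN : N.FG) {I : Ideal R}
    (h : ∀ p : Ideal R, p.IsPrime → I ≤ p → ∀ z ∈ N, ∃ w ∉ p, w • z ∈ B) :
    ∃ f : R, f - 1 ∈ I ∧ ∀ z ∈ N, f • z ∈ B := by
  by_cases htop : I ⊔ B.colon (N : Set V) = ⊤
  · obtain ⟨a, ha, b, hb, hab⟩ := Submodule.mem_sup.mp ((Ideal.eq_top_iff_one _).mp htop)
    refine ⟨b, ?_, fun z hz => Submodule.mem_colon.mp hb z hz⟩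
    rw [← hab, sub_add_cancel_right]
    exact I.neg_mem ha
  · obtain ⟨p, hp, hle⟩ := Ideal.exists_le_maximal _ htop
    have hpp := hp.isPrime
    exfalso
    obtain ⟨t, rfl⟩ := hN
    choose! w hw hwB using h p hpp (le_sup_left.trans hle)
    refine (Ideal.IsPrime.prod_mem_iff.not.mpr ?_) (hle (Submodule.mem_sup_right
      (Submodule.mem_colon.mpr (?_ : ∀ z ∈ (Submodule.span R (t : Set V) : Set V),
        (∏ z ∈ t, w z) • z ∈ B))))
    · rintro ⟨z, hz, hz'⟩
      exact hw z (Submodule.subset_span hz) hz'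
    · intro z hz
      refine (Submodule.span_le (p := B.comap (LinearMap.lsmul R V (∏ z ∈ t, w z)))).mpr ?_ hz
      intro y hy
      obtain ⟨c, hc⟩ := Finset.dvd_prod_of_mem w hy
      change (∏ z ∈ t, w z) • y ∈ B
      rw [hc, mul_comm, mul_smul]
      exact B.smul_mem c (hwB y (Submodule.subset_span hy))

namespace ExteriorAlgebra
variable {R M : Type*} [CommRing R] [AddCommGroup M] [Module R M]

theorem smul_eq_zero_of_le {f : R} {n k : ℕ} (hnk : n ≤ k)
    (h : ∀ z ∈ ⋀[R]^n M, f • z = 0) : ∀ z ∈ ⋀[R]^k M, f • z = 0 := by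
  induction k, hnk using Nat.le_induction with
  | base => exact h
  | succ k _ ih =>
    intro z hz
    rw [exteriorPower, pow_succ'] at hz
    refine Submodule.mul_induction_on hz (fun a _ b hb => ?_) fun a b ha hb => by
      rw [smul_add, ha, hb, add_zero]
    rw [← mul_smul_comm, ih b hb, mul_zero]

theorem pow_smul_eq_zero {ι' : Type*} [Fintype ι'] {m : ι' → M} {l : ι' → Module.Dual R M} {u : R}
    (hm : ∀ v, u • v = ∑ i, l i v • m i) {n : ℕ} (hn : Fintype.card ι' < n)
    {z : ExteriorAlgebra R M} (hz : z ∈ ⋀[R]^n M) : u ^ n • z = 0 := by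
  classical
  rw [← ιMulti_span_fixedDegree] at hz
  refine (Submodule.span_le (p := LinearMap.ker (LinearMap.lsmul R _ (u ^ n)))).mpr ?_ hz
  rintro _ ⟨v, rfl⟩
  change u ^ n • ιMulti R n v = 0
  have := (ιMulti R n).map_smul_univ (fun _ => u) v
  rw [Finset.prod_const, Finset.card_univ, Fintype.card_fin] at this
  rw [← this]
  simp_rw [hm]
  rw [← AlternatingMap.coe_multilinearMap, MultilinearMap.map_sum]
  refine Finset.sum_eq_zero fun φ _ => ?_
  rw [MultilinearMap.map_smul_univ, AlternatingMap.coe_multilinearMap]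
  obtain ⟨i, j, hij, h⟩ := Fintype.exists_ne_map_eq_of_card_lt φ (by simpa using hn)
  rw [(ιMulti R n).map_eq_zero_of_eq (fun i => m (φ i)) (by rw [h]) hij, smul_zero]

theorem contract_mem_smul {I : Ideal R} {f : Module.Dual R M} (hf : ∀ m, f m ∈ I) {n : ℕ}
    {x : ExteriorAlgebra R M} (hx : x ∈ ⋀[R]^(n + 1) M) : contract f x ∈ I • (⋀[R]^n M) := by
  induction n generalizing x with
  | zero =>
    obtain ⟨m, rfl⟩ := mem_exteriorPower_one.mp hx
    rw [contract_ι, Algebra.algebraMap_eq_smul_one]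
    exact Submodule.smul_mem_smul (hf m) (mem_exteriorPower_zero.mpr ⟨1, map_one _⟩)
  | succ n ih =>
    rw [exteriorPower, pow_succ'] at hx
    refine Submodule.mul_induction_on hx ?_ fun a b ha hb => by
      rw [map_add]; exact add_mem ha hb
    rintro _ ⟨m, rfl⟩ y hy
    rw [contract_ι_mul]
    refine sub_mem (Submodule.smul_mem_smul (hf m) hy) ?_
    refine Submodule.smul_induction_on (ih hy) (fun r hr z hz => ?_) fun a b ha hb => by
      rw [mul_add]; exact add_mem ha hb
    rw [mul_smul_comm]
    exact Submodule.smul_mem_smul hr (ι_mul_mem hz m)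

theorem _root_.exteriorPower.projective_s6 [Module.Finite R M] [Module.Projective R M] (n : ℕ) :
    Module.Projective R (⋀[R]^n M) := by
  obtain ⟨k, f, hf⟩ := Module.Finite.exists_fin' R M
  obtain ⟨g, hg⟩ := Module.projective_lifting_property f LinearMap.id hf
  refine Module.Projective.of_split (exteriorPower.map n g) (exteriorPower.map n f) ?_
  rw [← exteriorPower.map_comp, hg, exteriorPower.map_id]

end ExteriorAlgebra

namespace AugmentedComplex
open ExteriorAlgebra
universe u
variable {R M Q : Type u} [CommRing R] [AddCommGroup M] [Module R M] [AddCommGroup Q] [Module R Q]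
  {s : Module.Dual R M} {π : R →ₗ[R] Q}

/-- The Koszul complex of a linear form `s`, augmented by a map out of `R` that kills the values
of `s`. -/
noncomputable def koszul (s : Module.Dual R M) (π : R →ₗ[R] Q) (h : ∀ m, π (s m) = 0) :
    AugmentedComplex R Q where
  obj n := ⋀[R]^n M
  d n := (contract s ∘ₗ (⋀[R]^(n + 1) M).subtype).codRestrict (⋀[R]^n M)
    fun x => contract_mem s x.2
  ε := π ∘ₗ (algebraMapInv (R := R) (M := M)).toLinearMap ∘ₗ (⋀[R]^0 M).subtype
  d_d n x := Subtype.ext (contract_contract_self s x.1)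
  ε_d x := by
    obtain ⟨m, hm⟩ := mem_exteriorPower_one.mp x.2
    have : contract s (x : ExteriorAlgebra R M) = algebraMap R _ (s m) := by rw [← hm, contract_ι]
    change π (algebraMapInv (contract s (x : ExteriorAlgebra R M))) = 0
    rw [this, AlgHom.commutes]
    exact h m

variable (h : ∀ m, π (s m) = 0)

theorem exactUpTo_koszul {f : R} (hπ : Function.Surjective π)
    (h0 : ∀ r, π r = 0 → ∃ m, s m = f * r)
    (h1 : ∀ n, ∀ y ∈ ⋀[R]^(n + 1) M, contract s y = 0 →
      ∃ z ∈ ⋀[R]^(n + 2) M, contract s z = f • y) : (koszul s π h).ExactUpTo f where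
  ε_surj q := by
    obtain ⟨r, hr⟩ := hπ (f • q)
    refine ⟨⟨algebraMap R _ r, mem_exteriorPower_zero.mpr ⟨r, rfl⟩⟩, ?_⟩
    change π (algebraMapInv (algebraMap R (ExteriorAlgebra R M) r)) = _
    rw [AlgHom.commutes]
    exact hr
  ε_exact := by
    rintro ⟨y, hy⟩ hy'
    obtain ⟨r, rfl⟩ := mem_exteriorPower_zero.mp hy
    change π (algebraMapInv (algebraMap R (ExteriorAlgebra R M) r)) = _ at hy'
    rw [AlgHom.commutes] at hy'
    obtain ⟨m, hm⟩ := h0 r hy'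
    refine ⟨⟨ι R m, mem_exteriorPower_one.mpr ⟨m, rfl⟩⟩, Subtype.ext ?_⟩
    change contract s (ι R m) = f • algebraMap R _ r
    rw [contract_ι, hm, Algebra.smul_def, map_mul]
  d_exact n y hy := by
    obtain ⟨z, hz, h'⟩ := h1 n y.1 y.2 (congrArg Subtype.val hy)
    exact ⟨⟨z, hz⟩, Subtype.ext h'⟩

theorem koszul_d_mem {I : Ideal R} (hs : ∀ m, s m ∈ I) (n : ℕ) (x : ⋀[R]^(n + 1) M) :
    (koszul s π h).d n x ∈ (I • ⊤ : Submodule R (⋀[R]^n M)) := by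
  have h1 := contract_mem_smul hs x.2
  rw [← Submodule.range_subtype (⋀[R]^n M), ← Submodule.map_top, ← Submodule.map_smul''] at h1
  obtain ⟨y, hy, hy'⟩ := h1
  exact (Subtype.ext hy' : y = (koszul s π h).d n x) ▸ hy

theorem smul_mem_coboundaries_koszul {f : R} {n : ℕ} (hf : ∀ y ∈ ⋀[R]^(n + 1) M, f • y = 0) (m : M)
    (g : ⋀[R]^n M →ₗ[R] R) : (f * s m) • g ∈ (koszul s π h).coboundaries n := by
  have key : ∀ y : ⋀[R]^n M, f • (s m • y.1 - ι R m * contract s y.1) = 0 := fun y => by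
    rw [← contract_ι_mul, ← map_smul, hf _ (ι_mul_mem y.2 m), map_zero]
  cases n with
  | zero =>
    refine mem_coboundaries_zero.mpr (LinearMap.ext fun y => ?_)
    have hy : contract s y.1 = 0 := by
      obtain ⟨r, hr⟩ := mem_exteriorPower_zero.mp y.2
      rw [← hr, contract_algebraMap]
    have := key y
    rw [hy, mul_zero, sub_zero] at this
    have h' : (f * s m) • y = 0 := Subtype.ext (by rw [mul_smul]; exact this)
    rw [LinearMap.smul_apply, ← map_smul]
    exact (congrArg g h').trans (map_zero g)
  | succ n =>
    let μ : ⋀[R]^n M →ₗ[R] ⋀[R]^(n + 1) M :=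
      (LinearMap.mulLeft R (ι R m) ∘ₗ (⋀[R]^n M).subtype).codRestrict _ fun y => ι_mul_mem y.2 m
    refine mem_coboundaries_succ.mpr ⟨f • g ∘ₗ μ, LinearMap.ext fun y => ?_⟩
    have h' : (f * s m) • y = f • μ ((koszul s π h).d n y) := Subtype.ext (by
      have := key y
      rw [smul_sub, sub_eq_zero, smul_smul] at this
      exact this)
    change (f * s m) • g y = f • g (μ ((koszul s π h).d n y))
    rw [← map_smul, ← map_smul]
    exact congrArg g h'

theorem exists_exactUpTo_koszul [IsNoetherianRing R] [Module.Finite R M]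
    (hπ : Function.Surjective π) {I : Ideal R} (hI : LinearMap.ker π = I)
    (hsI : I ≤ LinearMap.range s ⊔ I • I) {d : ℕ}
    (hloc : ∀ p : Ideal R, p.IsPrime → I ≤ p → ∃ (m : Fin d → M) (l : Fin d → Module.Dual R M),
      ∃ u ∉ p, (∀ i j, l i (m j) = if i = j then u else 0) ∧ (∀ v, u • v = ∑ i, l i v • m i) ∧
      ∀ (t : Finset (Fin d)) (i : Fin d) (r : R), i ∉ t →
        s (m i) * r ∈ Ideal.span ((fun k => s (m k)) '' (t : Set (Fin d))) →
        ∃ w ∉ p, w * r ∈ Ideal.span ((fun k => s (m k)) '' (t : Set (Fin d)))) :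
    ∃ f, f - 1 ∈ I ∧ (koszul s π h).ExactUpTo f ∧ (∀ y ∈ ⋀[R]^(d + 1) M, f • y = 0) ∧
      ∀ x ∈ I, ∃ m, s m = f * x := by
  have hfg (n : ℕ) (N : Submodule R (ExteriorAlgebra R M)) (hN : N ≤ ⋀[R]^n M) : N.FG :=
    have : IsNoetherian R (⋀[R]^n M) := inferInstance
    (isNoetherian_submodule.mp this) N hN
  have hmul {f g : R} (hf : f - 1 ∈ I) (hg : g - 1 ∈ I) : f * g - 1 ∈ I := by
    rw [show f * g - 1 = f * (g - 1) + (f - 1) by ring]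
    exact I.add_mem (I.mul_mem_left _ hg) hf
  have hex (n : ℕ) : ∃ f, f - 1 ∈ I ∧ ∀ y ∈ ⋀[R]^(n + 1) M, contract s y = 0 →
      ∃ z ∈ ⋀[R]^(n + 2) M, contract s z = f • y := by
    obtain ⟨f, hf, hf'⟩ := Submodule.exists_sub_one_mem_and_smul_mem_of_prime
      (N := ⋀[R]^(n + 1) M ⊓ LinearMap.ker (contract s)) (B := (⋀[R]^(n + 2) M).map (contract s))
      (hfg (n + 1) _ inf_le_left) (I := I) fun p hp hle z hz => by
        obtain ⟨m, l, u, hu, hlm, hm, hreg⟩ := hloc p hp hle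
        obtain ⟨w, hw, y, hy, -, hy'⟩ := exists_contract_eq_smul p.primeCompl hu s hlm hm hreg
          Finset.univ n z hz.1 (by simp) hz.2
        exact ⟨w, hw, y, hy, hy'⟩
    exact ⟨f, hf, fun y hy hy' => hf' y ⟨hy, hy'⟩⟩
  obtain ⟨a, ha, ha'⟩ : ∃ f, f - 1 ∈ I ∧ ∀ y ∈ ⋀[R]^(d + 1) M, f • y = 0 := by
    obtain ⟨f, hf, hf'⟩ := Submodule.exists_sub_one_mem_and_smul_mem_of_prime
      (N := ⋀[R]^(d + 1) M) (B := ⊥) (hfg (d + 1) _ le_rfl) (I := I) fun p hp hle z hz => by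
        obtain ⟨m, l, u, hu, hlm, hm, -⟩ := hloc p hp hle
        exact ⟨u ^ (d + 1), fun h => hu (hp.mem_of_pow_mem _ h), pow_smul_eq_zero hm (by simp) hz⟩
    exact ⟨f, hf, hf'⟩
  obtain ⟨b, hb, hb'⟩ : ∃ f, f - 1 ∈ I ∧ ∀ x ∈ I, ∃ m, s m = f * x := by
    obtain ⟨f, hf, hf'⟩ := Submodule.exists_sub_one_mem_and_smul_le_of_fg_of_le_sup
      (IsNoetherian.noetherian I) le_rfl hsI
    exact ⟨f, hf, fun x hx => hf' (Submodule.smul_mem_pointwise_smul x f I hx)⟩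
  choose c hc hc' using hex
  have hprod : ∀ n, ∏ i ∈ Finset.range n, c i - 1 ∈ I := fun n => by
    induction n with
    | zero => simp
    | succ n ih => rw [Finset.prod_range_succ]; exact hmul ih (hc n)
  set e := ∏ i ∈ Finset.range d, c i with he
  refine ⟨a * b * e, hmul (hmul ha hb) (hprod d), exactUpTo_koszul h hπ ?_ ?_, ?_, ?_⟩
  · intro r hr
    obtain ⟨m, hm⟩ := hb' r (hI ▸ hr)
    exact ⟨(a * e) • m, by rw [map_smul, hm, smul_eq_mul]; ring⟩
  · intro n y hy hy'
    rcases lt_or_ge n d with hn | hn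
    · obtain ⟨z, hz, hz'⟩ := hc' n y hy hy'
      obtain ⟨q, hq⟩ := Finset.dvd_prod_of_mem c (Finset.mem_range.mpr hn)
      refine ⟨(a * b * q) • z, Submodule.smul_mem _ _ hz, ?_⟩
      rw [map_smul, hz', smul_smul, he, hq]
      congr 1
      ring
    · refine ⟨0, zero_mem _, ?_⟩
      rw [map_zero, mul_assoc, mul_comm, mul_smul,
        smul_eq_zero_of_le (Nat.succ_le_succ hn) ha' y hy, smul_zero]
  · intro y hy
    rw [mul_assoc, mul_comm, mul_smul, ha' y hy, smul_zero]
  · intro x hx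
    obtain ⟨m, hm⟩ := hb' x hx
    exact ⟨(a * e) • m, by rw [map_smul, hm, smul_eq_mul]; ring⟩

end AugmentedComplex

theorem Module.exists_local_frame {A V : Type*} [CommRing A] [AddCommGroup V] [Module A V]
    [Module.Finite A V] [Module.Projective A V] (q : Ideal A) [q.IsPrime] {d : ℕ}
    (h : Module.rank (Localization.AtPrime q) (LocalizedModule q.primeCompl V) = d) :
    ∃ (m : Fin d → V) (l : Fin d → V →ₗ[A] A), ∃ u ∉ q,
      (∀ i j, l i (m j) = if i = j then u else 0) ∧ ∀ v, u • v = ∑ i, l i v • m i := by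
  have : Module.FinitePresentation A V := Module.finitePresentation_of_projective A V
  have : Module.Projective (Localization.AtPrime q) (LocalizedModule q.primeCompl V) :=
    Module.projective_of_isLocalizedModule q.primeCompl
      (LocalizedModule.mkLinearMap q.primeCompl V)
  have : Module.Finite (Localization.AtPrime q) (LocalizedModule q.primeCompl V) :=
    Module.Finite.of_isLocalizedModule q.primeCompl (LocalizedModule.mkLinearMap q.primeCompl V)
  have : Module.Free (Localization.AtPrime q) (LocalizedModule q.primeCompl V) :=
    Module.free_of_flat_of_isLocalRing
  let b := Module.finBasisOfFinrankEq (Localization.AtPrime q) (LocalizedModule q.primeCompl V)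
    (Module.finrank_eq_of_rank_eq h)
  let e := b.equivFun.restrictScalars A
  let F := LocalizedModule.mkLinearMap q.primeCompl V
  let G : (Fin d → A) →ₗ[A] (Fin d → Localization.AtPrime q) :=
    .pi fun i ↦ Algebra.linearMap A (Localization.AtPrime q) ∘ₗ .proj i
  have hG : IsLocalizedModule q.primeCompl G := inferInstance
  obtain ⟨g, s, hg⟩ := Module.FinitePresentation.exists_lift_of_isLocalizedModule q.primeCompl F
    (e.symm.toLinearMap ∘ₗ G)
  obtain ⟨k, t, hk⟩ := Module.FinitePresentation.exists_lift_of_isLocalizedModule q.primeCompl G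
    (e.toLinearMap ∘ₗ F)
  have hkg : G ∘ₗ (k ∘ₗ g) = G ∘ₗ ((s * t) • LinearMap.id) := LinearMap.ext fun x => by
    have h1 : G (k (g x)) = t • e (F (g x)) := LinearMap.congr_fun hk _
    have h2 : F (g x) = s • e.symm (G x) := LinearMap.congr_fun hg x
    change G (k (g x)) = G ((s * t) • x)
    rw [h1, h2, mul_comm, mul_smul]
    simp only [Submonoid.smul_def, map_smul, LinearEquiv.apply_symm_apply]
  have hgk : F ∘ₗ (g ∘ₗ k) = F ∘ₗ ((s * t) • LinearMap.id) := LinearMap.ext fun x => by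
    have h1 : G (k x) = t • e (F x) := LinearMap.congr_fun hk x
    have h2 : F (g (k x)) = s • e.symm (G (k x)) := LinearMap.congr_fun hg _
    change F (g (k x)) = F ((s * t) • x)
    rw [h2, h1, mul_smul]
    simp only [Submonoid.smul_def, map_smul, LinearEquiv.symm_apply_apply]
  obtain ⟨c, hc⟩ := Module.Finite.exists_smul_of_comp_eq_of_isLocalizedModule q.primeCompl G _ _ hkg
  obtain ⟨c', hc'⟩ := Module.Finite.exists_smul_of_comp_eq_of_isLocalizedModule q.primeCompl F _ _
    hgk
  refine ⟨fun i => g (Pi.single i 1), fun i => (c * c') • (LinearMap.proj i ∘ₗ k),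
    (c * c' * (s * t) : q.primeCompl), (c * c' * (s * t)).2, fun i j => ?_, fun v => ?_⟩
  · have : c • k (g (Pi.single j 1)) = c • (s * t) • (Pi.single j 1 : Fin d → A) :=
      LinearMap.congr_fun hc _
    have := congrFun congr(c' • $this) i
    simp only [Submonoid.smul_def, Pi.smul_apply, smul_eq_mul, Pi.single_apply,
      Submonoid.coe_mul] at this
    simp only [Submonoid.smul_def, LinearMap.smul_apply, LinearMap.comp_apply, LinearMap.proj_apply,
      smul_eq_mul, Submonoid.coe_mul]
    rw [mul_comm (c : A), mul_assoc, this]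
    split_ifs <;> ring
  · have : c' • g (k v) = c' • (s * t) • v := LinearMap.congr_fun hc' _
    have h' : ∑ i, k v i • g (Pi.single i 1) = g (k v) := by
      simp_rw [← map_smul, ← map_sum]
      congr 1
      ext i
      simp [Finset.sum_apply, Pi.single_apply]
    have := congr(c • $this)
    simp only [Submonoid.smul_def, smul_smul, Submonoid.coe_mul] at this
    simp only [Submonoid.smul_def, LinearMap.smul_apply, LinearMap.comp_apply, LinearMap.proj_apply,
      Submonoid.coe_mul, smul_assoc (_ : A), ← Finset.smul_sum, h']
    rw [mul_assoc, ← this, mul_smul]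

namespace KaehlerDifferential
variable {K P : Type*} [CommRing K] [CommRing P] [Algebra K P]

theorem exists_derivation_tmul (δ : Derivation K P P) :
    ∃ D : Derivation P (P ⊗[K] P) (P ⊗[K] P), ∀ a b, D (a ⊗ₜ b) = a ⊗ₜ δ b := by
  refine ⟨Derivation.mk' (AlgebraTensorModule.map LinearMap.id δ.toLinearMap) fun x y => ?_,
    fun a b => rfl⟩
  induction x with
  | zero => simp
  | add x x' hx hx' => simp only [add_mul, map_add, hx, hx', smul_add, add_smul]; abel
  | tmul a b =>
    induction y with
    | zero => simp
    | add y y' hy hy' => simp only [mul_add, map_add, hy, hy', smul_add, add_smul]; abel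
    | tmul a' b' =>
      simp [Algebra.TensorProduct.tmul_mul_tmul, tmul_add, mul_comm a' a]

theorem exists_derivation_lmul' (l : Ω[P⁄K] →ₗ[P] P) :
    ∃ D : Derivation P (P ⊗[K] P) (P ⊗[K] P), ∀ x : ideal K P,
      Algebra.TensorProduct.lmul' (S := P) K (D x) = l (fromIdeal K P x) := by
  obtain ⟨δ, hδ⟩ := exists_derivation_tmul (l.compDer (D K P))
  refine ⟨δ, fun x => ?_⟩
  rw [show fromIdeal K P x = (D K P).tensorProductTo (x : P ⊗[K] P) from (D_tensorProductTo x).symm]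
  generalize (x : P ⊗[K] P) = y
  induction y with
  | zero => simp
  | add x x' hx hx' => simp only [map_add, hx, hx']
  | tmul a b => simp [hδ, Derivation.tensorProductTo_tmul]

/-- The `P ⊗[K] P`-linear extension of a `P`-linear map from the Kähler differentials to the
diagonal ideal. -/
noncomputable def extend (σ : Ω[P⁄K] →ₗ[P] ideal K P) :
    Module.Dual (P ⊗[K] P) ((P ⊗[K] P) ⊗[P] Ω[P⁄K]) :=
  LinearMap.liftBaseChange (P ⊗[K] P) (((ideal K P).subtype.restrictScalars P) ∘ₗ σ)

variable {σ : Ω[P⁄K] →ₗ[P] ideal K P}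

theorem extend_one_tmul (ω : Ω[P⁄K]) : extend σ (1 ⊗ₜ ω) = σ ω := by
  simp [extend]

theorem extend_mem (x : (P ⊗[K] P) ⊗[P] Ω[P⁄K]) : extend σ x ∈ ideal K P := by
  induction x with
  | zero => simp
  | add x x' hx hx' => rw [map_add]; exact add_mem hx hx'
  | tmul a b =>
    rw [extend, LinearMap.liftBaseChange_tmul]
    exact Ideal.mul_mem_left _ _ (σ b).2

theorem exists_section [Module.Projective P Ω[P⁄K]] :
    ∃ σ : Ω[P⁄K] →ₗ[P] ideal K P, ∀ ω, fromIdeal K P (σ ω) = ω := by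
  obtain ⟨σ, hσ⟩ := Module.projective_lifting_property ((fromIdeal K P).restrictScalars P)
    LinearMap.id (fromIdeal_surjective K P)
  exact ⟨σ, LinearMap.congr_fun hσ⟩

theorem ideal_le_range_extend_sup (hσ : ∀ ω, fromIdeal K P (σ ω) = ω) :
    ideal K P ≤ LinearMap.range (extend σ) ⊔ ideal K P • ideal K P := by
  intro x hx
  let y := σ (fromIdeal K P ⟨x, hx⟩)
  have h : fromIdeal K P (⟨x, hx⟩ - y) = 0 := by rw [map_sub, hσ, sub_self]
  have h' : x - y ∈ ideal K P • ideal K P := by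
    rw [smul_eq_mul, ← pow_two]
    exact ((ideal K P).toCotangent_eq_zero _).mp h
  rw [← add_sub_cancel (y : P ⊗[K] P) x]
  exact Submodule.add_mem_sup ⟨_, extend_one_tmul _⟩ h'

theorem exists_extend_frame [IsNoetherianRing (P ⊗[K] P)] [Algebra.FormallySmooth P (P ⊗[K] P)]
    (hσ : ∀ ω, fromIdeal K P (σ ω) = ω) {d : ℕ} [Module.Finite P Ω[P⁄K]]
    [Module.Projective P Ω[P⁄K]] (hd : ∀ (p : Ideal P) (_ : p.IsPrime),
      Module.rank (Localization.AtPrime p) (LocalizedModule p.primeCompl (Ω[P⁄K])) = d)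
    (p : Ideal (P ⊗[K] P)) (hp : p.IsPrime) (hle : ideal K P ≤ p) :
    ∃ (m : Fin d → (P ⊗[K] P) ⊗[P] Ω[P⁄K])
      (l : Fin d → Module.Dual (P ⊗[K] P) ((P ⊗[K] P) ⊗[P] Ω[P⁄K])),
      ∃ u ∉ p, (∀ i j, l i (m j) = if i = j then u else 0) ∧ (∀ v, u • v = ∑ i, l i v • m i) ∧
      ∀ (t : Finset (Fin d)) (i : Fin d) (r : P ⊗[K] P), i ∉ t →
        extend σ (m i) * r ∈ Ideal.span ((fun k => extend σ (m k)) '' (t : Set (Fin d))) →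
        ∃ w ∉ p, w * r ∈ Ideal.span ((fun k => extend σ (m k)) '' (t : Set (Fin d))) := by
  obtain ⟨m, l, u, hu, hlm, hm⟩ := Module.exists_local_frame (p.comap (algebraMap P (P ⊗[K] P)))
    (hd _ (hp.comap _))
  refine ⟨fun i => 1 ⊗ₜ m i, fun i =>
    LinearMap.liftBaseChange (P ⊗[K] P) (Algebra.linearMap P (P ⊗[K] P) ∘ₗ l i),
    algebraMap P (P ⊗[K] P) u, hu, fun i j => ?_, fun v => ?_, fun t i r hi h => ?_⟩
  · rw [LinearMap.liftBaseChange_tmul, one_smul, LinearMap.comp_apply, hlm, apply_ite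
      (Algebra.linearMap P (P ⊗[K] P)), map_zero, Algebra.linearMap_apply]
  · induction v with
    | zero => simp
    | add v v' hv hv' => simp only [smul_add, hv, hv', map_add, add_smul, Finset.sum_add_distrib]
    | tmul a ω =>
      rw [algebraMap_smul, ← tmul_smul, hm, tmul_sum]
      refine Finset.sum_congr rfl fun i _ => ?_
      rw [LinearMap.liftBaseChange_tmul, smul_assoc, LinearMap.comp_apply, Algebra.linearMap_apply,
        algebraMap_smul, tmul_smul, smul_comm a, smul_tmul' a, smul_eq_mul, mul_one]
  · choose D hD using fun i => exists_derivation_lmul' (l i)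
    simp only [extend_one_tmul] at h ⊢
    refine exists_mul_mem_span_of_derivation (A := P) p (x := fun i => (σ (m i) : P ⊗[K] P))
      (fun i => hle (σ (m i)).2) (D := D) (u := algebraMap P (P ⊗[K] P) u) hu (fun i j => hle ?_)
      t (by simpa using hi) h
    rw [RingHom.mem_ker, map_sub, hD, hσ, hlm]
    split_ifs <;> simp
end KaehlerDifferential

namespace exteriorPower
variable {A R V : Type*} [CommRing A] [CommRing R] [Algebra A R] [AddCommGroup V] [Module A V]
  {n : ℕ}

theorem eq_zero_of_ιMulti_one_tmul {N : Type*} [AddCommGroup N] [Module R N]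
    {φ : ⋀[R]^n (R ⊗[A] V) →ₗ[R] N} (h : ∀ v : Fin n → V, φ (ιMulti R n fun i => 1 ⊗ₜ v i) = 0) :
    φ = 0 := by
  have hspan : Submodule.span R (Set.range fun v : V => (1 : R) ⊗ₜ[A] v) = ⊤ := by
    refine eq_top_iff.mpr fun x _ => ?_
    induction x with
    | zero => exact zero_mem _
    | add x y hx hy => exact add_mem (hx trivial) (hy trivial)
    | tmul r v =>
      rw [← mul_one r, ← smul_eq_mul, ← smul_tmul']
      exact Submodule.smul_mem _ _ (Submodule.subset_span ⟨v, rfl⟩)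
  refine LinearMap.ext_on (ιMulti_span_of_span R n _ hspan) ?_
  rintro _ ⟨w, hw, rfl⟩
  choose v hv using fun i => hw ⟨i, rfl⟩
  rw [← funext hv]
  exact h v

variable [Algebra R A]

theorem exists_comp_ιMulti_one_tmul (h : ∀ a : A, algebraMap R A (algebraMap A R a) = a)
    (g : V [⋀^Fin n]→ₗ[A] A) : ∃ φ : ⋀[R]^n (R ⊗[A] V) →ₗ[R] A,
      ∀ v : Fin n → V, φ (ιMulti R n fun i => 1 ⊗ₜ v i) = g v := by
  let _ : Module R V := Module.compHom V (algebraMap R A)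
  have hsmul (r : R) (v : V) : r • v = algebraMap R A r • v := rfl
  have : IsScalarTower A R V := ⟨fun a r v => by
    rw [hsmul, hsmul, Algebra.smul_def, map_mul, h, mul_smul]⟩
  let ρ : R ⊗[A] V →ₗ[R] V := LinearMap.liftBaseChange R (LinearMap.id : V →ₗ[A] V)
  let g' : V [⋀^Fin n]→ₗ[R] A :=
    { toFun := g
      map_update_add' := g.map_update_add'
      map_update_smul' := fun m i c x => by
        rw [Algebra.smul_def]
        exact g.map_update_smul' m i (algebraMap R A c) x
      map_eq_zero_of_eq' := fun v i j => g.map_eq_zero_of_eq v }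
  refine ⟨alternatingMapLinearEquiv (g'.compLinearMap ρ), fun v => ?_⟩
  rw [alternatingMapLinearEquiv_apply_ιMulti]
  change g (fun i => ρ (1 ⊗ₜ v i)) = g v
  simp [ρ]

/-- When `R` retracts onto `A`, linear forms on an exterior power over `A` agree with `A`-valued
linear maps on the exterior power of the base change to `R`. -/
theorem nonempty_dual_equiv (h : ∀ a : A, algebraMap R A (algebraMap A R a) = a) :
    Nonempty ((⋀[R]^n (R ⊗[A] V) →ₗ[R] A) ≃ₗ[A] Module.Dual A (⋀[A]^n V)) := by
  have : IsScalarTower A R A := ⟨fun a r b => by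
    simp only [Algebra.smul_def, map_mul, h, Algebra.algebraMap_self_apply, mul_assoc]⟩
  let res (φ : ⋀[R]^n (R ⊗[A] V) →ₗ[R] A) : V [⋀^Fin n]→ₗ[A] A :=
    { ((φ.compMultilinearMap (ιMulti R n).toMultilinearMap).restrictScalars A).compLinearMap
        fun _ => TensorProduct.mk A R V 1 with
      map_eq_zero_of_eq' := fun v i j hv hij => by
        change φ (ιMulti R n fun i => 1 ⊗ₜ v i) = 0
        rw [(ιMulti R n).map_eq_zero_of_eq (fun i => (1 : R) ⊗ₜ[A] v i)
          (congrArg (fun x => (1 : R) ⊗ₜ[A] x) hv) hij, map_zero] }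
  let Φ : (⋀[R]^n (R ⊗[A] V) →ₗ[R] A) →ₗ[A] (V [⋀^Fin n]→ₗ[A] A) :=
    { toFun := res
      map_add' := fun _ _ => rfl
      map_smul' := fun _ _ => rfl }
  refine ⟨LinearEquiv.ofBijective Φ ⟨?_, ?_⟩ ≪≫ₗ alternatingMapLinearEquiv⟩
  · rw [← LinearMap.ker_eq_bot, LinearMap.ker_eq_bot']
    exact fun φ hφ => eq_zero_of_ιMulti_one_tmul fun v => congrArg (fun g => g v) hφ
  · intro g
    obtain ⟨φ, hφ⟩ := exists_comp_ιMulti_one_tmul h g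
    exact ⟨φ, AlternatingMap.ext hφ⟩

end exteriorPower

namespace KaehlerDifferential

theorem nonempty_ext_equiv_exteriorPower {K P : Type} [CommRing K] [CommRing P] [Algebra K P]
    [IsNoetherianRing (P ⊗[K] P)] [Algebra.FormallySmooth P (P ⊗[K] P)]
    [Module.Finite P Ω[P⁄K]] [Module.Projective P Ω[P⁄K]] {d : ℕ}
    (hd : ∀ (p : Ideal P) (_ : p.IsPrime),
      Module.rank (Localization.AtPrime p) (LocalizedModule p.primeCompl (Ω[P⁄K])) = d) :
    let _ : Algebra (P ⊗[K] P) P := (Algebra.TensorProduct.lmul' (S := P) K).toRingHom.toAlgebra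
    Nonempty ((((Ext (P ⊗[K] P) (ModuleCat (P ⊗[K] P)) d).obj
        (Opposite.op (ModuleCat.of (P ⊗[K] P) P))).obj (ModuleCat.of (P ⊗[K] P) (P ⊗[K] P)))
      ≃ₗ[P ⊗[K] P] (⋀[P ⊗[K] P]^d ((P ⊗[K] P) ⊗[P] Ω[P⁄K]) →ₗ[P ⊗[K] P] P)) := by
  intro _
  obtain ⟨σ, hσ⟩ := exists_section (K := K) (P := P)
  let π := Algebra.linearMap (P ⊗[K] P) P
  have hπ : Function.Surjective π := fun a => ⟨a ⊗ₜ 1, by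
    change Algebra.TensorProduct.lmul' (S := P) K (a ⊗ₜ 1) = a
    simp⟩
  have hI : LinearMap.ker π = ideal K P := rfl
  have h : ∀ x, π (extend σ x) = 0 := fun x => extend_mem x
  have hproj (n : ℕ) : Module.Projective (P ⊗[K] P)
      ((AugmentedComplex.koszul (extend σ) π h).obj n) :=
    exteriorPower.projective_s6 n
  have hfin : Module.Finite (P ⊗[K] P) ((AugmentedComplex.koszul (extend σ) π h).obj d) :=
    exteriorPower.instFinite
  obtain ⟨f, hf, hex, hkill, hs⟩ := AugmentedComplex.exists_exactUpTo_koszul h hπ hI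
    (ideal_le_range_extend_sup hσ) (exists_extend_frame hσ hd)
  refine AugmentedComplex.nonempty_ext_equiv hπ hI hf hex
    (AugmentedComplex.koszul_d_mem h extend_mem) (fun y => Subtype.ext (hkill _ y.2)) ?_
  intro x hx g
  obtain ⟨m, hm⟩ := hs x hx
  rw [pow_two, mul_assoc, ← hm]
  exact AugmentedComplex.smul_mem_coboundaries_koszul h hkill m g

end KaehlerDifferential

theorem stmt6 (K P : Type) [CommRing K] [CommRing P] [IsNoetherianRing K]
    [IsNoetherianRing P] [Algebra K P] (d : ℕ)
    (hsm : EssentiallySmooth K P) (hd : RelDim K P d) :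
    letI : Algebra (P ⊗[K] P) P :=
      (Algebra.TensorProduct.lmul' (S := P) K).toRingHom.toAlgebra
    letI E := (((Ext (P ⊗[K] P) (ModuleCat (P ⊗[K] P)) d).obj
        (Opposite.op (ModuleCat.of (P ⊗[K] P) P))).obj
          (ModuleCat.of (P ⊗[K] P) (P ⊗[K] P)))
    letI : Module P E := Module.compHom E
      (Algebra.TensorProduct.includeLeftRingHom : P →+* P ⊗[K] P)
    Nonempty ((⋀[P]^d (Ω[P⁄K])) ≃ₗ[P] (E →ₗ[P] P)) := by
  have : Algebra.EssFiniteType K P := hsm.1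
  have : Algebra.FormallySmooth K P := hsm.2.2
  have : Module.Finite P Ω[P⁄K] := hd.1
  have : Module.Projective P Ω[P⁄K] := hd.2.1
  have : IsNoetherianRing (P ⊗[K] P) := Algebra.EssFiniteType.isNoetherianRing P (P ⊗[K] P)
  let _ : Algebra (P ⊗[K] P) P :=
    (Algebra.TensorProduct.lmul' (S := P) K).toRingHom.toAlgebra
  let E := (((Ext (P ⊗[K] P) (ModuleCat (P ⊗[K] P)) d).obj
      (Opposite.op (ModuleCat.of (P ⊗[K] P) P))).obj (ModuleCat.of (P ⊗[K] P) (P ⊗[K] P)))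
  let _ : Module P E := Module.compHom E
    (Algebra.TensorProduct.includeLeftRingHom : P →+* P ⊗[K] P)
  obtain ⟨e⟩ := KaehlerDifferential.nonempty_ext_equiv_exteriorPower hd.2.2
  obtain ⟨e'⟩ := exteriorPower.nonempty_dual_equiv (A := P) (R := P ⊗[K] P) (V := Ω[P⁄K]) (n := d)
    (fun a => by
      change Algebra.TensorProduct.lmul' (S := P) K (a ⊗ₜ 1) = a
      simp)
  let ε : E ≃ₗ[P] (⋀[P ⊗[K] P]^d ((P ⊗[K] P) ⊗[P] Ω[P⁄K]) →ₗ[P ⊗[K] P] P) :=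
    { e with
      map_smul' := fun a x => LinearMap.ext fun y => by
        have h : e ((a ⊗ₜ[K] (1 : P)) • x) y =
            Algebra.TensorProduct.lmul' (S := P) K (a ⊗ₜ 1) * e x y := by
          rw [map_smul]
          rfl
        rw [Algebra.TensorProduct.lmul'_apply_tmul, mul_one] at h
        exact h }
  have : Module.Projective P (⋀[P]^d Ω[P⁄K]) := exteriorPower.projective_s6 d
  exact ⟨Module.evalEquiv P (⋀[P]^d Ω[P⁄K]) ≪≫ₗ (ε ≪≫ₗ e').dualMap⟩
end

section
/- Let R be an associative ring and M a complex of R-modules such that the graded R-module H(M) is projective in each degree. Then there exists a morphism of complexes H(M) → M (viewing H(M) as a complex with zero differential) inducing the identity on homology, and this morphism is unique up to homotopy; consequently there is a unique isomorphism α : H(M) → M in the derived category D(R) with H(α) = id. -/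
/-!
STATEMENT 9: Let `R` be an associative ring and `M` a complex of `R`-modules whose
homology modules are all projective.  Viewing `H(M)` as a complex with zero
differentials, there is a morphism of complexes `H(M) → M` inducing the identity on
homology; it is unique up to homotopy, and there is a unique isomorphism
`α : H(M) → M` in the derived category `D(R)` with `H(α) = id`.
-/

open CategoryTheory

noncomputable section

variable {R : Type} [Ring R]

/-- The homology of `M`, viewed as a complex with zero differentials. -/
def homologyCx (M : CochainComplex (ModuleCat R) ℤ) : CochainComplex (ModuleCat R) ℤ where
  X i := M.homology i
  d _ _ := 0
  shape := by intros; rfl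
  d_comp_d' := by intros; simp

/-- The canonical identification of the homology of `homologyCx M` with its terms. -/
def zIso (M : CochainComplex (ModuleCat R) ℤ) (i : ℤ) :
    (homologyCx M).homology i ≅ (homologyCx M).X i :=
  (ShortComplex.HomologyData.ofZeros ((homologyCx M).sc i) rfl rfl).left.homologyIso

/-- `φ : H(M) ⟶ M` induces the identity of `H(M)` on homology. -/
def InducesIdOnHomology (M : CochainComplex (ModuleCat R) ℤ)
    (φ : homologyCx M ⟶ M) : Prop :=
  ∀ i, HomologicalComplex.homologyMap φ i = (zIso M i).hom

section ZeroDifferential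

variable {C : Type*} [Category* C] [Abelian C] {K N : CochainComplex C ℤ}

/-- Out of a complex of projective objects with zero differentials, every family of morphisms
on homology is induced by a morphism of complexes. -/
lemma exists_homologyMap_eq_of_d_eq_zero [∀ i, Projective (K.X i)] (hK : ∀ i j, K.d i j = 0)
    (a : ∀ i, K.homology i ⟶ N.homology i) :
    ∃ φ : K ⟶ N, ∀ i, HomologicalComplex.homologyMap φ i = a i := by
  let s (i : ℤ) : K.X i ⟶ N.cycles i := Projective.factorThru
    ((K.iCyclesIso i _ rfl (hK _ _)).inv ≫ K.homologyπ i ≫ a i) (N.homologyπ i)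
  have hs (i : ℤ) : s i ≫ N.homologyπ i =
      (K.iCyclesIso i _ rfl (hK _ _)).inv ≫ K.homologyπ i ≫ a i :=
    Projective.factorThru_comp _ _
  let φ : K ⟶ N :=
    { f i := s i ≫ N.iCycles i
      comm' i j _ := by simp [hK] }
  refine ⟨φ, fun i ↦ ?_⟩
  have hφ : HomologicalComplex.cyclesMap φ i = K.iCycles i ≫ s i := by
    simp [← cancel_mono (N.iCycles i), φ]
  rw [← cancel_epi (K.homologyπ i), HomologicalComplex.homologyπ_naturality, hφ, Category.assoc,
    hs, HomologicalComplex.iCyclesIso_hom_inv_id_assoc]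

/-- A morphism into the `i`-th term of a complex which factors through the cycles and vanishes in
homology lifts along the differential, if its source is projective. -/
lemma exists_comp_d_eq {P : C} [Projective P] {i j : ℤ} (hij : j + 1 = i) (z : P ⟶ N.cycles i)
    (hz : z ≫ N.homologyπ i = 0) : ∃ t : P ⟶ N.X j, t ≫ N.d j i = z ≫ N.iCycles i := by
  let S := ShortComplex.mk _ _ (N.toCycles_comp_homologyπ j i)
  have hS : S.Exact :=
    S.exact_of_g_is_cokernel (N.homologyIsCokernel j i (by simp [← hij]))
  refine ⟨hS.liftFromProjective z hz, ?_⟩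
  rw [← N.toCycles_i j i]
  exact hS.liftFromProjective_comp_assoc z hz _

/-- Morphisms out of a complex of projective objects with zero differentials are homotopic
as soon as they agree on homology. -/
lemma nonempty_homotopy_of_d_eq_zero [∀ i, Projective (K.X i)] (hK : ∀ i j, K.d i j = 0)
    {φ ψ : K ⟶ N}
    (h : ∀ i, HomologicalComplex.homologyMap φ i = HomologicalComplex.homologyMap ψ i) :
    Nonempty (Homotopy φ ψ) := by
  have key (i j : ℤ) (hij : j + 1 = i) : ∃ t : K.X i ⟶ N.X j, t ≫ N.d j i = (φ - ψ).f i := by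
    obtain ⟨t, ht⟩ := exists_comp_d_eq (N := N) hij
      ((K.iCyclesIso i _ rfl (hK _ _)).inv ≫ HomologicalComplex.cyclesMap (φ - ψ) i) (by
        rw [Category.assoc, ← HomologicalComplex.homologyπ_naturality,
          HomologicalComplex.homologyMap_sub, h, sub_self, Limits.comp_zero, Limits.comp_zero])
    refine ⟨t, ?_⟩
    rw [ht, Category.assoc, HomologicalComplex.cyclesMap_i,
      HomologicalComplex.iCyclesIso_inv_hom_id_assoc]
  choose t ht using key
  refine ⟨{
    hom i j := if hij : j + 1 = i then t i j hij else 0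
    zero i j hij := dif_neg hij
    comm i := ?_ }⟩
  have hij : i - 1 + 1 = i := sub_add_cancel i 1
  rw [dNext_eq _ (show (ComplexShape.up ℤ).Rel i (i + 1) from rfl),
    prevD_eq _ (show (ComplexShape.up ℤ).Rel (i - 1) i from hij), hK, Limits.zero_comp, zero_add, dif_pos hij, ht]
  simp

/-- Morphisms in the derived category out of a complex of projective objects with zero
differentials are represented by morphisms of complexes. -/
lemma exists_Q_map_eq_of_d_eq_zero [HasDerivedCategory C] [∀ i, Projective (K.X i)]
    (hK : ∀ i j, K.d i j = 0) (α : DerivedCategory.Q.obj K ⟶ DerivedCategory.Q.obj N) :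
    ∃ φ : K ⟶ N, DerivedCategory.Q.map φ = α := by
  obtain ⟨X, s, hs, g, rfl⟩ := DerivedCategory.right_fac α
  have : QuasiIso s := (DerivedCategory.isIso_Q_map_iff_quasiIso _ s).1 hs
  obtain ⟨σ, hσ⟩ := exists_homologyMap_eq_of_d_eq_zero (N := X) hK
    fun i ↦ inv (HomologicalComplex.homologyMap s i)
  obtain ⟨H⟩ := nonempty_homotopy_of_d_eq_zero (φ := σ ≫ s) (ψ := 𝟙 K) hK fun i ↦ by
    simp [HomologicalComplex.homologyMap_comp, hσ]
  have hQ := DerivedCategory.Q_map_eq_of_homotopy _ H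
  rw [Functor.map_comp, CategoryTheory.Functor.map_id] at hQ
  refine ⟨σ ≫ g, ?_⟩
  rw [Functor.map_comp, IsIso.eq_inv_of_inv_hom_id hQ]

end ZeroDifferential

lemma homologyFunctor_map_Q_map_eq_iff {C : Type*} [Category* C] [Abelian C]
    [HasDerivedCategory C] {K N : CochainComplex C ℤ} (φ : K ⟶ N) (i : ℤ)
    (a : K.homology i ⟶ N.homology i) :
    (DerivedCategory.homologyFunctor C i).map (DerivedCategory.Q.map φ) =
        (DerivedCategory.homologyFunctorFactors C i).hom.app K ≫ a ≫
          (DerivedCategory.homologyFunctorFactors C i).inv.app N ↔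
      HomologicalComplex.homologyMap φ i = a := by
  let eK : (DerivedCategory.homologyFunctor C i).obj (DerivedCategory.Q.obj K) ≅ K.homology i :=
    (DerivedCategory.homologyFunctorFactors C i).app K
  let eN : (DerivedCategory.homologyFunctor C i).obj (DerivedCategory.Q.obj N) ≅ N.homology i :=
    (DerivedCategory.homologyFunctorFactors C i).app N
  have h : (DerivedCategory.homologyFunctor C i).map (DerivedCategory.Q.map φ) ≫ eN.hom =
      eK.hom ≫ HomologicalComplex.homologyMap φ i :=
    DerivedCategory.homologyFunctorFactors_hom_naturality φ i
  change _ = eK.hom ≫ a ≫ eN.inv ↔ _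
  rw [← Category.assoc, Iso.eq_comp_inv, h, cancel_epi]

lemma InducesIdOnHomology.quasiIso {M : CochainComplex (ModuleCat R) ℤ} {φ : homologyCx M ⟶ M}
    (h : InducesIdOnHomology M φ) : QuasiIso φ := by
  rw [quasiIso_iff]
  intro i
  rw [quasiIsoAt_iff_isIso_homologyMap, h i]
  exact (zIso M i).isIso_hom

theorem stmt9 (M : CochainComplex (ModuleCat R) ℤ)
    (hproj : ∀ i, Projective (M.homology i)) :
    -- existence
    (∃ φ : homologyCx M ⟶ M, InducesIdOnHomology M φ) ∧
    -- uniqueness up to homotopy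
    (∀ φ ψ : homologyCx M ⟶ M, InducesIdOnHomology M φ → InducesIdOnHomology M ψ →
      Nonempty (Homotopy φ ψ)) ∧
    -- unique isomorphism in the derived category inducing the identity on homology
    (letI := HasDerivedCategory.standard (ModuleCat R)
     ∃! α : DerivedCategory.Q.obj (homologyCx M) ⟶ DerivedCategory.Q.obj M,
       IsIso α ∧ ∀ i, (DerivedCategory.homologyFunctor (ModuleCat R) i).map α =
         ((DerivedCategory.homologyFunctorFactors (ModuleCat R) i).hom.app (homologyCx M)) ≫
           (zIso M i).hom ≫
             ((DerivedCategory.homologyFunctorFactors (ModuleCat R) i).inv.app M)) := by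
  have (i : ℤ) : Projective ((homologyCx M).X i) := hproj i
  have hd (i j : ℤ) : (homologyCx M).d i j = 0 := rfl
  have huniq (φ ψ : homologyCx M ⟶ M) (hφ : InducesIdOnHomology M φ)
      (hψ : InducesIdOnHomology M ψ) : Nonempty (Homotopy φ ψ) :=
    nonempty_homotopy_of_d_eq_zero hd fun i ↦ (hφ i).trans (hψ i).symm
  obtain ⟨φ, hφ⟩ : ∃ φ : homologyCx M ⟶ M, InducesIdOnHomology M φ :=
    exists_homologyMap_eq_of_d_eq_zero hd fun i ↦ (zIso M i).hom
  refine ⟨⟨φ, hφ⟩, huniq, ?_⟩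
  let := HasDerivedCategory.standard (ModuleCat R)
  have := hφ.quasiIso
  refine ⟨DerivedCategory.Q.map φ, ⟨inferInstance, fun i ↦
    (homologyFunctor_map_Q_map_eq_iff φ i _).2 (hφ i)⟩, ?_⟩
  rintro β ⟨-, hβ⟩
  obtain ⟨ψ, rfl⟩ := exists_Q_map_eq_of_d_eq_zero hd β
  obtain ⟨H⟩ := huniq ψ φ (fun i ↦ (homologyFunctor_map_Q_map_eq_iff ψ i _).1 (hβ i)) hφ
  exact DerivedCategory.Q_map_eq_of_homotopy _ H

end
end
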